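/- arXiv:2410.04389 — 7 statements merged into one kernel-verified Lean document; each statement's English description precedes it below -/
import Mathlib

section
/- Let G be a bridgeless cubic graph and M a perfect matching of G. If there exists a non-conflicting nowhere-zero Z2×Z2 flow with respect to M, then G admits a normal 6-edge-coloring, i.e. a proper edge-coloring with at most 6 colors in which every edge is poor or rich. -/
open scoped Classical

/-- The Klein four-group `Z2 × Z2`. -/
abbrev K4 : Type := ZMod 2 × ZMod 2

/-- `α = (1,0)`. -/
def flowAlpha : K4 := (1, 0)

/-- `β = (0,1)`. -/
def flowBeta : K4 := (0, 1)

/-- A graph is bridgeless if no edge is a bridge, i.e. deleting any single edge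
does not increase the number of connected components. -/
def SimpleGraph.Bridgeless {V : Type} (G : SimpleGraph V) : Prop :=
  ∀ e : Sym2 V, ¬ G.IsBridge e

/-- The complementary 2-factor `G − M`: the spanning subgraph of `G` with
edge set `E(G) \ M`. -/
def compl2Factor {V : Type} (G : SimpleGraph V) (M : G.Subgraph) : SimpleGraph V :=
  G.deleteEdges M.edgeSet

/-- A nowhere-zero `Z2 × Z2` flow with respect to a perfect matching `M`, encoded as a
vertex function: `θ v` is the flow value of the unique `M`-edge `e_v` incident to `v`
(so `θ` is constant on the two endpoints of each matching edge, nonzero everywhere,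
and sums to zero over every connected component of `G − M`). -/
def IsNZFlowWrt {V : Type} [Fintype V] (G : SimpleGraph V) (M : G.Subgraph)
    (θ : V → K4) : Prop :=
  (∀ ⦃u v : V⦄, M.Adj u v → θ u = θ v) ∧
  (∀ v : V, θ v ≠ 0) ∧
  (∀ u : V, ∑ v ∈ Finset.univ.filter (fun w => (compl2Factor G M).Reachable u w), θ v = 0)

/-- `θ` is non-conflicting: there is no edge `uv ∈ E(G) \ M` with
`θ(e_u) = α` and `θ(e_v) = β`. -/
def NonConflicting {V : Type} (G : SimpleGraph V) (M : G.Subgraph) (θ : V → K4) : Prop :=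
  ¬ ∃ u v : V, G.Adj u v ∧ ¬ M.Adj u v ∧ θ u = flowAlpha ∧ θ v = flowBeta

/-- The set of colors appearing on the edges incident to `v`. -/
noncomputable def colorsAt {V : Type} [Fintype V] {k : ℕ} (G : SimpleGraph V)
    (c : Sym2 V → Fin k) (v : V) : Finset (Fin k) :=
  (Finset.univ.filter (fun w => G.Adj v w)).image (fun w => c s(v, w))

/-- A proper edge-coloring: edges sharing a vertex receive different colors. -/
def IsProperEdgeColoring {V : Type} {k : ℕ} (G : SimpleGraph V) (c : Sym2 V → Fin k) : Prop :=
  ∀ ⦃u v w : V⦄, G.Adj u v → G.Adj u w → v ≠ w → c s(u, v) ≠ c s(u, w)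

/-- `G` has a normal `k`-edge-coloring: a proper edge-coloring with at most `k` colors
in which every edge `uv` is poor (`|S_c(u) ∪ S_c(v)| = 3`) or rich (`|S_c(u) ∪ S_c(v)| = 5`). -/
def HasNormalColoring {V : Type} [Fintype V] (G : SimpleGraph V) (k : ℕ) : Prop :=
  ∃ c : Sym2 V → Fin k, IsProperEdgeColoring G c ∧
    ∀ ⦃u v : V⦄, G.Adj u v →
      ((colorsAt G c u ∪ colorsAt G c v).card = 3 ∨ (colorsAt G c u ∪ colorsAt G c v).card = 5)

/-- The boundary of a `K4`-valued function on the edges of a graph: at each vertex, the sum of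
the values on the incident edges. -/
noncomputable def edgeBoundary {V : Type} [Fintype V] (H : SimpleGraph V) :
    (Sym2 V → K4) →+ (V → K4) where
  toFun f v := ∑ w ∈ Finset.univ.filter (fun w => H.Adj v w), f s(v, w)
  map_zero' := by ext v <;> simp
  map_add' f g := by
    funext v
    simp [Finset.sum_add_distrib]

lemma K4.add_self (x : K4) : x + x = 0 := by
  revert x; decide

/-- The boundary of a single edge is supported, with equal values, on its two ends. -/
lemma edgeBoundary_single {V : Type} [Fintype V] (H : SimpleGraph V) {a b : V}
    (h : H.Adj a b) (x : K4) :
    edgeBoundary H (Pi.single s(a, b) x) = Pi.single a x + Pi.single b x := by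
  have hab : a ≠ b := h.ne
  funext v
  change ∑ w ∈ Finset.univ.filter (fun w => H.Adj v w),
    (Pi.single s(a, b) x : Sym2 V → K4) s(v, w) = _
  simp only [Pi.add_apply, Pi.single_apply, Sym2.eq_iff]
  by_cases hva : v = a
  · subst hva
    simp [hab, h]
  · by_cases hvb : v = b
    · subst hvb
      simp [hva, h.symm]
    · simp [hva, hvb]

lemma single_add_single_mem_range_edgeBoundary {V : Type} [Fintype V] (H : SimpleGraph V)
    {a b : V} (h : H.Reachable a b) (x : K4) :
    (Pi.single a x + Pi.single b x : V → K4) ∈ (edgeBoundary H).range := by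
  obtain ⟨p⟩ := h
  induction p with
  | nil =>
    rw [← Pi.single_add, K4.add_self, Pi.single_zero]
    exact zero_mem _
  | @cons u v w huv p ih =>
    have h1 : (Pi.single u x + Pi.single v x : V → K4) ∈ (edgeBoundary H).range :=
      ⟨_, edgeBoundary_single H huv x⟩
    have h2 := add_mem h1 ih
    have h3 : (Pi.single v x + Pi.single v x : V → K4) = 0 := by
      rw [← Pi.single_add, K4.add_self, Pi.single_zero]
    rwa [add_assoc, ← add_assoc (Pi.single v x : V → K4), h3, zero_add] at h2

/-- A vertex function whose sum over every connected component vanishes is a boundary. -/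
lemma mem_range_edgeBoundary {V : Type} [Fintype V] (H : SimpleGraph V) (θ : V → K4)
    (hθ : ∀ u : V, ∑ v ∈ Finset.univ.filter (fun w => H.Reachable u w), θ v = 0) :
    θ ∈ (edgeBoundary H).range := by
  let r : V → V := fun v => (H.connectedComponentMk v).out
  have hr : ∀ v, H.connectedComponentMk (r v) = H.connectedComponentMk v :=
    fun v => Quot.out_eq _
  have hreach : ∀ v, H.Reachable v (r v) :=
    fun v => (SimpleGraph.ConnectedComponent.exact (hr v)).symm
  have hzero : ∑ v, (Pi.single (r v) (θ v) : V → K4) = 0 := by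
    funext w
    rw [Finset.sum_apply, Pi.zero_apply]
    simp only [Pi.single_apply]
    rw [← Finset.sum_filter]
    by_cases hw : r w = w
    · rw [← hθ w]
      congr 1
      ext v
      simp only [Finset.mem_filter, Finset.mem_univ, true_and]
      constructor
      · intro h
        have := (hreach v).symm
        rwa [← h] at this
      · intro h
        have h1 : H.connectedComponentMk w = H.connectedComponentMk v :=
          SimpleGraph.ConnectedComponent.sound h
        rw [← hw]
        simp only [r, h1]
    · apply Finset.sum_eq_zero
      intro v hv
      exfalso
      apply hw
      have h : w = r v := (Finset.mem_filter.mp hv).2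
      have h1 := hr v
      rw [← h] at h1
      rw [h]
      simp only [r, h1, ← h]
  have hsum : θ = ∑ v, ((Pi.single v (θ v) + Pi.single (r v) (θ v) : V → K4)) := by
    rw [Finset.sum_add_distrib, hzero, add_zero, Finset.univ_sum_single]
  rw [hsum]
  exact sum_mem fun v _ => single_add_single_mem_range_edgeBoundary H (hreach v) _

/-- The colors around a vertex of flow value `t` having an edge of the 2-factor colored `a`.
Edges of the 2-factor use colors in `K4`; matching edges use one of two further colors, depending
on whether their flow value is `α + β`. -/
def localPalette (a t : K4) : Finset (K4 ⊕ Bool) :=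
  {Sum.inl a, Sum.inl (a + t), Sum.inr (decide (t = (1, 1)))}

lemma card_localPalette_union_of_same_flow :
    ∀ a b t : K4, t ≠ 0 → (localPalette a t ∪ localPalette b t).card = 3 ∨
      (localPalette a t ∪ localPalette b t).card = 5 := by
  decide

lemma card_localPalette_union_of_same_edge :
    ∀ a s t : K4, s ≠ 0 → t ≠ 0 → ¬ (s = (1, 0) ∧ t = (0, 1)) → ¬ (t = (1, 0) ∧ s = (0, 1)) →
      (localPalette a s ∪ localPalette a t).card = 3 ∨
      (localPalette a s ∪ localPalette a t).card = 5 := by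
  decide

/-- In a cubic graph with a perfect matching, every vertex has one matching neighbor and two
neighbors along the complementary 2-factor. -/
lemma exists_neighbors_of_isPerfectMatching {V : Type} [Fintype V] {G : SimpleGraph V}
    (hcubic : G.IsRegularOfDegree 3) {M : G.Subgraph} (hM : M.IsPerfectMatching) (v : V) :
    ∃ x y z : V, x ≠ y ∧ M.Adj v z ∧ (∀ w, G.Adj v w ↔ w = x ∨ w = y ∨ w = z) ∧
      (∀ w, (compl2Factor G M).Adj v w ↔ w = x ∨ w = y) := by
  obtain ⟨z, hz, hzu⟩ := hM.1 (hM.2 v)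
  have hmem : z ∈ G.neighborFinset v := by simpa using hz.adj_sub
  have hcard : ((G.neighborFinset v).erase z).card = 2 := by
    rw [Finset.card_erase_of_mem hmem, SimpleGraph.card_neighborFinset_eq_degree, hcubic v]
  obtain ⟨x, y, hxy, he⟩ := Finset.card_eq_two.mp hcard
  have hH : ∀ w, w ≠ z ∧ G.Adj v w ↔ w = x ∨ w = y := by
    intro w
    have := Finset.ext_iff.mp he w
    simpa using this
  have hMz : ∀ w, M.Adj v w ↔ w = z := fun w => ⟨hzu w, fun h => h ▸ hz⟩
  have hGz := hz.adj_sub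
  refine ⟨x, y, z, hxy, hz, fun w => ?_, fun w => ?_⟩
  · rw [← or_assoc, ← hH]
    by_cases h : w = z
    · subst h; simp [hGz]
    · simp [h]
  · rw [← hH]
    simp only [compl2Factor, SimpleGraph.deleteEdges_adj, SimpleGraph.Subgraph.mem_edgeSet, hMz]
    exact and_comm

/-- If a bridgeless cubic graph `G` with a perfect matching `M` admits a non-conflicting
nowhere-zero `Z2 × Z2` flow with respect to `M`, then `G` admits a normal 6-edge-coloring. -/
theorem stmt_0 {V : Type} [Fintype V] [DecidableEq V] (G : SimpleGraph V)
    (hbl : G.Bridgeless) (hcubic : G.IsRegularOfDegree 3)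
    (M : G.Subgraph) (hM : M.IsPerfectMatching)
    (θ : V → K4) (hflow : IsNZFlowWrt G M θ) (hnc : NonConflicting G M θ) :
    HasNormalColoring G 6 := by
  obtain ⟨hθM, hθ0, hθsum⟩ := hflow
  obtain ⟨f, hf⟩ := mem_range_edgeBoundary (compl2Factor G M) θ hθsum
  let σ : K4 ⊕ Bool ≃ Fin 6 := Fintype.equivFinOfCardEq (by decide)
  let d : Sym2 V → K4 ⊕ Bool := fun e =>
    if e ∈ M.edgeSet then Sum.inr (decide (∃ w ∈ e, θ w = (1, 1))) else Sum.inl (f e)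
  have hdM : ∀ u v, M.Adj u v → d s(u, v) = Sum.inr (decide (θ u = (1, 1))) := by
    intro u v h
    have h1 := hθM h
    simp [d, h, ← h1]
  have hdH : ∀ u v, (compl2Factor G M).Adj u v → d s(u, v) = Sum.inl (f s(u, v)) := by
    intro u v h
    have h1 : ¬ M.Adj u v := by simpa using (SimpleGraph.deleteEdges_adj.mp h).2
    simp [d, h1]
  have hedges : ∀ v, ∃ x y z : V, (∀ w, G.Adj v w ↔ w = x ∨ w = y ∨ w = z) ∧
      (∀ w, (compl2Factor G M).Adj v w ↔ w = x ∨ w = y) ∧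
      d s(v, x) = Sum.inl (f s(v, x)) ∧ d s(v, y) = Sum.inl (f s(v, y)) ∧
      d s(v, z) = Sum.inr (decide (θ v = (1, 1))) ∧ f s(v, y) = f s(v, x) + θ v := by
    intro v
    obtain ⟨x, y, z, hxy, hz, hG, hH⟩ := exists_neighbors_of_isPerfectMatching hcubic hM v
    refine ⟨x, y, z, hG, hH, hdH _ _ ((hH x).2 (.inl rfl)), hdH _ _ ((hH y).2 (.inr rfl)),
      hdM _ _ hz, ?_⟩
    have hv : ∑ w ∈ Finset.univ.filter (fun w => (compl2Factor G M).Adj v w), f s(v, w) = θ v :=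
      congrFun hf v
    have hs : Finset.univ.filter (fun w => (compl2Factor G M).Adj v w) = {x, y} := by
      ext w; simp [hH]
    rw [hs, Finset.sum_pair hxy] at hv
    rw [← hv, ← add_assoc, K4.add_self, zero_add]
  have hpal : ∀ v w, (compl2Factor G M).Adj v w →
      colorsAt G (fun e => σ (d e)) v = (localPalette (f s(v, w)) (θ v)).map σ.toEmbedding := by
    intro v w hvw
    obtain ⟨x, y, z, hG, hH, hx, hy, hz, hxy⟩ := hedges v
    have hs : Finset.univ.filter (fun w => G.Adj v w) = {x, y, z} := by
      ext w; simp [hG]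
    unfold colorsAt
    rw [hs]
    rcases (hH w).1 hvw with rfl | rfl
    · ext i
      simp [localPalette, hx, hy, hz, hxy]
    · have hyx : f s(v, x) = f s(v, w) + θ v := by
        rw [hxy, add_assoc, K4.add_self, add_zero]
      ext i
      simp only [Finset.mem_image, Finset.mem_map, localPalette, Finset.mem_insert,
        Finset.mem_singleton, exists_eq_or_imp, exists_eq_left, hx, hy, hz, hyx,
        Equiv.coe_toEmbedding]
      tauto
  refine ⟨fun e => σ (d e), ?_, ?_⟩
  · intro u v w huv huw hvw h
    have h := σ.injective h
    obtain ⟨x, y, z, hG, hH, hx, hy, hz, hxy⟩ := hedges u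
    have hne : f s(u, x) ≠ f s(u, y) := by
      rw [hxy]
      intro h
      exact hθ0 u (left_eq_add.mp h)
    rcases (hG v).1 huv with rfl | rfl | rfl <;> rcases (hG w).1 huw with rfl | rfl | rfl <;>
      simp_all
  · intro u v huv
    by_cases hMuv : M.Adj u v
    · obtain ⟨x, _, _, _, hHu, _⟩ := hedges u
      obtain ⟨y, _, _, _, hHv, _⟩ := hedges v
      rw [hpal u x ((hHu x).2 (.inl rfl)), hpal v y ((hHv y).2 (.inl rfl)), ← Finset.map_union,
        Finset.card_map, ← hθM hMuv]
      exact card_localPalette_union_of_same_flow _ _ _ (hθ0 u)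
    · have hH : (compl2Factor G M).Adj u v :=
        SimpleGraph.deleteEdges_adj.mpr ⟨huv, by simpa using hMuv⟩
      rw [hpal u v hH, hpal v u hH.symm, Sym2.eq_swap, ← Finset.map_union, Finset.card_map]
      refine card_localPalette_union_of_same_edge _ _ _ (hθ0 u) (hθ0 v) ?_ ?_
      · exact fun h => hnc ⟨u, v, huv, hMuv, h.1, h.2⟩
      · exact fun h => hnc ⟨v, u, huv.symm, fun h' => hMuv h'.symm, h.1, h.2⟩
end

section
/- Let G be a bridgeless cubic graph and M a perfect matching of G. If some connected component of the complementary 2-factor G − M is a triangle (a cycle of length 3), then there is no non-conflicting nowhere-zero Z2×Z2 flow with respect to M. -/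
open scoped Classical

/-- In a cubic graph, a vertex has at most two neighbours outside a perfect matching. -/
theorem compl2Factor_adj_eq_or_eq {V : Type} [Fintype V] {G : SimpleGraph V}
    (hcubic : G.IsRegularOfDegree 3) {M : G.Subgraph} (hM : M.IsPerfectMatching)
    {x y z t : V} (hy : (compl2Factor G M).Adj x y) (hz : (compl2Factor G M).Adj x z)
    (hyz : y ≠ z) (ht : (compl2Factor G M).Adj x t) : t = y ∨ t = z := by
  obtain ⟨m, hm, -⟩ := SimpleGraph.Subgraph.isPerfectMatching_iff.1 hM x
  simp only [compl2Factor, SimpleGraph.deleteEdges_adj, SimpleGraph.Subgraph.mem_edgeSet]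
    at hy hz ht
  by_contra! hne
  have hsub : ({m, y, z, t} : Finset V) ⊆ G.neighborFinset x := by
    intro a ha
    simp only [Finset.mem_insert, Finset.mem_singleton] at ha
    rw [SimpleGraph.mem_neighborFinset]
    rcases ha with rfl | rfl | rfl | rfl
    exacts [hm.adj_sub, hy.1, hz.1, ht.1]
  have hcard := Finset.card_le_card hsub
  rw [SimpleGraph.card_neighborFinset_eq_degree, hcubic.degree_eq] at hcard
  have hmy : m ≠ y := fun h => hy.2 (h ▸ hm)
  have hmz : m ≠ z := fun h => hz.2 (h ▸ hm)
  have hmt : m ≠ t := fun h => ht.2 (h ▸ hm)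
  have hfour : ({m, y, z, t} : Finset V).card = 4 := by
    rw [Finset.card_insert_of_notMem (by simp [hmy, hmz, hmt]),
      Finset.card_insert_of_notMem (by simp [hyz, hne.1.symm]),
      Finset.card_pair hne.2.symm]
  omega

/-- A set of vertices closed under adjacency contains everything reachable from it. -/
theorem SimpleGraph.Reachable.mem_of_adj_closed {V : Type} {H : SimpleGraph V} {s : Set V}
    (hs : ∀ ⦃a b⦄, a ∈ s → H.Adj a b → b ∈ s) {a b : V} (hab : H.Reachable a b)
    (ha : a ∈ s) : b ∈ s := by
  obtain ⟨p⟩ := hab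
  induction p with
  | nil => exact ha
  | cons h _ ih => exact ih (hs ha h)

/-- Among three nonzero elements of the Klein four-group with sum zero, both `α` and `β`
occur. -/
theorem flowAlpha_flowBeta_of_add_eq_zero : ∀ a b c : K4, a ≠ 0 → b ≠ 0 → c ≠ 0 →
    a + b + c = 0 →
    (a = flowAlpha ∧ b = flowBeta) ∨ (b = flowAlpha ∧ a = flowBeta) ∨
    (b = flowAlpha ∧ c = flowBeta) ∨ (c = flowAlpha ∧ b = flowBeta) ∨
    (a = flowAlpha ∧ c = flowBeta) ∨ (c = flowAlpha ∧ a = flowBeta) := by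
  rintro ⟨a₁, a₂⟩ ⟨b₁, b₂⟩ ⟨c₁, c₂⟩
  simp only [flowAlpha, flowBeta, ne_eq, Prod.mk_add_mk, Prod.mk_eq_zero, Prod.mk.injEq]
  have h : ∀ x : ZMod 2, x = 0 ∨ x = 1 := Fin.forall_fin_two.2 ⟨Or.inl rfl, Or.inr rfl⟩
  have hthree : (1 + 1 + 1 : ZMod 2) = 1 := rfl
  rcases h a₁ with rfl | rfl <;> rcases h a₂ with rfl | rfl <;>
    rcases h b₁ with rfl | rfl <;> rcases h b₂ with rfl | rfl <;>
    rcases h c₁ with rfl | rfl <;> rcases h c₂ with rfl | rfl <;> simp [hthree]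

/-- If some connected component of the complementary 2-factor `G − M` of a bridgeless
cubic graph `G` is a triangle, then there is no non-conflicting nowhere-zero
`Z2 × Z2` flow with respect to `M`. -/
theorem stmt_1 {V : Type} [Fintype V] [DecidableEq V] (G : SimpleGraph V)
    (hbl : G.Bridgeless) (hcubic : G.IsRegularOfDegree 3)
    (M : G.Subgraph) (hM : M.IsPerfectMatching)
    (u v w : V)
    (h1 : (compl2Factor G M).Adj u v) (h2 : (compl2Factor G M).Adj v w)
    (h3 : (compl2Factor G M).Adj u w) :
    ¬ ∃ θ : V → K4, IsNZFlowWrt G M θ ∧ NonConflicting G M θ := by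
  rintro ⟨θ, ⟨-, hne, hsum⟩, hconf⟩
  have hno : ∀ {x y : V}, (compl2Factor G M).Adj x y →
      ¬ (θ x = flowAlpha ∧ θ y = flowBeta) := by
    intro x y hxy hθ
    rw [compl2Factor, SimpleGraph.deleteEdges_adj, SimpleGraph.Subgraph.mem_edgeSet] at hxy
    exact hconf ⟨x, y, hxy.1, hxy.2, hθ⟩
  have hcomp : ∀ x, (compl2Factor G M).Reachable u x ↔ x = u ∨ x = v ∨ x = w := by
    intro x
    constructor
    · intro hx
      refine hx.mem_of_adj_closed (s := {x | x = u ∨ x = v ∨ x = w}) ?_ (Or.inl rfl)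
      rintro a b (rfl | rfl | rfl) hab
      · exact Or.inr (compl2Factor_adj_eq_or_eq hcubic hM h1 h3 h2.ne hab)
      · rcases compl2Factor_adj_eq_or_eq hcubic hM h1.symm h2 h3.ne hab with h | h
        exacts [Or.inl h, Or.inr (Or.inr h)]
      · rcases compl2Factor_adj_eq_or_eq hcubic hM h3.symm h2.symm h1.ne hab with h | h
        exacts [Or.inl h, Or.inr (Or.inl h)]
    · rintro (rfl | rfl | rfl)
      exacts [SimpleGraph.Reachable.refl _, h1.reachable, h3.reachable]
  have hzero : θ u + θ v + θ w = 0 := by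
    rw [add_assoc, ← Finset.sum_pair h2.ne,
      ← Finset.sum_insert (by simp [h1.ne, h3.ne] : u ∉ ({v, w} : Finset V)), ← hsum u]
    exact Finset.sum_congr (by ext x; simp [hcomp]) fun _ _ => rfl
  rcases flowAlpha_flowBeta_of_add_eq_zero _ _ _ (hne u) (hne v) (hne w) hzero with
    h | h | h | h | h | h
  exacts [hno h1 h, hno h1.symm h, hno h2 h, hno h2.symm h, hno h3 h, hno h3.symm h]
end

section
/- Let G be a cubic graph and M a perfect matching of G such that there exists a non-conflicting nowhere-zero Z2×Z2 flow with respect to M. Then G admits a nowhere-zero Z2×Z2×Z2 flow f together with two distinct elements x, y ∈ (Z2)^3 such that (1) the set of edges with f-value x or y is a matching in G, and (2) there is no edge uv of G such that some edge incident to u has f-value x and some edge incident to v has f-value y. -/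
open scoped Classical

/-- The group `Z2 × Z2 × Z2`. -/
abbrev K8 : Type := ZMod 2 × ZMod 2 × ZMod 2

/-- A nowhere-zero `Z2 × Z2 × Z2` flow of `G`: a function on edges, nonzero on every
edge of `G`, whose values sum to zero around every vertex. -/
def IsNZ8Flow {V : Type} [Fintype V] (G : SimpleGraph V) (f : Sym2 V → K8) : Prop :=
  (∀ e ∈ G.edgeSet, f e ≠ 0) ∧
  (∀ v : V, ∑ w ∈ Finset.univ.filter (fun w => G.Adj v w), f s(v, w) = 0)

/-- A walk from `u` to `w` carries an edge labelling whose boundary is `a` at `u` and at `w`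
and zero elsewhere. -/
theorem SimpleGraph.Walk.exists_boundary {V A : Type} [Fintype V] [AddCommGroup A]
    (H : SimpleGraph V) (a : A) (ha : a + a = 0) {u w : V} (p : H.Walk u w) :
    ∃ g : Sym2 V → A, ∀ v : V, ∑ x ∈ Finset.univ.filter (fun x => H.Adj v x), g s(v, x) =
      (if v = u then a else 0) + (if v = w then a else 0) := by
  induction p with
  | nil =>
    refine ⟨0, fun v => ?_⟩
    split_ifs <;> simp [ha]
  | @cons u y w h p ih =>
    obtain ⟨g, hg⟩ := ih
    refine ⟨fun e => (if e = s(u, y) then a else 0) + g e, fun v => ?_⟩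
    rw [Finset.sum_add_distrib, hg]
    have hne : u ≠ y := h.ne
    have key : ∑ x ∈ Finset.univ.filter (fun x => H.Adj v x),
        (if s(v, x) = s(u, y) then a else 0) =
          (if v = u then a else 0) + (if v = y then a else 0) := by
      by_cases hvu : v = u
      · subst hvu
        simp [hne, h, Finset.sum_ite_eq']
      · by_cases hvy : v = y
        · subst hvy
          simp [hvu, h.symm, Finset.sum_ite_eq']
        · simp [hvu, hvy]
    rw [key]
    have : ∀ b c d : A, b + c + (c + d) = b + (c + c) + d := fun b c d => by abel
    rw [this]
    split_ifs <;> simp [ha]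

/-- In an elementary abelian 2-group, a vertex labelling summing to zero on every component
is the boundary of an edge labelling. -/
theorem SimpleGraph.exists_boundary_of_sum_component_eq_zero {V A : Type} [Fintype V]
    [AddCommGroup A] (hA : ∀ a : A, a + a = 0) (H : SimpleGraph V) (θ : V → A)
    (hθ : ∀ u : V, ∑ v ∈ Finset.univ.filter (fun w => H.Reachable u w), θ v = 0) :
    ∃ g : Sym2 V → A, ∀ v : V,
      ∑ x ∈ Finset.univ.filter (fun x => H.Adj v x), g s(v, x) = θ v := by
  obtain ⟨r, hr, hrr⟩ : ∃ r : V → V, (∀ v, H.Reachable v (r v)) ∧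
      ∀ u v, H.Reachable u v → r u = r v := by
    refine ⟨fun v => Quot.out (H.connectedComponentMk v), fun v => ?_, fun u v h => ?_⟩
    · exact SimpleGraph.ConnectedComponent.exact (Quot.out_eq (H.connectedComponentMk v)).symm
    · simp only [SimpleGraph.ConnectedComponent.sound h]
  choose g hg using fun v => (hr v).elim fun p => p.exists_boundary H (θ v) (hA _)
  refine ⟨fun e => ∑ v, g v e, fun x => ?_⟩
  rw [Finset.sum_comm]
  simp only [hg]
  rw [Finset.sum_add_distrib]
  have root : ∑ v, (if x = r v then θ v else 0) = 0 := by
    rw [← Finset.sum_filter]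
    by_cases hx : x = r x
    · convert hθ x using 2
      ext v
      simp only [Finset.mem_filter, Finset.mem_univ, true_and]
      exact ⟨fun h => h ▸ (hr v).symm, fun h => hx.trans (hrr x v h)⟩
    · refine Finset.sum_eq_zero fun v hv => absurd ?_ hx
      have h : x = r v := (Finset.mem_filter.1 hv).2
      exact h.trans (hrr v x (h ▸ hr v))
  rw [root]
  simp

/-- If a cubic graph `G` with perfect matching `M` admits a non-conflicting nowhere-zero
`Z2 × Z2` flow with respect to `M`, then `G` admits a nowhere-zero `Z2 × Z2 × Z2` flow `f`
and two distinct elements `x, y` such that (1) the edges with `f`-value `x` or `y` form a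
matching, and (2) no edge `uv` of `G` has an edge at `u` of `f`-value `x` and an edge at `v`
of `f`-value `y`. -/
theorem stmt_2 {V : Type} [Fintype V] [DecidableEq V] (G : SimpleGraph V)
    (hcubic : G.IsRegularOfDegree 3)
    (M : G.Subgraph) (hM : M.IsPerfectMatching)
    (θ : V → K4) (hflow : IsNZFlowWrt G M θ) (hnc : NonConflicting G M θ) :
    ∃ (f : Sym2 V → K8) (x y : K8), IsNZ8Flow G f ∧ x ≠ y ∧
      (∀ e ∈ G.edgeSet, ∀ e' ∈ G.edgeSet,
        (f e = x ∨ f e = y) → (f e' = x ∨ f e' = y) → e ≠ e' →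
        ∀ z : V, ¬ (z ∈ e ∧ z ∈ e')) ∧
      ¬ ∃ u v : V, G.Adj u v ∧
        (∃ a : V, G.Adj u a ∧ f s(u, a) = x) ∧
        (∃ b : V, G.Adj v b ∧ f s(v, b) = y) := by
  obtain ⟨hθM, hθ0, hθsum⟩ := hflow
  have hK : ∀ a : K4, a + a = 0 := by decide
  obtain ⟨g, hg⟩ :=
    SimpleGraph.exists_boundary_of_sum_component_eq_zero hK (compl2Factor G M) θ hθsum
  let f : Sym2 V → K8 := fun e =>
    if e ∈ M.edgeSet then ((0, θ e.out.1) : ZMod 2 × K4) else ((1, g e) : ZMod 2 × K4)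
  have hfM : ∀ u v, M.Adj u v → f s(u, v) = ((0, θ u) : ZMod 2 × K4) := by
    intro u v h
    have hout : θ (s(u, v) : Sym2 V).out.1 = θ u := by
      rcases Sym2.mem_iff.1 (Sym2.out_fst_mem s(u, v)) with h' | h'
      · rw [h']
      · rw [h', hθM h]
    have hmem : s(u, v) ∈ M.edgeSet := h
    simp only [f, if_pos hmem, hout]
  have hfN : ∀ u v, ¬ M.Adj u v → f s(u, v) = ((1, g s(u, v)) : ZMod 2 × K4) := by
    intro u v h
    have hmem : s(u, v) ∉ M.edgeSet := h
    simp only [f, if_neg hmem]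
  have hval : ∀ u v (c : K4), f s(u, v) = ((0, c) : ZMod 2 × K4) → M.Adj u v ∧ θ u = c := by
    intro u v c h
    by_cases hm : M.Adj u v
    · rw [hfM u v hm] at h
      exact ⟨hm, congrArg Prod.snd h⟩
    · rw [hfN u v hm] at h
      exact absurd (congrArg Prod.fst h) one_ne_zero
  refine ⟨f, ((0, flowAlpha) : ZMod 2 × K4), ((0, flowBeta) : ZMod 2 × K4), ⟨?_, ?_⟩, ?_, ?_, ?_⟩
  · intro e _ h0
    induction e using Sym2.ind with
    | _ u v => exact hθ0 u (hval u v 0 h0).2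
  · intro v
    obtain ⟨w, hw, hwu⟩ := hM.1 (hM.2 v)
    have hadj : ∀ x, (compl2Factor G M).Adj v x ↔ G.Adj v x ∧ ¬ M.Adj v x := by
      intro x
      simp [compl2Factor, SimpleGraph.deleteEdges_adj]
    have hnot : w ∉ Finset.univ.filter (fun x => (compl2Factor G M).Adj v x) := by
      simp [hadj, hw]
    have hsplit : Finset.univ.filter (fun x => G.Adj v x) =
        insert w (Finset.univ.filter (fun x => (compl2Factor G M).Adj v x)) := by
      ext x
      simp only [Finset.mem_filter, Finset.mem_univ, true_and, Finset.mem_insert, hadj]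
      constructor
      · intro h
        by_cases hm : M.Adj v x
        · exact Or.inl (hwu x hm)
        · exact Or.inr ⟨h, hm⟩
      · rintro (rfl | h)
        · exact M.adj_sub hw
        · exact h.1
    have hcard : (Finset.univ.filter (fun x => (compl2Factor G M).Adj v x)).card = 2 := by
      have h3 : (Finset.univ.filter (fun x => G.Adj v x)).card = 3 := by
        rw [← hcubic v, ← SimpleGraph.card_neighborFinset_eq_degree]
        congr 1
        ext x
        simp
      rw [hsplit, Finset.card_insert_of_notMem hnot] at h3
      omega
    have hrest : ∑ x ∈ Finset.univ.filter (fun x => (compl2Factor G M).Adj v x), f s(v, x) =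
        ((0, θ v) : ZMod 2 × K4) := by
      rw [Finset.sum_congr rfl fun x hx =>
        hfN v x ((hadj x).1 (Finset.mem_filter.1 hx).2).2]
      refine Prod.ext ?_ ?_
      · rw [Prod.fst_sum, Finset.sum_const, hcard]
        exact (by decide : 2 • (1 : ZMod 2) = 0)
      · rw [Prod.snd_sum]
        exact hg v
    rw [hsplit, Finset.sum_insert hnot, hrest, hfM v w hw]
    exact (by decide : ∀ a : K8, a + a = 0) _
  · decide
  · intro e _ e' _ hx hx' hne z hz
    obtain ⟨a, rfl⟩ := hz.1
    obtain ⟨b, rfl⟩ := hz.2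
    have ha : M.Adj z a := hx.elim (fun h => (hval z a _ h).1) fun h => (hval z a _ h).1
    have hb : M.Adj z b := hx'.elim (fun h => (hval z b _ h).1) fun h => (hval z b _ h).1
    exact hne (by rw [(hM.1 (hM.2 z)).unique ha hb])
  · rintro ⟨u, v, huv, ⟨a, _, ha⟩, ⟨b, _, hb⟩⟩
    have hu := (hval u a _ ha).2
    have hv := (hval v b _ hb).2
    by_cases hm : M.Adj u v
    · exact absurd (hu.symm.trans ((hθM hm).trans hv)) (by decide)
    · exact hnc ⟨u, v, huv, hm, hu, hv⟩
end

section
/- Let G be a cubic graph and M a perfect matching of G such that every connected component of G − M is a cycle of length 5. If θ is a non-conflicting nowhere-zero Z2×Z2 flow with respect to M, then every connected component C of G − M contains exactly one vertex v with θ(e_v) = α and exactly one vertex w with θ(e_w) = β. Consequently, the set A of edges of M with θ-value α and the set B of edges of M with θ-value β are disjoint, and each of A and B meets every connected component of G − M in exactly one vertex. -/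
open scoped Classical

open scoped Finset in
/-- Five nonzero elements of the Klein four-group with sum zero contain each of the three
nonzero elements an odd number of times. -/
theorem K4.odd_card_of_sum_eq_zero {V : Type} (s : Finset V) (θ : V → K4)
    (hs : #s = 5) (h0 : ∀ v, θ v ≠ 0) (hsum : ∑ v ∈ s, θ v = 0) :
    #{v ∈ s | θ v = flowAlpha} + #{v ∈ s | θ v = flowBeta}
        + #{v ∈ s | θ v = flowAlpha + flowBeta} = 5 ∧
      Odd #{v ∈ s | θ v = flowAlpha} ∧ Odd #{v ∈ s | θ v = flowBeta} ∧
      Odd #{v ∈ s | θ v = flowAlpha + flowBeta} := by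
  have total : #{v ∈ s | θ v = flowAlpha} + #{v ∈ s | θ v = flowBeta}
      + #{v ∈ s | θ v = flowAlpha + flowBeta} = 5 := by
    rw [← hs, Finset.card_filter, Finset.card_filter, Finset.card_filter,
      ← Finset.sum_add_distrib, ← Finset.sum_add_distrib, Finset.card_eq_sum_ones]
    refine Finset.sum_congr rfl fun v _ => ?_
    have key : ∀ x : K4, x ≠ 0 → ((if x = flowAlpha then 1 else 0)
        + (if x = flowBeta then 1 else 0)
        + (if x = flowAlpha + flowBeta then 1 else 0) : ℕ) = 1 := by
      unfold flowAlpha flowBeta; decide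
    convert key (θ v) (h0 v)
  have even_fst : Even (#{v ∈ s | θ v = flowAlpha}
      + #{v ∈ s | θ v = flowAlpha + flowBeta}) := by
    rw [← ZMod.natCast_eq_zero_iff_even, Nat.cast_add, ← Finset.sum_boole, ← Finset.sum_boole,
      ← Finset.sum_add_distrib]
    have hsum' : ∑ v ∈ s, (θ v).1 = 0 := by rw [← Prod.fst_sum, hsum, Prod.fst_zero]
    refine (Finset.sum_congr rfl ?_).trans hsum'
    intro v _
    have key : ∀ x : K4, ((if x = flowAlpha then 1 else 0)
        + (if x = flowAlpha + flowBeta then 1 else 0) : ZMod 2) = x.1 := by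
      unfold flowAlpha flowBeta; decide
    convert key (θ v)
  have even_snd : Even (#{v ∈ s | θ v = flowBeta}
      + #{v ∈ s | θ v = flowAlpha + flowBeta}) := by
    rw [← ZMod.natCast_eq_zero_iff_even, Nat.cast_add, ← Finset.sum_boole, ← Finset.sum_boole,
      ← Finset.sum_add_distrib]
    have hsum' : ∑ v ∈ s, (θ v).2 = 0 := by rw [← Prod.snd_sum, hsum, Prod.snd_zero]
    refine (Finset.sum_congr rfl ?_).trans hsum'
    intro v _
    have key : ∀ x : K4, ((if x = flowBeta then 1 else 0)
        + (if x = flowAlpha + flowBeta then 1 else 0) : ZMod 2) = x.2 := by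
      unfold flowAlpha flowBeta; decide
    convert key (θ v)
  grind

open scoped Finset in
/-- If a component of `G − M` has exactly one vertex of value `x`, and no edge of `G − M` joins
values `x` and `y`, then the two neighbours of that vertex both have the third value `z`. -/
theorem two_le_card_of_card_eq_one {V : Type} [Fintype V] (G : SimpleGraph V)
    (hcubic : G.IsRegularOfDegree 3) (M : G.Subgraph) (hM : M.IsPerfectMatching)
    (θ : V → K4) (x y z : K4) (hθ : ∀ v, θ v = x ∨ θ v = y ∨ θ v = z)
    (hxy : ∀ v w, G.Adj v w → ¬ M.Adj v w → θ v = x → θ w ≠ y) (u : V)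
    (h1 : #{v | (compl2Factor G M).Reachable u v ∧ θ v = x} = 1) :
    2 ≤ #{v | (compl2Factor G M).Reachable u v ∧ θ v = z} := by
  obtain ⟨v, hv⟩ := Finset.card_eq_one.1 h1
  have hmem : ∀ w, ((compl2Factor G M).Reachable u w ∧ θ w = x) ↔ w = v := fun w => by
    simpa using Finset.ext_iff.1 hv w
  obtain ⟨huv, hvx⟩ := (hmem v).2 rfl
  obtain ⟨m, hm, hmu⟩ := SimpleGraph.Subgraph.isPerfectMatching_iff.1 hM v
  have hcard : #((G.neighborFinset v).erase m) = 2 := by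
    rw [Finset.card_erase_of_mem ((G.mem_neighborFinset v m).2 hm.adj_sub),
      SimpleGraph.card_neighborFinset_eq_degree, hcubic v]
  refine hcard.ge.trans (Finset.card_le_card fun w hw => ?_)
  rw [Finset.mem_erase, SimpleGraph.mem_neighborFinset] at hw
  obtain ⟨hwm, hvw⟩ := hw
  have hnM : ¬ M.Adj v w := fun h => hwm (hmu w h)
  have huw : (compl2Factor G M).Reachable u w := by
    refine huv.trans (SimpleGraph.Adj.reachable ?_)
    simpa [compl2Factor, SimpleGraph.deleteEdges_adj] using ⟨hvw, hnM⟩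
  have hwx : θ w ≠ x := fun h => hvw.ne' ((hmem w).1 ⟨huw, h⟩)
  simpa [huw] using ((hθ w).resolve_left hwx).resolve_left (hxy v w hvw hnM hvx)


/-- If every connected component of `G − M` is a 5-cycle and `θ` is a non-conflicting
nowhere-zero `Z2 × Z2` flow with respect to `M`, then every connected component of `G − M`
contains exactly one vertex whose matching edge has `θ`-value `α` and exactly one vertex
whose matching edge has `θ`-value `β`. -/
theorem stmt_3 {V : Type} [Fintype V] [DecidableEq V] (G : SimpleGraph V)
    (hcubic : G.IsRegularOfDegree 3)
    (M : G.Subgraph) (hM : M.IsPerfectMatching)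
    (h5 : ∀ u : V,
      (Finset.univ.filter (fun w => (compl2Factor G M).Reachable u w)).card = 5)
    (θ : V → K4) (hflow : IsNZFlowWrt G M θ) (hnc : NonConflicting G M θ) :
    ∀ u : V,
      (Finset.univ.filter
        (fun v => (compl2Factor G M).Reachable u v ∧ θ v = flowAlpha)).card = 1 ∧
      (Finset.univ.filter
        (fun v => (compl2Factor G M).Reachable u v ∧ θ v = flowBeta)).card = 1 := by
  intro u
  obtain ⟨-, h0, hsum⟩ := hflow
  have hcases : ∀ x : K4, x ≠ 0 → x = flowAlpha ∨ x = flowBeta ∨ x = flowAlpha + flowBeta := by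
    unfold flowAlpha flowBeta; decide
  have hθ := fun v => hcases (θ v) (h0 v)
  have hcount := K4.odd_card_of_sum_eq_zero _ θ (h5 u) h0 (by convert hsum u)
  simp only [Finset.filter_filter] at hcount
  obtain ⟨htotal, hα, hβ, hγ⟩ := hcount
  have twoα := two_le_card_of_card_eq_one G hcubic M hM θ flowAlpha flowBeta _ hθ
    (fun v w h hn hv hw => hnc ⟨v, w, h, hn, hv, hw⟩) u
  have twoβ := two_le_card_of_card_eq_one G hcubic M hM θ flowBeta flowAlpha _
    (fun v => or_left_comm.1 (hθ v))
    (fun v w h hn hv hw => hnc ⟨w, v, h.symm, fun h' => hn h'.symm, hw, hv⟩) u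
  grind
end

section
/- Let G be a bipartite cubic graph and let M be any perfect matching of G. Then there exists a non-conflicting nowhere-zero Z2×Z2 flow with respect to M. -/
open scoped Classical

theorem compl2Factor_adj {V : Type} {G : SimpleGraph V} {M : G.Subgraph} {u v : V} :
    (compl2Factor G M).Adj u v ↔ G.Adj u v ∧ ¬ M.Adj u v := by
  simp [compl2Factor, SimpleGraph.deleteEdges_adj]

/-- The complement of a perfect matching in a cubic graph is 2-regular. -/
theorem card_filter_compl2Factor_adj {V : Type} [Fintype V] {G : SimpleGraph V}
    (hcubic : G.IsRegularOfDegree 3) {M : G.Subgraph} (hM : M.IsPerfectMatching) (v : V) :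
    (Finset.univ.filter (fun w => (compl2Factor G M).Adj v w)).card = 2 := by
  obtain ⟨w, hw, huniq⟩ := SimpleGraph.Subgraph.isPerfectMatching_iff.mp hM v
  have heq : Finset.univ.filter (fun w => (compl2Factor G M).Adj v w) =
      (G.neighborFinset v).erase w := by
    ext x
    simp only [Finset.mem_filter, Finset.mem_univ, true_and, Finset.mem_erase,
      SimpleGraph.mem_neighborFinset, compl2Factor_adj]
    constructor
    · rintro ⟨hx, hMx⟩
      exact ⟨fun h => hMx (h ▸ hw), hx⟩
    · rintro ⟨hxw, hx⟩
      exact ⟨hx, fun h => hxw (huniq x h)⟩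
  have hmem : w ∈ G.neighborFinset v := by simpa using hw.adj_sub
  have hdeg : (G.neighborFinset v).card = 3 := by
    rw [SimpleGraph.card_neighborFinset_eq_degree]
    convert hcubic v
  rw [heq, Finset.card_erase_of_mem hmem, hdeg]

/-- In a finite bipartite graph that is regular of degree 2, every component has even order. -/
theorem even_card_reachable_of_bipartite {V : Type} [Fintype V] {F : SimpleGraph V}
    {A : Set V} (hA : ∀ ⦃u v : V⦄, F.Adj u v → (u ∈ A ↔ v ∉ A))
    (hdeg : ∀ v, (Finset.univ.filter (fun w => F.Adj v w)).card = 2) (u : V) :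
    Even (Finset.univ.filter (fun w => F.Reachable u w)).card := by
  set C := Finset.univ.filter (fun w => F.Reachable u w) with hC
  have hmem : ∀ w, w ∈ C ↔ F.Reachable u w := fun w => by simp [hC]
  have hcard := Finset.card_mul_eq_card_mul F.Adj (s := C.filter (· ∈ A))
    (t := C.filter (· ∉ A)) (m := 2) (n := 2)
    (fun a ha => by
      rw [Finset.mem_filter, hmem] at ha
      rw [← hdeg a]
      congr 1
      ext x
      simp only [Finset.mem_bipartiteAbove, Finset.mem_filter, Finset.mem_univ, true_and, hmem]
      exact ⟨And.right, fun h => ⟨⟨ha.1.trans h.reachable, (hA h).mp ha.2⟩, h⟩⟩)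
    (fun b hb => by
      rw [Finset.mem_filter, hmem] at hb
      rw [← hdeg b]
      congr 1
      ext x
      simp only [Finset.mem_bipartiteBelow, Finset.mem_filter, Finset.mem_univ, true_and, hmem]
      exact ⟨fun h => h.2.symm,
        fun h => ⟨⟨hb.1.trans h.reachable, (hA h.symm).mpr hb.2⟩, h.symm⟩⟩)
  have hsum := Finset.card_filter_add_card_filter_not (s := C) (· ∈ A)
  exact ⟨(C.filter (· ∈ A)).card, by omega⟩

/-- For every perfect matching `M` of a bipartite cubic graph `G` there exists a
non-conflicting nowhere-zero `Z2 × Z2` flow with respect to `M`. -/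
theorem stmt_6 {V : Type} [Fintype V] [DecidableEq V] (G : SimpleGraph V)
    (hbip : ∃ A : Set V, ∀ ⦃u v : V⦄, G.Adj u v → (u ∈ A ↔ v ∉ A))
    (hcubic : G.IsRegularOfDegree 3)
    (M : G.Subgraph) (hM : M.IsPerfectMatching) :
    ∃ θ : V → K4, IsNZFlowWrt G M θ ∧ NonConflicting G M θ := by
  obtain ⟨A, hA⟩ := hbip
  refine ⟨fun _ => flowAlpha, ⟨fun _ _ _ => rfl, fun _ => show flowAlpha ≠ 0 by decide, fun u => ?_⟩, ?_⟩
  · obtain ⟨k, hk⟩ := even_card_reachable_of_bipartite (F := compl2Factor G M)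
      (fun _ _ h => hA (compl2Factor_adj.mp h).1)
      (card_filter_compl2Factor_adj hcubic hM) u
    rw [Finset.sum_const, hk, add_nsmul, ← nsmul_add]
    have h : flowAlpha + flowAlpha = 0 := by decide
    rw [h, nsmul_zero]
  · rintro ⟨_, _, _, _, _, h⟩
    exact absurd h (show flowAlpha ≠ flowBeta by decide)
end

section
/- Let G be a claw-free bridgeless cubic graph and let e be an edge of G. Then G has a perfect matching M with e ∈ M such that there exists a non-conflicting nowhere-zero Z2×Z2 flow with respect to M. -/
open scoped Classical

/-- A graph is claw-free if it has no induced subgraph isomorphic to `K_{1,3}`. -/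
def ClawFree {V : Type} (G : SimpleGraph V) : Prop :=
  ¬ ∃ u a b c : V, a ≠ b ∧ a ≠ c ∧ b ≠ c ∧
    G.Adj u a ∧ G.Adj u b ∧ G.Adj u c ∧
    ¬ G.Adj a b ∧ ¬ G.Adj a c ∧ ¬ G.Adj b c


namespace CubicFlow

/-! ### Edge cuts in multigraphs

A finite multigraph is given by its two endpoint maps `s t : E → V`. -/

/-- The edges whose endpoints are separated by the labelling `p` of the vertices. -/
noncomputable def cut {V E W : Type} [Fintype E] (s t : E → V) (p : V → W) : Finset E :=
  Finset.univ.filter fun e => p (s e) ≠ p (t e)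

/-- The labelling singling out the vertex `v`. -/
noncomputable def single {V : Type} (v : V) : V → Bool := fun w => decide (w = v)

section Cut

variable {V E : Type} [Fintype E] {s t : E → V}

lemma mem_cut {W : Type} {p : V → W} {e : E} : e ∈ cut s t p ↔ p (s e) ≠ p (t e) := by
  simp [cut]

lemma cut_not (S : V → Bool) : cut s t (fun v => !S v) = cut s t S := by
  ext e; simp [mem_cut]

lemma sum_cut_xor {A : Type} [AddCommGroup A] (hA : ∀ a : A, a + a = 0) (φ : E → A)
    (S X : V → Bool) :
    ∑ e ∈ cut s t (fun v => S v ^^ X v), φ e =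
      ∑ e ∈ cut s t S, φ e + ∑ e ∈ cut s t X, φ e := by
  simp only [cut, Finset.sum_filter]
  rw [← Finset.sum_add_distrib]
  refine Finset.sum_congr rfl fun e _ => ?_
  cases S (s e) <;> cases S (t e) <;> cases X (s e) <;> cases X (t e) <;> simp [hA]

lemma card_cut_xor (S X : V → Bool) :
    (cut s t (fun v => S v ^^ X v)).card ≡ (cut s t S).card + (cut s t X).card [MOD 2] := by
  have h := sum_cut_xor (s := s) (t := t) (A := ZMod 2) (by decide) (fun _ => 1) S X
  rw [← ZMod.natCast_eq_natCast_iff]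
  simpa using h

/-- A double count of incident pairs of a vertex and a non-loop edge. -/
lemma sum_cut_single [Fintype V] {A : Type} [AddCommMonoid A] (F : V → E → A) :
    ∑ v, ∑ e ∈ cut s t (single v), F v e =
      ∑ e ∈ cut s t id, (F (s e) e + F (t e) e) := by
  simp only [cut, Finset.sum_filter]
  rw [Finset.sum_comm]
  refine Finset.sum_congr rfl fun e _ => ?_
  by_cases h : s e = t e
  · simp [h]
  · rw [if_pos (show id (s e) ≠ id (t e) from h), ← Finset.sum_pair (f := fun v => F v e) h,
      ← Finset.sum_subset (Finset.subset_univ {s e, t e})]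
    · refine Finset.sum_congr rfl fun v hv => if_pos ?_
      simp only [Finset.mem_insert, Finset.mem_singleton] at hv
      rcases hv with rfl | rfl <;> simp [single, h, Ne.symm h]
    · intro v _ hv
      simp only [Finset.mem_insert, Finset.mem_singleton, not_or] at hv
      simp [single, Ne.symm hv.1, Ne.symm hv.2]

lemma sum_card_cut_single [Fintype V] :
    ∑ v, (cut s t (single v)).card = 2 * (cut s t id).card := by
  have h := sum_cut_single (s := s) (t := t) (A := ℕ) fun _ _ => 1
  simp only [Finset.sum_const, smul_eq_mul, mul_one] at h
  omega

lemma cut_single_eq {v : V} {e : E} :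
    e ∈ cut s t (single v) ↔ s e ≠ t e ∧ (s e = v ∨ t e = v) := by
  by_cases h1 : s e = v <;> by_cases h2 : t e = v <;> simp [mem_cut, single, h1, h2]
  · exact fun h => h2 h.symm

end Cut

/-! ### Merging two vertices -/

/-- The map identifying `v` with `x` and leaving the other vertices alone. -/
noncomputable def merge {V : Type} {v x : V} (h : x ≠ v) : V → {w // w ≠ v} := fun w =>
  if hw : w = v then ⟨x, h⟩ else ⟨w, hw⟩

section Merge

variable {V : Type} {v x : V} (h : x ≠ v)

lemma merge_self : merge h v = ⟨x, h⟩ := by simp [merge]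

lemma merge_of_ne {w : V} (hw : w ≠ v) : merge h w = ⟨w, hw⟩ := by simp [merge, hw]

lemma merge_surjective : Function.Surjective (merge h) :=
  fun w => ⟨w, merge_of_ne h w.2⟩

lemma comp_merge {S : V → Bool} (hS : S v = S x) (w : V) : S (merge h w) = S w := by
  by_cases hw : w = v
  · subst hw; simp [merge_self, hS]
  · simp [merge_of_ne h hw]

lemma cut_merge {E : Type} [Fintype E] {s t : E → V} {S : V → Bool} (hS : S v = S x) :
    cut (merge h ∘ s) (merge h ∘ t) (fun w => S w) = cut s t S := by
  ext e; simp [mem_cut, comp_merge h hS]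

lemma card_merge [Fintype V] : Fintype.card {w // w ≠ v} + 1 = Fintype.card V := by
  have := Fintype.card_subtype_compl (fun w => w = v)
  have h1 : 0 < Fintype.card V := Fintype.card_pos_iff.mpr ⟨v⟩
  simp only [Fintype.card_subtype_eq] at this
  simp only [ne_eq]
  omega

/-- A function whose sum vanishes over every cut not separating `v` from `x`, and over one cut
that does, has zero sum over every cut. -/
lemma sum_cut_eq_zero_of_merge {E A : Type} [Fintype E] [AddCommGroup A] (hA : ∀ a : A, a + a = 0)
    {s t : E → V} {φ : E → A}
    (h0 : ∀ S : V → Bool, S v = S x → ∑ e ∈ cut s t S, φ e = 0)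
    {X : V → Bool} (hX : X v ≠ X x) (hX0 : ∑ e ∈ cut s t X, φ e = 0) (S : V → Bool) :
    ∑ e ∈ cut s t S, φ e = 0 := by
  by_cases hS : S v = S x
  · exact h0 S hS
  · have h1 := h0 (fun w => S w ^^ X w) (by
      revert hX hS; cases S v <;> cases S x <;> cases X v <;> cases X x <;> simp)
    rwa [sum_cut_xor hA, hX0, add_zero] at h1

end Merge

/-! ### Two edge-disjoint connected spanning subgraphs -/

/-- The Nash-Williams–Tutte condition for two edge-disjoint spanning trees: every partition of the
vertices into `k` classes is crossed by at least `2 * (k - 1)` edges. -/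
def PartitionCond {V E : Type} [Fintype E] (s t : E → V) : Prop :=
  ∀ (W : Type) [Fintype W] (p : V → W), Function.Surjective p →
    2 * Fintype.card W ≤ (cut s t p).card + 2

/-- A `2`-colouring of the edges in which both colour classes are connected and spanning, that is,
meet every nontrivial cut. -/
def IsBicoloring {V E : Type} (s t : E → V) (col : E → Bool) : Prop :=
  ∀ S : V → Bool, (∃ x y, S x ≠ S y) → ∀ b, ∃ e, col e = b ∧ S (s e) ≠ S (t e)

section Bicoloring

variable {V E : Type}

lemma PartitionCond.comp [Fintype E] {s t : E → V} (h : PartitionCond s t) {W : Type} {q : V → W}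
    (hq : Function.Surjective q) : PartitionCond (q ∘ s) (q ∘ t) :=
  fun U _ p hp => h U (p ∘ q) (hp.comp hq)

/-- The classes of a tight partition inherit the partition condition. -/
lemma PartitionCond.fiber [Fintype E] {s t : E → V} (h : PartitionCond s t)
    {W : Type} [Fintype W] {p : V → W} (hp : Function.Surjective p)
    (ht : (cut s t p).card + 2 ≤ 2 * Fintype.card W) (w : W) :
    PartitionCond (V := {v // p v = w}) (E := {e // p (s e) = w ∧ p (t e) = w})
      (fun e => ⟨s e.1, e.2.1⟩) (fun e => ⟨t e.1, e.2.2⟩) := by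
  intro U _ r hr
  let Q : V → {w' // w' ≠ w} ⊕ U := fun v =>
    if hv : p v = w then Sum.inr (r ⟨v, hv⟩) else Sum.inl ⟨p v, hv⟩
  have hQ : Function.Surjective Q := by
    rintro (⟨w', hw'⟩ | u)
    · obtain ⟨v, rfl⟩ := hp w'
      exact ⟨v, by simp [Q, hw']⟩
    · obtain ⟨⟨v, hv⟩, rfl⟩ := hr u
      exact ⟨v, by simp [Q, hv]⟩
  have h1 := h _ Q hQ
  have hsub : (cut s t Q) ⊆
      (cut s t p) ∪
        (cut (V := {v // p v = w}) (E := {e // p (s e) = w ∧ p (t e) = w})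
          (fun e => ⟨s e.1, e.2.1⟩) (fun e => ⟨t e.1, e.2.2⟩) r).map
            (Function.Embedding.subtype _) := by
    intro e he
    simp only [mem_cut, Finset.mem_union, Finset.mem_map,
      Function.Embedding.subtype_apply] at he ⊢
    by_cases hpe : p (s e) = p (t e)
    · right
      by_cases hw : p (t e) = w
      · refine ⟨⟨e, hpe.trans hw, hw⟩, ?_, rfl⟩
        simpa [Q, hpe, hw] using he
      · exact absurd (by simp [Q, hpe, hw]) he
    · exact Or.inl hpe
  have h2 := (Finset.card_le_card hsub).trans (Finset.card_union_le _ _)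
  rw [Finset.card_map] at h2
  have h3 := card_merge (v := w)
  rw [Fintype.card_sum] at h1
  omega

/-- Bicolourings of a quotient graph and of the fibres of the quotient map combine. -/
lemma IsBicoloring.glue {s t : E → V} {W : Type} {p : V → W} {col : E → Bool}
    (h : IsBicoloring (p ∘ s) (p ∘ t) col)
    {fcol : ∀ w, {e // p (s e) = w ∧ p (t e) = w} → Bool}
    (hf : ∀ w, IsBicoloring (V := {v // p v = w})
      (fun e => ⟨s e.1, e.2.1⟩) (fun e => ⟨t e.1, e.2.2⟩) (fcol w)) :
    IsBicoloring s t fun e => if he : p (t e) = p (s e) then fcol (p (s e)) ⟨e, rfl, he⟩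
      else col e := by
  rintro S ⟨x, y, hxy⟩ b
  by_cases hc : ∃ w, ∃ x y : {v // p v = w}, S x ≠ S y
  · obtain ⟨w, hw⟩ := hc
    obtain ⟨⟨e, rfl, he⟩, hb, hS⟩ := hf w (fun v => S v) hw b
    exact ⟨e, by simpa [he] using hb, hS⟩
  · have hfac : S.FactorsThrough p := by
      intro x y hxy
      by_contra hS
      exact hc ⟨p y, ⟨x, hxy⟩, ⟨y, rfl⟩, hS⟩
    obtain ⟨e, hb, hS⟩ := h (Function.extend p S fun _ => false)
      ⟨p x, p y, by simpa [hfac.extend_apply] using hxy⟩ b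
    simp only [Function.comp_apply, hfac.extend_apply] at hS
    exact ⟨e, (dif_neg fun he => hS (hfac he.symm)).trans hb, hS⟩

lemma card_cut_le_subtype_ne [Fintype E] (s t : E → V) {W : Type} (p : V → W) (f : E) :
    (cut s t p).card ≤
      (cut (E := {e // e ≠ f}) (fun e => s e) (fun e => t e) p).card + 1 := by
  have hsub : cut s t p ⊆ insert f ((cut (E := {e // e ≠ f}) (fun e => s e) (fun e => t e) p).map
      (Function.Embedding.subtype _)) := by
    intro e he
    by_cases hf : e = f
    · simp [hf]
    · simpa [hf, mem_cut] using he
  simpa using (Finset.card_le_card hsub).trans (Finset.card_insert_le _ _)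

/-- If every partition other than the two trivial ones has slack, the graph obtained by deleting
an edge `g` at a vertex `v` of degree three, and contracting another one, satisfies the partition
condition, provided that the third edge does not become a loop. -/
lemma PartitionCond.delete_contract [Fintype V] [Fintype E] {s t : E → V} (h : PartitionCond s t)
    (hslack : ∀ (W : Type) [Fintype W] (p : V → W), Function.Surjective p →
      1 < Fintype.card W → Fintype.card W < Fintype.card V →
      2 * Fintype.card W < (cut s t p).card + 2)
    {v x : V} (hx : x ≠ v) (hd : (cut s t (single v)).card = 3) {g k : E}
    (hg : g ∈ cut s t (single v)) (hk : k ∈ cut s t (single v)) (hgk : k ≠ g)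
    (hkx : merge hx (s k) ≠ merge hx (t k)) :
    PartitionCond (E := {e // e ≠ g}) (fun e => merge hx (s e)) (fun e => merge hx (t e)) := by
  intro W _ p hp
  let Q : V → Option W := fun w => if hw : w = v then none else some (p ⟨w, hw⟩)
  have hQ : Function.Surjective Q := by
    rintro (_ | w)
    · exact ⟨v, by simp [Q]⟩
    · obtain ⟨⟨u, hu⟩, rfl⟩ := hp w
      exact ⟨u, by simp [Q, hu]⟩
  have hcard := card_merge (v := v)
  have hW : 0 < Fintype.card W := Fintype.card_pos_iff.mpr ⟨p ⟨x, hx⟩⟩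
  have hWV : Fintype.card W ≤ Fintype.card {w // w ≠ v} := Fintype.card_le_of_surjective p hp
  set T := cut s t Q with hT
  set T' := cut (E := {e // e ≠ g}) (fun e => merge hx (s e)) (fun e => merge hx (t e)) p with hT'
  have hsub : T \ cut s t (single v) ⊆ T'.map (Function.Embedding.subtype _) := by
    intro e he
    simp only [Finset.mem_sdiff, hT, mem_cut (p := Q),
      cut_single_eq, not_and, not_or] at he
    obtain ⟨hs, ht⟩ := he.2 fun hst => he.1 (by rw [hst])
    have heg : e ≠ g := by
      rintro rfl
      rcases (cut_single_eq.mp hg).2 with h | h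
      exacts [hs h, ht h]
    have := he.1
    simpa [hT', mem_cut, heg, merge_of_ne, hs, ht, Q] using this
  have hle := Finset.card_le_card hsub
  have hsd := Finset.le_card_sdiff (cut s t (single v)) T
  rw [Finset.card_map] at hle
  by_cases hinj : Function.Injective p
  · have hkT : (⟨k, hgk⟩ : {e // e ≠ g}) ∈ T' := by
      simpa [hT', mem_cut] using fun h => hkx (hinj h)
    have hins : insert k (T \ cut s t (single v)) ⊆ T'.map (Function.Embedding.subtype _) :=
      Finset.insert_subset (Finset.mem_map.mpr ⟨_, hkT, rfl⟩) hsub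
    have h2 := Finset.card_le_card hins
    rw [Finset.card_map, Finset.card_insert_of_notMem (by simp [hk])] at h2
    have h1 := h _ Q hQ
    rw [Fintype.card_option, ← hT] at h1
    omega
  · have hlt : Fintype.card W < Fintype.card {w // w ≠ v} := by
      refine lt_of_le_of_ne hWV fun heq => hinj ?_
      exact ((Fintype.bijective_iff_surjective_and_card p).mpr ⟨hp, heq.symm⟩).1
    have h1 := hslack _ Q hQ (by rw [Fintype.card_option]; omega)
      (by rw [Fintype.card_option]; omega)
    rw [Fintype.card_option, ← hT] at h1
    omega

/-- Undoing the reduction of `PartitionCond.delete_contract` on bicolourings. -/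
lemma IsBicoloring.of_delete_contract [Fintype E] {s t : E → V} {v x : V} (hx : x ≠ v)
    {f g k : E} (hf : merge hx (s f) = merge hx (t f)) (hfc : f ∈ cut s t (single v))
    (hgc : g ∈ cut s t (single v)) (hd : ∀ e ∈ cut s t (single v), e = f ∨ e = g ∨ e = k)
    (hfg : f ≠ g) (hkg : k ≠ g) (hfk : f ≠ k) {col : {e // e ≠ g} → Bool}
    (h : IsBicoloring (fun e : {e // e ≠ g} => merge hx (s e)) (fun e => merge hx (t e)) col) :
    IsBicoloring s t fun e => if he : e = g then !col ⟨k, hkg⟩ else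
      if e = f then col ⟨k, hkg⟩ else col ⟨e, he⟩ := by
  rintro S ⟨y, z, hyz⟩ b
  by_cases hS : S v = S x
  · obtain ⟨⟨e, heg⟩, hb, he⟩ := h (fun w => S w) ⟨merge hx y, merge hx z, by
      simpa [comp_merge hx hS] using hyz⟩ b
    have hef : e ≠ f := by rintro rfl; exact he (by simp only [hf])
    simp only [comp_merge hx hS] at he
    exact ⟨e, by simpa [heg, hef] using hb, he⟩
  · by_cases hb : b = col ⟨k, hkg⟩
    · refine ⟨f, by simp [hfg, hb], fun hSf => ?_⟩
      have hne := cut_single_eq.mp hfc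
      rcases hne.2 with hv | hv
      · rw [hv, merge_self, merge_of_ne hx (fun h => hne.1 (hv.trans h.symm))] at hf
        rw [Subtype.mk.injEq] at hf
        rw [hv, ← hf] at hSf
        exact hS hSf
      · rw [hv, merge_self, merge_of_ne hx (fun h => hne.1 (h.trans hv.symm))] at hf
        rw [Subtype.mk.injEq] at hf
        rw [hv, hf] at hSf
        exact hS hSf.symm
    · by_cases hc : ∃ y z : {w // w ≠ v}, S y ≠ S z
      · obtain ⟨⟨e, heg⟩, hbe, he⟩ := h (fun w => S w) hc b
        have hef : e ≠ f := by rintro rfl; exact he (by simp only [hf])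
        have hek : e ≠ k := by rintro rfl; exact hb hbe.symm
        have hne : s e ≠ t e := fun hst => he (by simp only [hst])
        have hev : e ∉ cut s t (single v) := fun hev => by
          rcases hd e hev with h | h | h
          exacts [hef h, heg h, hek h]
        rw [cut_single_eq, not_and, not_or] at hev
        obtain ⟨h1, h2⟩ := hev hne
        simp only [merge_of_ne hx h1, merge_of_ne hx h2] at he
        exact ⟨e, by simpa [heg, hef] using hbe, he⟩
      · push Not at hc
        have hne := cut_single_eq.mp hgc
        refine ⟨g, by revert hb; cases b <;> simp, fun hSg => hS ?_⟩
        rcases hne.2 with hv | hv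
        · rw [← hv, hSg]
          exact hc ⟨_, fun h => hne.1 (hv.trans h.symm)⟩ ⟨x, hx⟩
        · rw [← hv, ← hSg]
          exact hc ⟨_, fun h => hne.1 (h.trans hv.symm)⟩ ⟨x, hx⟩

lemma exists_isBicoloring_of_card_eq_two [Fintype V] [Fintype E] {s t : E → V}
    (h : PartitionCond s t) (hV : Fintype.card V = 2) : ∃ col, IsBicoloring s t col := by
  have h1 := h V id Function.surjective_id
  obtain ⟨f, hf, g, hg, hfg⟩ := Finset.one_lt_card.mp
    (show 1 < (cut s t id).card by omega)
  have key : ∀ S : V → Bool, (∃ x y, S x ≠ S y) → ∀ e, s e ≠ t e → S (s e) ≠ S (t e) := by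
    rintro S ⟨x, y, hxy⟩ e hne
    have hu : ({x, y} : Finset V) = Finset.univ := by
      apply Finset.eq_univ_of_card
      rw [Finset.card_pair (fun h => hxy (by rw [h])), hV]
    have hs : s e ∈ ({x, y} : Finset V) := hu ▸ Finset.mem_univ _
    have ht : t e ∈ ({x, y} : Finset V) := hu ▸ Finset.mem_univ _
    simp only [Finset.mem_insert, Finset.mem_singleton] at hs ht
    rcases hs with hs | hs <;> rcases ht with ht | ht <;> rw [hs, ht]
    · exact absurd (hs.trans ht.symm) hne
    · exact hxy
    · exact hxy.symm
    · exact absurd (hs.trans ht.symm) hne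
  refine ⟨fun e => decide (e = f), fun S hS b => ?_⟩
  cases b
  · exact ⟨g, by simpa using hfg.symm, key S hS g (mem_cut.mp hg)⟩
  · exact ⟨f, by simp, key S hS f ((mem_cut.mp hf))⟩

/-- In a graph with too few edges for two spanning trees plus an extra edge, whose proper partitions
have slack, some vertex has degree three. -/
lemma exists_card_cut_single_eq_three [Fintype V] [Fintype E] {s t : E → V}
    (hV : 2 < Fintype.card V)
    (hslack : ∀ (W : Type) [Fintype W] (p : V → W), Function.Surjective p →
      1 < Fintype.card W → Fintype.card W < Fintype.card V →
      2 * Fintype.card W < (cut s t p).card + 2)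
    (htot : (cut s t id).card + 2 ≤ 2 * Fintype.card V) :
    ∃ v, (cut s t (single v)).card = 3 := by
  by_contra! hcon
  have hge : ∀ v ∈ (Finset.univ : Finset V), 4 ≤ (cut s t (single v)).card := by
    intro v _
    have hsurj : Function.Surjective (single v) := by
      have : Nontrivial V := Fintype.one_lt_card_iff_nontrivial.mp (by omega)
      obtain ⟨w, hw⟩ := exists_ne v
      rintro (_ | _)
      · exact ⟨w, by simp [single, hw]⟩
      · exact ⟨v, by simp [single]⟩
    have h1 := hslack Bool (single v) hsurj (by simp) (by simpa using hV)
    rw [Fintype.card_bool] at h1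
    have := hcon v
    omega
  have h1 := Finset.sum_le_sum hge
  rw [sum_card_cut_single, Finset.sum_const, Finset.card_univ, smul_eq_mul] at h1
  omega

/-- A finite graph satisfying the partition condition has two edge-disjoint connected spanning
subgraphs. -/
theorem PartitionCond.exists_isBicoloring [Fintype V] [Fintype E] {s t : E → V}
    (h : PartitionCond s t) : ∃ col, IsBicoloring s t col := by
  induction hn : Fintype.card V + Fintype.card E using Nat.strong_induction_on
    generalizing V E with
  | _ n ih =>
  subst hn
  rcases Nat.lt_or_ge (Fintype.card V) 2 with hV | hV
  · refine ⟨fun _ => true, fun S ⟨x, y, hxy⟩ => ?_⟩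
    exact absurd (congrArg S (Fintype.card_le_one_iff.mp (by omega) x y)) hxy
  rcases hV.eq_or_lt' with hV | hV
  · exact exists_isBicoloring_of_card_eq_two h hV
  by_cases htight : ∃ (W : Type) (_ : Fintype W) (p : V → W), Function.Surjective p ∧
      1 < Fintype.card W ∧ Fintype.card W < Fintype.card V ∧
      (cut s t p).card + 2 ≤ 2 * Fintype.card W
  · obtain ⟨W, _, p, hp, hW1, hWV, ht⟩ := htight
    obtain ⟨col, hcol⟩ := ih _ (by omega) (h.comp hp) rfl
    have hfib : ∀ w, ∃ fcol, IsBicoloring (V := {v // p v = w})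
        (E := {e // p (s e) = w ∧ p (t e) = w})
        (fun e => ⟨s e.1, e.2.1⟩) (fun e => ⟨t e.1, e.2.2⟩) fcol := by
      intro w
      refine ih _ ?_ (h.fiber hp ht w) rfl
      obtain ⟨w', hw'⟩ := Fintype.exists_ne_of_one_lt_card hW1 w
      obtain ⟨v, rfl⟩ := hp w'
      have h1 := Fintype.card_subtype_lt (p := fun v => p v = w) hw'
      have h2 := Fintype.card_subtype_le (fun e => p (s e) = w ∧ p (t e) = w)
      omega
    choose fcol hfcol using hfib
    exact ⟨_, hcol.glue hfcol⟩
  have hslack : ∀ (W : Type) [Fintype W] (p : V → W), Function.Surjective p →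
      1 < Fintype.card W → Fintype.card W < Fintype.card V →
      2 * Fintype.card W < (cut s t p).card + 2 := by
    intro W _ p hp h1 h2
    by_contra hcon
    exact htight ⟨W, _, p, hp, h1, h2, not_lt.mp hcon⟩
  by_cases htot : 2 * Fintype.card V < (cut s t id).card + 2
  · obtain ⟨f, hf⟩ := Finset.card_pos.mp
      (show 0 < (cut s t id).card by omega)
    have hE := card_merge (v := f)
    have hcond : PartitionCond (E := {e // e ≠ f}) (fun e => s e) (fun e => t e) := by
      intro W _ p hp
      have h1 := card_cut_le_subtype_ne s t p f
      rcases Nat.lt_or_ge 1 (Fintype.card W) with hW | hW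
      · rcases (Fintype.card_le_of_surjective p hp).lt_or_eq with hWV | hWV
        · have := hslack W p hp hW hWV
          omega
        · have hinj := ((Fintype.bijective_iff_surjective_and_card p).mpr ⟨hp, hWV.symm⟩).1
          have h2 : cut s t p = cut s t id := by ext e; simp [mem_cut, hinj.eq_iff]
          rw [h2] at h1
          omega
      · omega
    obtain ⟨col, hcol⟩ := ih _ (by omega) hcond rfl
    refine ⟨fun e => if he : e ≠ f then col ⟨e, he⟩ else true, fun S hS b => ?_⟩
    obtain ⟨⟨e, hef⟩, hb, he⟩ := hcol S hS b
    exact ⟨e, by simpa [hef] using hb, he⟩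
  obtain ⟨v, hv⟩ := exists_card_cut_single_eq_three hV hslack (not_lt.mp htot)
  obtain ⟨f, hf⟩ := Finset.card_pos.mp (by rw [hv]; norm_num)
  obtain ⟨x, hx, hfx⟩ : ∃ x, ∃ hx : x ≠ v, merge hx (s f) = merge hx (t f) := by
    obtain ⟨hne, hv' | hv'⟩ := cut_single_eq.mp hf
    · have hx : t f ≠ v := fun h => hne (hv'.trans h.symm)
      exact ⟨t f, hx, by rw [merge_of_ne hx hx, hv', merge_self]⟩
    · have hx : s f ≠ v := fun h => hne (h.trans hv'.symm)
      exact ⟨s f, hx, by rw [merge_of_ne hx hx, hv', merge_self]⟩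
  obtain ⟨k, hk, hkx⟩ : ∃ k ∈ cut s t (single v), merge hx (s k) ≠ merge hx (t k) := by
    by_contra! hcon
    have h1 := h _ (merge hx) (merge_surjective hx)
    have hsub : cut s t (merge hx) ⊆
        (cut s t id) \ cut s t (single v) := by
      intro e he
      rw [mem_cut] at he
      rw [Finset.mem_sdiff, mem_cut]
      exact ⟨fun h => he (congrArg _ h), fun h => he (hcon e h)⟩
    have h2 := Finset.card_le_card hsub
    have hle : cut s t (single v) ⊆ cut s t id := fun e he => mem_cut.mpr (cut_single_eq.mp he).1
    rw [Finset.card_sdiff_of_subset hle] at h2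
    have h3 := card_merge (v := v)
    have h4 := Finset.card_le_card hle
    omega
  have hfk : f ≠ k := by rintro rfl; exact hkx hfx
  obtain ⟨g, hg, hgfk⟩ : ∃ g ∈ cut s t (single v), g ∉ ({f, k} : Finset E) := by
    refine Finset.exists_mem_notMem_of_card_lt_card ?_
    rw [hv, Finset.card_pair hfk]
    norm_num
  simp only [Finset.mem_insert, Finset.mem_singleton, not_or] at hgfk
  have hd : ∀ e ∈ cut s t (single v), e = f ∨ e = g ∨ e = k := by
    have heq : ({f, g, k} : Finset E) = cut s t (single v) := by
      refine Finset.eq_of_subset_of_card_le ?_ ?_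
      · intro e he
        simp only [Finset.mem_insert, Finset.mem_singleton] at he
        rcases he with rfl | rfl | rfl <;> assumption
      · rw [hv, Finset.card_eq_three.mpr ⟨f, g, k, Ne.symm hgfk.1, hfk, hgfk.2, rfl⟩]
    intro e he
    simpa [← heq] using he
  obtain ⟨col, hcol⟩ := ih _ (by
    have := card_merge (v := v); have := card_merge (v := g); omega)
    (h.delete_contract hslack hx hv hg hk (Ne.symm hgfk.2) hkx) rfl
  exact ⟨_, hcol.of_delete_contract hx hfx hf hg hd (Ne.symm hgfk.1) (Ne.symm hgfk.2) hfk⟩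

end Bicoloring

/-! ### Nowhere-zero flows -/

section Flow

variable {V E : Type} [Fintype E]

/-- Values prescribed off a connected spanning subgraph extend to a `ZMod 2`-flow. -/
lemma exists_flow_extend [Fintype V] {s t : E → V} {B : E → Prop}
    (hB : ∀ S : V → Bool, (∃ x y, S x ≠ S y) → ∃ e, B e ∧ S (s e) ≠ S (t e)) (a : E → ZMod 2) :
    ∃ φ : E → ZMod 2, (∀ e, ¬ B e → φ e = a e) ∧ ∀ S : V → Bool, ∑ e ∈ cut s t S, φ e = 0 := by
  induction hn : Fintype.card V using Nat.strong_induction_on generalizing V with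
  | _ n ih =>
  subst hn
  by_cases hV : ∃ v x : V, x ≠ v
  · obtain ⟨v, y, hy⟩ := hV
    obtain ⟨f, hfB, hf⟩ := hB (single v) ⟨v, y, by simp [single, hy]⟩
    obtain ⟨x, hx, hfx, hfX⟩ : ∃ x, ∃ hx : x ≠ v, merge hx (s f) = merge hx (t f) ∧
        ∀ S : V → Bool, S v = S x → f ∉ cut s t S := by
      obtain ⟨hne, hv | hv⟩ := cut_single_eq.mp (mem_cut.mpr hf)
      · have hx : t f ≠ v := fun h => hne (hv.trans h.symm)
        exact ⟨t f, hx, by rw [merge_of_ne hx hx, hv, merge_self],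
          fun S hS => by simp [mem_cut, hv, hS]⟩
      · have hx : s f ≠ v := fun h => hne (h.trans hv.symm)
        exact ⟨s f, hx, by rw [merge_of_ne hx hx, hv, merge_self],
          fun S hS => by simp [mem_cut, hv, hS]⟩
    obtain ⟨φ, hφ, hφ0⟩ := ih _ (by have := card_merge (v := v); omega)
      (s := merge hx ∘ s) (t := merge hx ∘ t) (fun S ⟨y, z, hyz⟩ => by
        obtain ⟨y, rfl⟩ := merge_surjective hx y
        obtain ⟨z, rfl⟩ := merge_surjective hx z
        exact hB (S ∘ merge hx) ⟨y, z, hyz⟩) rfl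
    refine ⟨Function.update φ f (∑ e ∈ (cut s t (single v)).erase f, φ e), fun e he => ?_,
      sum_cut_eq_zero_of_merge (v := v) (x := x) CharTwo.add_self_eq_zero ?_ (X := single v) ?_ ?_⟩
    · rw [Function.update_of_ne (by rintro rfl; exact he hfB), hφ e he]
    · intro S hS
      rw [Finset.sum_update_of_notMem (hfX S hS), ← cut_merge hx hS]
      exact hφ0 _
    · simp [single, hx]
    · rw [← Finset.add_sum_erase _ _ (mem_cut.mpr hf), Function.update_self,
        Finset.sum_update_of_notMem (Finset.notMem_erase _ _)]
      exact CharTwo.add_self_eq_zero _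
  · push Not at hV
    refine ⟨a, fun _ _ => rfl, fun S => Finset.sum_eq_zero fun e he => ?_⟩
    exact absurd (congrArg S (hV _ _)) (mem_cut.mp he)

/-- A finite graph all of whose nontrivial cuts have at least four edges satisfies the partition
condition. -/
lemma partitionCond_of_four_le {s t : E → V}
    (h : ∀ S : V → Bool, (∃ x y, S x ≠ S y) → 4 ≤ (cut s t S).card) : PartitionCond s t := by
  intro W _ p hp
  rcases Nat.lt_or_ge 1 (Fintype.card W) with hW | hW
  · have hge : ∀ w ∈ (Finset.univ : Finset W), 4 ≤ (cut (p ∘ s) (p ∘ t) (single w)).card := by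
      intro w _
      obtain ⟨w', hw'⟩ := Fintype.exists_ne_of_one_lt_card hW w
      obtain ⟨x, rfl⟩ := hp w
      obtain ⟨y, rfl⟩ := hp w'
      exact h (single (p x) ∘ p) ⟨x, y, by simp [single, hw']⟩
    have h1 := Finset.sum_le_sum hge
    rw [sum_card_cut_single, Finset.sum_const, Finset.card_univ, smul_eq_mul,
      show cut (p ∘ s) (p ∘ t) id = cut s t p from rfl] at h1
    omega
  · omega

/-- A finite graph without cuts of size one or three has a nowhere-zero flow with values in
the Klein four-group. -/
theorem exists_nowhere_zero_flow [Fintype V] {s t : E → V} (h1 : ∀ S : V → Bool, (cut s t S).card ≠ 1)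
    (h3 : ∀ S : V → Bool, (cut s t S).card ≠ 3) :
    ∃ φ : E → K4, (∀ e, φ e ≠ 0) ∧ ∀ S : V → Bool, ∑ e ∈ cut s t S, φ e = 0 := by
  have hK : ∀ a : K4, a + a = 0 := by decide
  induction hn : Fintype.card V using Nat.strong_induction_on generalizing V with
  | _ n ih =>
  subst hn
  have hmerge : ∀ v x : V, ∀ hx : x ≠ v, ∃ φ : E → K4, (∀ e, φ e ≠ 0) ∧
      ∀ S : V → Bool, S v = S x → ∑ e ∈ cut s t S, φ e = 0 := by
    intro v x hx
    obtain ⟨φ, hφ, hφ0⟩ := ih _ (by have := card_merge (v := v); omega)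
      (s := merge hx ∘ s) (t := merge hx ∘ t) (fun S => h1 (S ∘ merge hx))
      (fun S => h3 (S ∘ merge hx)) rfl
    exact ⟨φ, hφ, fun S hS => by rw [← cut_merge hx hS]; exact hφ0 _⟩
  by_cases h4 : ∀ S : V → Bool, (∃ x y, S x ≠ S y) → 4 ≤ (cut s t S).card
  · obtain ⟨col, hcol⟩ := (partitionCond_of_four_le h4).exists_isBicoloring
    obtain ⟨φ, hφ, hφ0⟩ := exists_flow_extend (fun S hS => hcol S hS true) fun _ => 1
    obtain ⟨ψ, hψ, hψ0⟩ := exists_flow_extend (fun S hS => hcol S hS false) fun _ => 1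
    refine ⟨fun e => (φ e, ψ e), fun e he => ?_, fun S => ?_⟩
    · cases hc : col e
      · have := hφ e (by simp [hc])
        simp [this] at he
      · have := hψ e (by simp [hc])
        simp [this] at he
    · exact Prod.ext (by rw [Prod.fst_sum]; exact hφ0 S) (by rw [Prod.snd_sum]; exact hψ0 S)
  push Not at h4
  obtain ⟨X, ⟨x, v, hX⟩, hX4⟩ := h4
  have hX1 := h1 X
  have hX3 := h3 X
  have hcard : (cut s t X).card = 0 ∨ (cut s t X).card = 2 := by omega
  rcases hcard with hcard | hcard
  · obtain ⟨φ, hφ, hφ0⟩ := hmerge v x (by rintro rfl; exact hX rfl)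
    exact ⟨φ, hφ, sum_cut_eq_zero_of_merge hK hφ0 (Ne.symm hX)
      (by rw [Finset.card_eq_zero.mp hcard, Finset.sum_empty])⟩
  · obtain ⟨f, g, hfg, hfgX⟩ := Finset.card_eq_two.mp hcard
    have hf : X (s f) ≠ X (t f) := mem_cut.mp (by rw [hfgX]; simp)
    obtain ⟨φ, hφ, hφ0⟩ := hmerge (s f) (t f) (by intro h; exact hf (by rw [h]))
    refine ⟨Function.update φ f (φ g), fun e => ?_, sum_cut_eq_zero_of_merge hK ?_ hf ?_⟩
    · by_cases he : e = f
      · subst he; simp [hφ]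
      · simp [he, hφ]
    · intro S hS
      rw [Finset.sum_update_of_notMem (by simp [mem_cut, hS])]
      exact hφ0 S hS
    · rw [hfgX, Finset.sum_pair hfg, Function.update_self, Function.update_of_ne hfg.symm]
      exact hK _

end Flow

/-! ### Perfect matchings -/

section Matching

variable {V E : Type} [Fintype E] {s t : E → V}

lemma card_cut_modEq [Fintype V] (h3 : ∀ v, (cut s t (single v)).card = 3) (S : V → Bool) :
    (cut s t S).card ≡ (Finset.univ.filter fun v => S v = true).card [MOD 2] := by
  rw [← ZMod.natCast_eq_natCast_iff]
  have h := sum_cut_single (s := s) (t := t) (A := ZMod 2) fun v _ => if S v then 1 else 0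
  have h2 : (3 : ZMod 2) = 1 := by decide
  have h0 : (1 + 1 : ZMod 2) = 0 := by decide
  simp only [Finset.sum_const, h3, nsmul_eq_mul, Nat.cast_ofNat, h2, one_mul,
    Finset.sum_boole] at h
  rw [h, Finset.card_eq_sum_ones, Nat.cast_sum]
  have hle : cut s t S ⊆ cut s t id := fun e he => mem_cut.mpr fun h => mem_cut.mp he (congrArg S h)
  rw [← Finset.sum_subset hle]
  · refine Finset.sum_congr rfl fun e he => ?_
    rw [mem_cut] at he
    revert he
    cases S (s e) <;> cases S (t e) <;> simp
  · intro e _ he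
    rw [mem_cut, not_not] at he
    rw [he]
    cases S (t e) <;> simp [h0]

/-- If the disjoint sets `X c` avoid `U`, and only edges in `D` or meeting `U` leave them, then
their cuts are bounded by the degrees of the vertices in `U`. -/
lemma sum_card_cut_le {ι : Type} (O : Finset ι) (X : ι → V → Bool) (U : Finset V) (D : Finset E)
    (hdisj : ∀ v, (O.filter fun c => X c v = true).card ≤ 1)
    (hU : ∀ v ∈ U, ∀ c, X c v = false)
    (hD : ∀ e ∉ D, s e ∉ U → t e ∉ U → ∀ c, X c (s e) = X c (t e)) :
    ∑ c ∈ O, (cut s t (X c)).card ≤ ∑ v ∈ U, (cut s t (single v)).card + 2 * D.card := by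
  have hpt : ∀ e, (O.filter fun c => e ∈ cut s t (X c)).card ≤
      (U.filter fun v => e ∈ cut s t (single v)).card + if e ∈ D then 2 else 0 := by
    intro e
    have hone : ∀ v : V, v ∈ U → (v = s e ∨ v = t e) →
        (O.filter fun c => e ∈ cut s t (X c)).card ≤
          (U.filter fun v => e ∈ cut s t (single v)).card := by
      intro v hv hve
      rcases (O.filter fun c => e ∈ cut s t (X c)).eq_empty_or_nonempty with h0 | ⟨c, hc⟩
      · simp [h0]
      · have hce := mem_cut.mp (Finset.mem_filter.mp hc).2
        have hne : s e ≠ t e := fun h => hce (congrArg _ h)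
        have hpos : 0 < (U.filter fun v => e ∈ cut s t (single v)).card :=
          Finset.card_pos.mpr ⟨v, Finset.mem_filter.mpr ⟨hv, cut_single_eq.mpr
            ⟨hne, hve.imp Eq.symm Eq.symm⟩⟩⟩
        refine le_trans ?_ hpos
        rcases hve with rfl | rfl
        · refine (Finset.card_le_card fun c hc => ?_).trans (hdisj (t e))
          rw [Finset.mem_filter, mem_cut, hU _ hv] at hc
          exact Finset.mem_filter.mpr ⟨hc.1, by simpa using hc.2⟩
        · refine (Finset.card_le_card fun c hc => ?_).trans (hdisj (s e))
          rw [Finset.mem_filter, mem_cut, hU _ hv] at hc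
          exact Finset.mem_filter.mpr ⟨hc.1, by simpa using hc.2⟩
    by_cases heD : e ∈ D
    · rw [if_pos heD]
      have hsub : (O.filter fun c => e ∈ cut s t (X c)) ⊆
          (O.filter fun c => X c (s e) = true) ∪ (O.filter fun c => X c (t e) = true) := by
        intro c hc
        rw [Finset.mem_filter, mem_cut] at hc
        rw [Finset.mem_union, Finset.mem_filter, Finset.mem_filter]
        have := hc.2
        revert this
        cases X c (s e) <;> cases X c (t e) <;> simp [hc.1]
      have h1 := (Finset.card_le_card hsub).trans (Finset.card_union_le _ _)
      have h2 := hdisj (s e)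
      have h3 := hdisj (t e)
      omega
    · rw [if_neg heD, add_zero]
      by_cases hs : s e ∈ U
      · exact hone _ hs (Or.inl rfl)
      by_cases ht : t e ∈ U
      · exact hone _ ht (Or.inr rfl)
      simp [mem_cut, hD e heD hs ht]
  have h1 : ∑ c ∈ O, (cut s t (X c)).card =
      ∑ e, (O.filter fun c => e ∈ cut s t (X c)).card := by
    simp only [Finset.card_filter]
    rw [Finset.sum_comm]
    simp
  have h2 : ∑ v ∈ U, (cut s t (single v)).card =
      ∑ e, (U.filter fun v => e ∈ cut s t (single v)).card := by
    simp only [Finset.card_filter]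
    rw [Finset.sum_comm]
    simp
  have h3 : 2 * D.card = ∑ e, if e ∈ D then 2 else 0 := by simp [mul_comm]
  rw [h1, h2, h3, ← Finset.sum_add_distrib]
  exact Finset.sum_le_sum fun e _ => hpt e

/-- The simple graph underlying the multigraph with the edges in `D` deleted. -/
def underlying (s t : E → V) (D : Finset E) : SimpleGraph V where
  Adj u v := u ≠ v ∧ ∃ e ∉ D, s(s e, t e) = s(u, v)
  symm := ⟨fun _ _ ⟨h, e, he, h'⟩ => ⟨h.symm, e, he, h'.trans Sym2.eq_swap⟩⟩
  loopless := ⟨fun _ h => h.1 rfl⟩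

lemma exists_matching_underlying [Fintype V]
    (h3 : ∀ v, (cut s t (single v)).card = 3)
    (h1 : ∀ S : V → Bool, (cut s t S).card ≠ 1) {D : Finset E} (hD : D.card ≤ 2) :
    ∃ M : (underlying s t D).Subgraph, M.IsPerfectMatching := by
  rw [SimpleGraph.tutte]
  intro U hviol
  rw [SimpleGraph.IsTutteViolator] at hviol
  set H := ((⊤ : (underlying s t D).Subgraph).deleteVerts U).coe with hH
  have hmem : ∀ v, v ∈ ((⊤ : (underlying s t D).Subgraph).deleteVerts U).verts ↔ v ∉ U := by simp
  have heven : 2 ∣ Fintype.card V := by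
    have := sum_card_cut_single (s := s) (t := t)
    simp only [h3, Finset.sum_const, Finset.card_univ, smul_eq_mul] at this
    omega
  have hodd := H.odd_ncard_oddComponents
  have hverts : Nat.card ((⊤ : (underlying s t D).Subgraph).deleteVerts U).verts + U.ncard =
      Fintype.card V := by
    rw [Nat.card_coe_set_eq, ← Nat.card_eq_fintype_card, ← Set.ncard_add_ncard_compl U, add_comm]
    congr 2
    ext v; simp
  have hq : U.ncard + 2 ≤ H.oddComponents.ncard := by
    rw [Nat.odd_iff, Nat.odd_iff] at hodd
    omega
  let X : H.ConnectedComponent → V → Bool := fun c v =>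
    decide (∃ h : v ∉ U, H.connectedComponentMk ⟨v, (hmem v).mpr h⟩ = c)
  have hle := sum_card_cut_le (s := s) (t := t) H.oddComponents.toFinset X U.toFinset D ?_ ?_ ?_
  · have hge : ∀ c ∈ H.oddComponents.toFinset, 3 ≤ (cut s t (X c)).card := by
      intro c hc
      have hc' : Odd c.supp.ncard := by simpa using hc
      have hX : (Finset.univ.filter fun v => X c v = true).card = c.supp.ncard := by
        rw [← Set.ncard_coe_finset, ← Set.ncard_image_of_injective c.supp Subtype.val_injective]
        congr 1
        ext v
        simp [X]
      have hpar := card_cut_modEq h3 (X c)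
      have hne := h1 (X c)
      rw [hX, Nat.ModEq, Nat.odd_iff.mp hc'] at hpar
      omega
    have hsum := Finset.sum_le_sum hge
    simp only [h3, Finset.sum_const, smul_eq_mul] at hsum hle
    rw [← Set.ncard_eq_toFinset_card'] at hsum hle
    omega
  · intro v
    refine Finset.card_le_one.mpr fun c hc d hd => ?_
    simp only [Finset.mem_filter, X, decide_eq_true_eq] at hc hd
    obtain ⟨_, _, hc⟩ := hc
    obtain ⟨_, _, hd⟩ := hd
    exact hc.symm.trans hd
  · intro v hv c
    simpa [X] using fun h => absurd (Set.mem_toFinset.mp hv) h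
  · intro e he hs ht c
    rw [Set.mem_toFinset] at hs ht
    by_cases hne : s e = t e
    · rw [hne]
    · have hadj : H.Adj ⟨s e, (hmem _).mpr hs⟩ ⟨t e, (hmem _).mpr ht⟩ :=
        SimpleGraph.Subgraph.deleteVerts_adj.mpr ⟨trivial, hs, trivial, ht, hne, e, he, rfl⟩
      have := SimpleGraph.ConnectedComponent.connectedComponentMk_eq_of_adj hadj
      simp [X, hs, ht, this]

/-- **Schönberger's theorem**: every edge of a bridgeless cubic graph lies in a perfect matching. -/
lemma exists_perfect_matching [Fintype V] (h3 : ∀ v, (cut s t (single v)).card = 3)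
    (h1 : ∀ S : V → Bool, (cut s t S).card ≠ 1) {e : E} (he : s e ≠ t e) :
    ∃ M : Finset E, e ∈ M ∧ ∀ v, (M ∩ cut s t (single v)).card = 1 := by
  have hes : e ∈ cut s t (single (s e)) := cut_single_eq.mpr ⟨he, Or.inl rfl⟩
  obtain ⟨N, hN⟩ := exists_matching_underlying h3 h1
    (D := (cut s t (single (s e))).erase e) (by rw [Finset.card_erase_of_mem hes, h3])
  rw [SimpleGraph.Subgraph.isPerfectMatching_iff] at hN
  have hch : ∀ z : N.edgeSet, ∃ k ∉ (cut s t (single (s e))).erase e, s(s k, t k) = z.1 := by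
    rintro ⟨z, hz⟩
    induction z with
    | _ u v => exact (N.adj_sub hz).2
  choose ch hchD hch using hch
  have hM : ∀ v, ∃ z, Finset.univ.image ch ∩ cut s t (single v) = {ch z} := by
    intro v
    obtain ⟨w, hw, huniq⟩ := hN v
    have hne := (N.adj_sub hw).1
    refine ⟨⟨s(v, w), hw⟩, ?_⟩
    ext k
    simp only [Finset.mem_inter, Finset.mem_image, Finset.mem_univ, true_and,
      Finset.mem_singleton, cut_single_eq]
    constructor
    · rintro ⟨⟨z, rfl⟩, hst, hv⟩
      congr 1
      have hz := hch z
      have hadj : N.Adj (s (ch z)) (t (ch z)) := by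
        rw [← SimpleGraph.Subgraph.mem_edgeSet, hz]; exact z.2
      apply Subtype.ext
      rw [← hz]
      rcases hv with hv | hv
      · rw [hv] at hadj ⊢
        rw [huniq _ hadj]
      · rw [hv] at hadj ⊢
        rw [huniq _ hadj.symm, Sym2.eq_swap]
    · rintro rfl
      have hz := hch ⟨s(v, w), hw⟩
      rw [Sym2.eq_iff] at hz
      refine ⟨⟨_, rfl⟩, ?_⟩
      rcases hz with ⟨h1, h2⟩ | ⟨h1, h2⟩
      · exact ⟨by rw [h1, h2]; exact hne, Or.inl h1⟩
      · exact ⟨by rw [h1, h2]; exact hne.symm, Or.inr h2⟩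
  refine ⟨Finset.univ.image ch, ?_, fun v => ?_⟩
  · obtain ⟨z, hz⟩ := hM (s e)
    have hmem : ch z ∈ Finset.univ.image ch ∩ cut s t (single (s e)) := by simp [hz]
    have hze : ch z = e := by
      by_contra hne
      exact hchD z (Finset.mem_erase.mpr ⟨hne, (Finset.mem_inter.mp hmem).2⟩)
    exact Finset.mem_image.mpr ⟨z, Finset.mem_univ _, hze⟩
  · obtain ⟨z, hz⟩ := hM v
    rw [hz, Finset.card_singleton]

end Matching

/-! ### Perfect matchings meeting every 3-edge-cut once -/

/-- The map identifying the vertices with label `true`. -/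
noncomputable def contract {V : Type} (S : V → Bool) : V → Option {v // S v = false} := fun v =>
  if h : S v = false then some ⟨v, h⟩ else none

section Contract

variable {V E : Type} [Fintype E] {s t : E → V} {S : V → Bool}

lemma contract_of_false {v : V} (h : S v = false) : contract S v = some ⟨v, h⟩ := by
  simp [contract, h]

lemma contract_of_true {v : V} (h : S v = true) : contract S v = none := by
  simp [contract, h]

lemma contract_ne_of_mem_cut {e : E} (he : e ∈ cut s t S) :
    contract S (s e) ≠ contract S (t e) := by
  rw [mem_cut] at he
  cases h : S (s e) <;> cases h' : S (t e) <;>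
    simp_all [contract_of_false, contract_of_true]

lemma contract_ne_of_false {v w : V} (h : S v = false) (hne : v ≠ w) :
    contract S v ≠ contract S w := by
  cases h' : S w <;> simp_all [contract_of_false, contract_of_true]

lemma cut_contract {Y : V → Bool} (hY : ∀ v w, S v = true → S w = true → Y v = Y w) :
    ∃ Y' : Option {v // S v = false} → Bool,
      cut (contract S ∘ s) (contract S ∘ t) Y' = cut s t Y := by
  by_cases hS : ∃ x, S x = true
  · obtain ⟨x, hx⟩ := hS
    refine ⟨fun o => o.elim (Y x) fun v => Y v, ?_⟩
    have h : ∀ v, (contract S v).elim (Y x) (fun v => Y v) = Y v := by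
      intro v
      cases hv : S v
      · simp [contract_of_false hv]
      · simp [contract_of_true hv, hY x v hx hv]
    ext e
    simp [mem_cut, h]
  · refine ⟨fun o => o.elim true fun v => Y v, ?_⟩
    have h : ∀ v, (contract S v).elim true (fun v => Y v) = Y v := by
      intro v
      cases hv : S v
      · simp [contract_of_false hv]
      · exact absurd ⟨v, hv⟩ hS
    ext e
    simp [mem_cut, h]

lemma cut_contract_single (w : Option {v // S v = false}) :
    cut (contract S ∘ s) (contract S ∘ t) (single w) =
      w.elim (cut s t S) fun v => cut s t (single v.1) := by
  have h : ∀ v, single w (contract S v) = w.elim (S v) fun u => single u.1 v := by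
    intro v
    cases hv : S v <;> rcases w with _ | ⟨u, hu⟩ <;>
      simp only [single, contract_of_false, contract_of_true, hv] <;> simp
    rintro rfl
    simp [hu] at hv
  ext e
  rcases w with _ | u <;> simp [mem_cut, h]

lemma card_contract_lt [Fintype V] {x y : V} (hne : x ≠ y) (hx : S x = true) (hy : S y = true) :
    Fintype.card (Option {v // S v = false}) < Fintype.card V := by
  have h : Fintype.card {v // S v = false} ≤
      ((Finset.univ.erase x).erase y).card := by
    rw [Fintype.card_subtype]
    refine Finset.card_le_card fun v hv => ?_
    have hv' := (Finset.mem_filter.mp hv).2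
    simp only [Finset.mem_erase, Finset.mem_univ, and_true]
    exact ⟨fun h => by simp_all, fun h => by simp_all⟩
  have hxy := Finset.one_lt_card.mpr ⟨x, Finset.mem_univ x, y, Finset.mem_univ y, hne⟩
  rw [Finset.card_univ] at hxy
  rw [Finset.card_erase_of_mem (by simp [hne.symm]), Finset.card_erase_of_mem (by simp),
    Finset.card_univ] at h
  rw [Fintype.card_option]
  omega

end Contract

section ThreeCut

variable {V E : Type} [Fintype E] {s t : E → V} {S : V → Bool}

lemma exists_card_inter_cut_add (S Y : V → Bool) : ∃ K : Finset E, ∀ N : Finset E,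
    (N ∩ cut s t S).card + (N ∩ cut s t Y).card =
      (N ∩ cut s t fun v => S v && Y v).card + (N ∩ cut s t fun v => S v || Y v).card +
        2 * (N ∩ K).card := by
  refine ⟨Finset.univ.filter fun e => S (s e) ≠ S (t e) ∧ Y (s e) ≠ Y (t e) ∧ S (s e) ≠ Y (s e),
    fun N => ?_⟩
  simp only [cut, Finset.inter_filter, Finset.inter_univ, Finset.card_filter]
  rw [← Finset.sum_add_distrib, ← Finset.sum_add_distrib, Finset.mul_sum, ← Finset.sum_add_distrib]
  refine Finset.sum_congr rfl fun e _ => ?_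
  cases S (s e) <;> cases S (t e) <;> cases Y (s e) <;> cases Y (t e) <;> simp

/-- Edge sets meeting once the 3-edge-cuts on either side of a 3-edge-cut `S` can be glued when
they agree on `S`. -/
lemma exists_glue (h1 : ∀ S : V → Bool, (cut s t S).card ≠ 1) (hS : (cut s t S).card = 3)
    {M₁ M₂ : Finset E}
    (hM₁ : ∀ Y : V → Bool, (∀ v w, S v = true → S w = true → Y v = Y w) →
      (cut s t Y).card = 3 → (M₁ ∩ cut s t Y).card = 1)
    (hM₂ : ∀ Y : V → Bool, (∀ v w, S v = false → S w = false → Y v = Y w) →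
      (cut s t Y).card = 3 → (M₂ ∩ cut s t Y).card = 1)
    (h12 : M₁ ∩ cut s t S = M₂ ∩ cut s t S) :
    ∃ M : Finset E, (∀ e, S (s e) = false → (e ∈ M ↔ e ∈ M₁)) ∧
      ∀ Y : V → Bool, (cut s t Y).card = 3 → (M ∩ cut s t Y).card = 1 := by
  set M : Finset E := Finset.univ.filter fun e =>
    if S (s e) = false ∨ S (t e) = false then e ∈ M₁ else e ∈ M₂ with hM
  have hMe : ∀ e, e ∈ M ↔ if S (s e) = false ∨ S (t e) = false then e ∈ M₁ else e ∈ M₂ := by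
    simp [hM]
  have key₁ : ∀ Y : V → Bool, (∀ v w, S v = true → S w = true → Y v = Y w) →
      (cut s t Y).card = 3 → (M ∩ cut s t Y).card = 1 := by
    intro Y hY h3
    rw [← hM₁ Y hY h3]
    congr 1
    ext e
    simp only [Finset.mem_inter, and_congr_left_iff, mem_cut]
    intro he
    rw [hMe, if_pos]
    by_contra h
    simp only [not_or, Bool.not_eq_false] at h
    exact he (hY _ _ h.1 h.2)
  have key₂ : ∀ Y : V → Bool, (∀ v w, S v = false → S w = false → Y v = Y w) →
      (cut s t Y).card = 3 → (M ∩ cut s t Y).card = 1 := by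
    intro Y hY h3
    rw [← hM₂ Y hY h3]
    congr 1
    ext e
    simp only [Finset.mem_inter, and_congr_left_iff, mem_cut]
    intro he
    rw [hMe]
    split_ifs with h
    · have heS : e ∈ cut s t S := by
        rw [mem_cut]
        intro hst
        exact he (hY _ _ (by simp_all) (by simp_all))
      have := Finset.ext_iff.mp h12 e
      simpa [heS] using this
    · rfl
  have hodd : ∀ Y : V → Bool, (cut s t Y).card = 3 →
      (cut s t fun v => S v && Y v).card % 2 = 1 → (M ∩ cut s t Y).card = 1 := by
    intro Y hY hA
    obtain ⟨K, hK⟩ := exists_card_inter_cut_add (s := s) (t := t) S Y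
    have hu := hK Finset.univ
    simp only [Finset.univ_inter, hS, hY] at hu
    have hA1 := h1 fun v => S v && Y v
    have hB1 := h1 fun v => S v || Y v
    have hK0 : K = ∅ := Finset.card_eq_zero.mp (by omega)
    have hA2 := key₂ (fun v => S v && Y v) (fun v w hv hw => by simp [hv, hw]) (by omega)
    have hB2 := key₁ (fun v => S v || Y v) (fun v w hv hw => by simp [hv, hw]) (by omega)
    have hS2 := key₁ S (fun v w hv hw => hv.trans hw.symm) hS
    have hMK := hK M
    rw [hA2, hB2, hS2, hK0, Finset.inter_empty, Finset.card_empty] at hMK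
    omega
  refine ⟨M, fun e he => by simp [hMe, he], fun Y hY => ?_⟩
  rcases Nat.mod_two_eq_zero_or_one (cut s t fun v => S v && Y v).card with h0 | h0
  · have hx := card_cut_xor (s := s) (t := t) (fun v => S v && Y v) (fun v => S v && !Y v)
    have hxS : (fun v => (S v && Y v) ^^ (S v && !Y v)) = S := by
      funext v; cases S v <;> cases Y v <;> rfl
    rw [hxS, hS, Nat.ModEq] at hx
    have := hodd (fun v => !Y v) (by rwa [cut_not]) (by omega)
    rwa [cut_not] at this
  · exact hodd Y hY h0

/-- Every edge of a bridgeless cubic graph lies in a perfect matching meeting every 3-edge-cut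
exactly once. -/
lemma exists_matching_threeCut [Fintype V] (h3 : ∀ v, (cut s t (single v)).card = 3)
    (h1 : ∀ S : V → Bool, (cut s t S).card ≠ 1) {e : E} (he : s e ≠ t e) :
    ∃ M : Finset E, e ∈ M ∧
      ∀ S : V → Bool, (cut s t S).card = 3 → (M ∩ cut s t S).card = 1 := by
  induction hn : Fintype.card V using Nat.strong_induction_on generalizing V e with
  | _ n ih =>
  subst hn
  have hcon : ∀ S : V → Bool, (cut s t S).card = 3 → (∃ x y, x ≠ y ∧ S x = true ∧ S y = true) →
      ∀ f, contract S (s f) ≠ contract S (t f) → ∃ M : Finset E, f ∈ M ∧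
        ∀ Y : V → Bool, (∀ v w, S v = true → S w = true → Y v = Y w) →
          (cut s t Y).card = 3 → (M ∩ cut s t Y).card = 1 := by
    rintro S hS ⟨x, y, hne, hx, hy⟩ f hf
    obtain ⟨M, hfM, hM⟩ := ih _ (card_contract_lt hne hx hy)
      (s := contract S ∘ s) (t := contract S ∘ t)
      (fun w => by rw [cut_contract_single]; cases w <;> simp [hS, h3])
      (fun Y => h1 (Y ∘ contract S)) hf rfl
    refine ⟨M, hfM, fun Y hY hY3 => ?_⟩
    obtain ⟨Y', hY'⟩ := cut_contract (s := s) (t := t) hY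
    rw [← hY']
    exact hM Y' (by rw [hY', hY3])
  by_cases hnt : ∃ S : V → Bool, (cut s t S).card = 3 ∧
      (∃ x y, x ≠ y ∧ S x = true ∧ S y = true) ∧ ∃ x y, x ≠ y ∧ S x = false ∧ S y = false
  · obtain ⟨S, hS, hST, hSF, hSe⟩ : ∃ S : V → Bool, (cut s t S).card = 3 ∧
        (∃ x y, x ≠ y ∧ S x = true ∧ S y = true) ∧
        (∃ x y, x ≠ y ∧ S x = false ∧ S y = false) ∧ S (s e) = false := by
      obtain ⟨S, hS, hST, hSF⟩ := hnt
      cases h : S (s e)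
      · exact ⟨S, hS, hST, hSF, h⟩
      · exact ⟨fun v => !S v, by rwa [cut_not], by simpa using hSF, by simpa using hST,
          by simp [h]⟩
    obtain ⟨M₁, heM₁, hM₁⟩ := hcon S hS hST e (contract_ne_of_false hSe he)
    have hM₁S := hM₁ S (fun v w hv hw => hv.trans hw.symm) hS
    obtain ⟨f, hf⟩ := Finset.card_eq_one.mp hM₁S
    have hfS : f ∈ cut s t S := by
      have : f ∈ M₁ ∩ cut s t S := by simp [hf]
      exact (Finset.mem_inter.mp this).2
    obtain ⟨M₂, hfM₂, hM₂⟩ := hcon (fun v => !S v) (by rwa [cut_not]) (by simpa using hSF) f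
      (contract_ne_of_mem_cut (by rwa [cut_not]))
    simp only [Bool.not_eq_true'] at hM₂
    have hM₂S := hM₂ S (fun v w hv hw => hv.trans hw.symm) hS
    have h12 : M₁ ∩ cut s t S = M₂ ∩ cut s t S := by
      rw [hf]
      exact Finset.eq_of_subset_of_card_le
        (Finset.singleton_subset_iff.mpr (Finset.mem_inter.mpr ⟨hfM₂, hfS⟩)) (by simp [hM₂S])
    obtain ⟨M, hMe, hM⟩ := exists_glue h1 hS hM₁ hM₂ h12
    exact ⟨M, (hMe e hSe).mpr heM₁, hM⟩
  · obtain ⟨M, heM, hM⟩ := exists_perfect_matching h3 h1 he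
    refine ⟨M, heM, fun S hS => ?_⟩
    have hsingle : ∀ T : V → Bool, (cut s t T).card = 3 →
        (¬ ∃ x y, x ≠ y ∧ T x = true ∧ T y = true) → (M ∩ cut s t T).card = 1 := by
      intro T hT hT1
      obtain ⟨f, hf⟩ := Finset.card_pos.mp (by rw [hT]; norm_num)
      obtain ⟨v, hv⟩ : ∃ v, T v = true := by
        rw [mem_cut] at hf
        cases hs : T (s f)
        · exact ⟨t f, by simpa [hs] using hf.symm⟩
        · exact ⟨_, hs⟩
      have hTv : T = single v := by
        funext w
        by_cases hw : w = v
        · simp [single, hw, hv]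
        · simp only [single, hw, decide_false, ← Bool.not_eq_true]
          exact fun h => hT1 ⟨w, v, hw, h, hv⟩
      rw [hTv]
      exact hM v
    by_cases hST : ∃ x y, x ≠ y ∧ S x = true ∧ S y = true
    · rw [← cut_not]
      exact hsingle _ (by rwa [cut_not]) fun h => hnt ⟨S, hS, hST, by simpa using h⟩
    · exact hsingle S hS hST

end ThreeCut

/-! ### Cuts in simple graphs -/

lemma exists_endpoints {V : Type} (G : SimpleGraph V) :
    ∃ s t : G.edgeSet → V, ∀ e, s(s e, t e) = e.1 := by
  have h : ∀ e : G.edgeSet, ∃ p : V × V, s(p.1, p.2) = e.1 := by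
    rintro ⟨e, he⟩
    induction e with
    | _ u v => exact ⟨(u, v), rfl⟩
  choose p hp using h
  exact ⟨fun e => (p e).1, fun e => (p e).2, hp⟩

lemma eq_of_reachable {V W : Type} {H : SimpleGraph V} {f : V → W}
    (hf : ∀ x y, H.Adj x y → f x = f y) {x y : V} (h : H.Reachable x y) : f x = f y := by
  obtain ⟨p⟩ := h
  induction p with
  | nil => rfl
  | cons hadj _ ih => exact (hf _ _ hadj).trans ih

section SimpleGraphCut

variable {V : Type} {G : SimpleGraph V} {s t : G.edgeSet → V}

lemma adj_endpoints (hst : ∀ e, s(s e, t e) = e.1) (e : G.edgeSet) : G.Adj (s e) (t e) := by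
  rw [← SimpleGraph.mem_edgeSet, hst]
  exact e.2

lemma mem_cut_single_iff [Fintype V] (hst : ∀ e, s(s e, t e) = e.1) {v : V} {e : G.edgeSet} :
    e ∈ cut s t (single v) ↔ v ∈ e.1 := by
  rw [cut_single_eq, ← hst, Sym2.mem_iff]
  have := (adj_endpoints hst e).ne
  simp [this, eq_comm]

lemma card_cut_single_eq_degree [Fintype V] (hst : ∀ e, s(s e, t e) = e.1) (v : V) :
    (cut s t (single v)).card = G.degree v := by
  rw [← SimpleGraph.card_incidenceFinset_eq_degree,
    ← Finset.card_map (Function.Embedding.subtype _)]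
  congr 1
  ext e
  simp [mem_cut_single_iff hst, SimpleGraph.incidenceSet, and_comm]

lemma card_cut_ne_one [Fintype V] (hbl : G.Bridgeless) (hst : ∀ e, s(s e, t e) = e.1)
    (S : V → Bool) : (cut s t S).card ≠ 1 := by
  intro h
  obtain ⟨f, hf⟩ := Finset.card_eq_one.mp h
  have hfS : f ∈ cut s t S := by simp [hf]
  refine hbl s(s f, t f) (SimpleGraph.isBridge_iff.mpr fun hr => mem_cut.mp hfS ?_)
  refine eq_of_reachable (fun x y hxy => ?_) hr
  rw [SimpleGraph.deleteEdges_adj] at hxy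
  by_contra hS
  have hg : (⟨s(x, y), hxy.1⟩ : G.edgeSet) ∈ cut s t S := by
    have := hst ⟨s(x, y), hxy.1⟩
    rw [mem_cut]
    rcases Sym2.eq_iff.mp this with ⟨h1, h2⟩ | ⟨h1, h2⟩ <;> rw [h1, h2]
    exacts [hS, Ne.symm hS]
  rw [hf, Finset.mem_singleton] at hg
  apply hxy.2
  rw [hst, ← hg, Set.mem_singleton_iff]

lemma sum_card_inter_cut_single [Fintype V] (N : Finset G.edgeSet) (T : Finset V) :
    ∑ v ∈ T, (N ∩ cut s t (single v)).card =
      (N ∩ cut s t fun v => decide (v ∈ T)).card +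
        2 * (N ∩ (cut s t id).filter fun e => s e ∈ T ∧ t e ∈ T).card := by
  have h := sum_cut_single (s := s) (t := t) (A := ℕ)
    fun v e => if v ∈ T ∧ e ∈ N then 1 else 0
  have h1 : ∑ v ∈ T, (N ∩ cut s t (single v)).card =
      ∑ v, ∑ e ∈ cut s t (single v), if v ∈ T ∧ e ∈ N then 1 else 0 := by
    rw [← Finset.sum_filter_add_sum_filter_not Finset.univ (fun v => v ∈ T)]
    rw [Finset.sum_eq_zero (s := Finset.univ.filter fun v => ¬ v ∈ T), add_zero]
    · refine Finset.sum_congr (by ext; simp) fun v hv => ?_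
      rw [← Finset.card_filter, Finset.inter_comm, ← Finset.filter_mem_eq_inter]
      simp [(Finset.mem_filter.mp hv).2]
    · intro v hv
      simp [(Finset.mem_filter.mp hv).2]
  rw [h1, h]
  simp only [cut, Finset.inter_filter, Finset.inter_univ, Finset.card_filter, Finset.filter_filter,
    Finset.sum_filter]
  have hN : ∀ F : G.edgeSet → ℕ, ∑ e ∈ N, F e = ∑ e, if e ∈ N then F e else 0 := by simp
  rw [hN, hN, Finset.mul_sum, ← Finset.sum_add_distrib]
  refine Finset.sum_congr rfl fun e _ => ?_
  by_cases hN : e ∈ N <;> by_cases hs : s e ∈ T <;> by_cases ht : t e ∈ T <;>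
    by_cases hne : s e = t e <;> simp_all

end SimpleGraphCut

/-! ### Triangles in claw-free cubic graphs -/

section ClawFreeCubic

variable {V : Type} {G : SimpleGraph V} {s t : G.edgeSet → V}

lemma exists_triangle [Fintype V] (hclaw : ClawFree G) (u : V) (hu : G.degree u = 3) :
    ∃ a b c, G.Adj u a ∧ G.Adj u b ∧ G.Adj a b ∧ ∀ w, G.Adj u w → w = a ∨ w = b ∨ w = c := by
  rw [← SimpleGraph.card_neighborFinset_eq_degree, Finset.card_eq_three] at hu
  obtain ⟨a, b, c, hab, hac, hbc, hu⟩ := hu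
  have hadj : ∀ w, G.Adj u w ↔ w = a ∨ w = b ∨ w = c := by
    intro w
    rw [← SimpleGraph.mem_neighborFinset, hu]
    simp
  by_cases h1 : G.Adj a b
  · exact ⟨a, b, c, by simp [hadj], by simp [hadj], h1, fun w => (hadj w).mp⟩
  by_cases h2 : G.Adj a c
  · exact ⟨a, c, b, by simp [hadj], by simp [hadj], h2, fun w h => by have := (hadj w).mp h; tauto⟩
  by_cases h3 : G.Adj b c
  · exact ⟨b, c, a, by simp [hadj], by simp [hadj], h3, fun w h => by have := (hadj w).mp h; tauto⟩
  exact absurd ⟨u, a, b, c, hab, hac, hbc, by simp [hadj], by simp [hadj], by simp [hadj],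
    h1, h2, h3⟩ hclaw

lemma exists_mem_of_triangle [Fintype V] (hst : ∀ e, s(s e, t e) = e.1)
    (hcubic : ∀ v, G.degree v = 3)
    {M : Finset G.edgeSet} (hM : ∀ S : V → Bool, (cut s t S).card = 3 → (M ∩ cut s t S).card = 1)
    {u a b : V} (hua : G.Adj u a) (hub : G.Adj u b) (hab : G.Adj a b) :
    ∃ g ∈ M, g.1 = s(u, a) ∨ g.1 = s(u, b) ∨ g.1 = s(a, b) := by
  set T : Finset V := {u, a, b} with hT
  set I := (cut s t id).filter fun e => s e ∈ T ∧ t e ∈ T with hI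
  have hTcard : T.card = 3 := Finset.card_eq_three.mpr ⟨u, a, b, hua.ne, hub.ne, hab.ne, rfl⟩
  have hI' : ∀ g, g ∈ I ↔ g.1 = s(u, a) ∨ g.1 = s(u, b) ∨ g.1 = s(a, b) := by
    intro g
    have hne := (adj_endpoints hst g).ne
    have h1 := hua.ne
    have h2 := hub.ne
    have h3 := hab.ne
    rw [← hst g]
    simp only [hI, hT, Finset.mem_filter, mem_cut, id, Finset.mem_insert, Finset.mem_singleton,
      Sym2.eq_iff]
    grind
  have hIcard : I.card = 3 := by
    have h1 : I = {⟨s(u, a), hua⟩, ⟨s(u, b), hub⟩, ⟨s(a, b), hab⟩} := by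
      ext g
      rw [hI']
      simp [Subtype.ext_iff]
    rw [h1, Finset.card_eq_three]
    refine ⟨_, _, _, ?_, ?_, ?_, rfl⟩ <;>
      simp [Subtype.ext_iff, hua.ne, hub.ne, hab.ne, hua.ne', hab.ne']
  have hdeg : ∀ v, (cut s t (single v)).card = 3 := fun v => by
    rw [card_cut_single_eq_degree hst, hcubic]
  have h1 := sum_card_inter_cut_single (s := s) (t := t) Finset.univ T
  have h2 := sum_card_inter_cut_single (s := s) (t := t) M T
  rw [← hI] at h1 h2
  simp only [Finset.univ_inter, hdeg, Finset.sum_const, hTcard, hIcard, smul_eq_mul] at h1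
  simp only [fun v => hM _ (hdeg v), Finset.sum_const, hTcard, smul_eq_mul] at h2
  rw [hM _ (by omega)] at h2
  obtain ⟨g, hg⟩ := Finset.card_pos.mp (show 0 < (M ∩ I).card by omega)
  rw [Finset.mem_inter, hI'] at hg
  exact ⟨g, hg⟩

/-- The spanning subgraph with edge set `M`. -/
def spanningSubgraph (M : Finset G.edgeSet) : G.Subgraph where
  verts := Set.univ
  Adj x y := ∃ e ∈ M, e.1 = s(x, y)
  adj_sub := fun ⟨e, _, h⟩ => by
    rw [← SimpleGraph.mem_edgeSet, ← h]
    exact e.2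
  edge_vert := fun _ => trivial
  symm := ⟨fun _ _ ⟨e, he, h⟩ => ⟨e, he, h.trans Sym2.eq_swap⟩⟩

lemma mem_edgeSet_spanningSubgraph {M : Finset G.edgeSet} (e : G.edgeSet) :
    e.1 ∈ (spanningSubgraph M).edgeSet ↔ e ∈ M := by
  obtain ⟨e, he⟩ := e
  induction e with
  | _ x y =>
    rw [SimpleGraph.Subgraph.mem_edgeSet]
    exact ⟨fun ⟨f, hf, hfe⟩ => by rwa [show f = ⟨s(x, y), he⟩ from Subtype.ext hfe] at hf,
      fun h => ⟨_, h, rfl⟩⟩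

end ClawFreeCubic

section Flow

variable {V : Type} {G : SimpleGraph V} {s t : G.edgeSet → V} {M : Finset G.edgeSet}
  {m : V → G.edgeSet}

lemma isPerfectMatching_spanningSubgraph (hm : ∀ v e, e ∈ M ∧ v ∈ e.1 ↔ e = m v) :
    (spanningSubgraph M).IsPerfectMatching := by
  rw [SimpleGraph.Subgraph.isPerfectMatching_iff]
  intro v
  obtain ⟨hmM, w, hw⟩ := (hm v _).mpr rfl
  refine ⟨w, ⟨m v, hmM, hw⟩, fun x ⟨e, he, hx⟩ => ?_⟩
  have := (hm v e).mp ⟨he, by simp [hx]⟩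
  rw [this, hw] at hx
  exact (Sym2.congr_right.mp hx).symm

lemma adj_compl2Factor {x y : V} (h : G.Adj x y) (hM : (⟨s(x, y), h⟩ : G.edgeSet) ∉ M) :
    (compl2Factor G (spanningSubgraph M)).Adj x y := by
  rw [compl2Factor, SimpleGraph.deleteEdges_adj]
  exact ⟨h, fun h' => hM ((mem_edgeSet_spanningSubgraph ⟨s(x, y), h⟩).mp h')⟩

/-- A matching meeting every 3-edge-cut once carries a nowhere-zero flow of the graph obtained by
contracting the components of its complement. -/
lemma exists_flow_compl2Factor [Fintype V] (hbl : G.Bridgeless) (hst : ∀ e, s(s e, t e) = e.1)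
    (hM : ∀ S : V → Bool, (cut s t S).card = 3 → (M ∩ cut s t S).card = 1) :
    ∃ φ : G.edgeSet → K4, (∀ e, φ e ≠ 0) ∧ ∀ u, ∑ e ∈ cut s t fun w =>
      decide ((compl2Factor G (spanningSubgraph M)).Reachable u w), φ e = 0 := by
  set H := compl2Factor G (spanningSubgraph M) with hH
  let q : V → H.ConnectedComponent := H.connectedComponentMk
  obtain ⟨φ, hφ0, hφ⟩ := exists_nowhere_zero_flow (s := q ∘ s) (t := q ∘ t)
    (fun S => card_cut_ne_one hbl hst (S ∘ q)) (fun S h3 => by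
      have h3' : (cut s t (S ∘ q)).card = 3 := h3
      have h1 := hM _ h3'
      rw [Finset.inter_eq_right.mpr, h3'] at h1
      · omega
      · intro e he
        by_contra heM
        refine mem_cut.mp he (congrArg S ?_)
        refine SimpleGraph.ConnectedComponent.connectedComponentMk_eq_of_adj
          (adj_compl2Factor (adj_endpoints hst e) ?_)
        rwa [show (⟨s(s e, t e), adj_endpoints hst e⟩ : G.edgeSet) = e from Subtype.ext (hst e)])
  refine ⟨φ, hφ0, fun u => ?_⟩
  rw [← hφ fun c => decide (q u = c)]
  refine Finset.sum_congr ?_ fun _ _ => rfl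
  ext e
  simp [mem_cut, q]

lemma sum_filter_matching [Fintype V] (hst : ∀ e, s(s e, t e) = e.1)
    (hm : ∀ v e, e ∈ M ∧ v ∈ e.1 ↔ e = m v)
    {C : V → Bool} (hC : ∀ e ∉ M, C (s e) = C (t e)) (ψ : G.edgeSet → K4) :
    ∑ v ∈ Finset.univ.filter (fun v => C v = true), ψ (m v) = ∑ e ∈ cut s t C, ψ e := by
  have hA : ∀ a : K4, a + a = 0 := by decide
  have h := sum_cut_single (s := s) (t := t)
    fun v e => if e ∈ M ∧ C v = true then ψ e else 0
  have h1 : ∀ v, (∑ e ∈ cut s t (single v), if e ∈ M ∧ C v = true then ψ e else 0) =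
      if C v = true then ψ (m v) else 0 := by
    intro v
    have hmv := (hm v _).mpr rfl
    rw [Finset.sum_eq_single_of_mem (m v) ((mem_cut_single_iff hst).mpr hmv.2)]
    · simp [hmv.1]
    · intro e he hne
      exact if_neg fun h => hne ((hm v e).mp ⟨h.1, (mem_cut_single_iff hst).mp he⟩)
  simp only [h1] at h
  rw [Finset.sum_filter, h]
  simp only [cut, Finset.sum_filter]
  refine Finset.sum_congr rfl fun e _ => ?_
  have hne := (adj_endpoints hst e).ne
  by_cases he : e ∈ M
  · cases h1 : C (s e) <;> cases h2 : C (t e) <;> simp [he, hne, hA]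
  · simp [he, hC e he]

end Flow

lemma exists_nonConflicting {V : Type} [Fintype V] (G : SimpleGraph V) (hclaw : ClawFree G)
    (hbl : G.Bridgeless) (hcubic : ∀ v, G.degree v = 3) (e : Sym2 V) (he : e ∈ G.edgeSet) :
    ∃ M : G.Subgraph, M.IsPerfectMatching ∧ e ∈ M.edgeSet ∧
      ∃ θ : V → K4, IsNZFlowWrt G M θ ∧ NonConflicting G M θ := by
  obtain ⟨s, t, hst⟩ := exists_endpoints G
  have h3 : ∀ v, (cut s t (single v)).card = 3 := fun v => by
    rw [card_cut_single_eq_degree hst, hcubic]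
  obtain ⟨M, heM, hM⟩ : ∃ M : Finset G.edgeSet, ⟨e, he⟩ ∈ M ∧
      ∀ S : V → Bool, (cut s t S).card = 3 → (M ∩ cut s t S).card = 1 := by
    obtain ⟨M, heM, hM⟩ := exists_matching_threeCut h3 (card_cut_ne_one hbl hst) (e := ⟨e, he⟩)
      (adj_endpoints hst _).ne
    exact ⟨M, heM, fun S hS => by convert hM S hS⟩
  obtain ⟨m, hm⟩ : ∃ m : V → G.edgeSet, ∀ v e, e ∈ M ∧ v ∈ e.1 ↔ e = m v := by
    choose m hm using fun v => Finset.card_eq_one.mp (hM _ (h3 v))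
    refine ⟨m, fun v e => ?_⟩
    rw [← Finset.mem_singleton, ← hm v, Finset.mem_inter, mem_cut_single_iff hst]
  obtain ⟨φ, hφ0, hφ⟩ := exists_flow_compl2Factor hbl hst hM
  let tri : G.edgeSet → Prop := fun e => ∃ w, G.Adj (s e) w ∧ G.Adj (t e) w
  have htri : ∀ {x y w : V} {g : G.edgeSet}, g.1 = s(x, y) → G.Adj x w → G.Adj y w → tri g := by
    intro x y w g hg hx hy
    rw [← hst] at hg
    rcases Sym2.eq_iff.mp hg with ⟨h1, h2⟩ | ⟨h1, h2⟩
    · exact ⟨w, by rwa [h1], by rwa [h2]⟩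
    · exact ⟨w, by rwa [h1], by rwa [h2]⟩
  let ψ : G.edgeSet → K4 := fun e => if tri e then (1, 1) else φ e
  refine ⟨spanningSubgraph M, isPerfectMatching_spanningSubgraph hm,
    (mem_edgeSet_spanningSubgraph ⟨e, he⟩).mpr heM, fun v => ψ (m v), ⟨?_, ?_, ?_⟩, ?_⟩
  · rintro u v ⟨f, hf, huv⟩
    dsimp only
    rw [← (hm u f).mp ⟨hf, by simp [huv]⟩, ← (hm v f).mp ⟨hf, by simp [huv]⟩]
  · intro v
    by_cases h : tri (m v)
    · simp [ψ, h]
    · simpa [ψ, h] using hφ0 (m v)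
  · intro u
    set C : V → Bool := fun w =>
      decide ((compl2Factor G (spanningSubgraph M)).Reachable u w) with hCdef
    have hadj : ∀ x y, (compl2Factor G (spanningSubgraph M)).Adj x y → C x = C y := by
      intro x y hxy
      simp only [hCdef, decide_eq_decide]
      exact ⟨fun h => h.trans hxy.reachable, fun h => h.trans hxy.symm.reachable⟩
    have hC : ∀ e ∉ M, C (s e) = C (t e) := by
      intro e heM
      refine hadj _ _ (adj_compl2Factor (adj_endpoints hst e) ?_)
      rwa [show (⟨s(s e, t e), adj_endpoints hst e⟩ : G.edgeSet) = e from Subtype.ext (hst e)]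
    have hsum := sum_filter_matching hst hm hC ψ
    simp only [hCdef, decide_eq_true_eq] at hsum
    rw [hsum, ← hφ u]
    refine Finset.sum_congr rfl fun e heC => if_neg ?_
    rintro ⟨w, hsw, htw⟩
    have heM : e ∈ M := by
      by_contra h
      exact mem_cut.mp heC (hC e h)
    have hnot : ∀ x (hx : x ∈ e.1) (h : G.Adj x w), w ∉ e.1 →
        (compl2Factor G (spanningSubgraph M)).Adj x w := by
      intro x hx h hw
      refine adj_compl2Factor h fun h' => hw ?_
      rw [(hm x e).mp ⟨heM, hx⟩, ← (hm x _).mp ⟨h', by simp⟩]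
      simp
    have hw : w ∉ e.1 := by
      rw [← hst, Sym2.mem_iff]
      rintro (h | h)
      · exact hsw.ne h.symm
      · exact htw.ne h.symm
    exact mem_cut.mp heC
      ((hadj _ _ (hnot _ (by rw [← hst]; simp) hsw hw)).trans
        (hadj _ _ (hnot _ (by rw [← hst]; simp) htw hw)).symm)
  · rintro ⟨u, v, huv, hnM, hu, hv⟩
    have hψtri : ∀ g, tri g → ψ g = (1, 1) := fun g hg => if_pos hg
    have hnu : ¬ tri (m u) := fun h => by
      dsimp only at hu
      rw [hψtri _ h] at hu
      exact absurd hu (by decide)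
    have hnv : ¬ tri (m v) := fun h => by
      dsimp only at hv
      rw [hψtri _ h] at hv
      exact absurd hv (by decide)
    obtain ⟨a, b, c, hua, hub, hab, hN⟩ := exists_triangle hclaw u (hcubic u)
    have hmu := (hm u _).mpr rfl
    obtain ⟨w, hw⟩ := hmu.2
    have huw : G.Adj u w := by
      rw [← SimpleGraph.mem_edgeSet, ← hw]
      exact (m u).2
    have hwa : w ≠ a := by
      rintro rfl
      exact hnu (htri hw hub hab)
    have hwb : w ≠ b := by
      rintro rfl
      exact hnu (htri hw hua hab.symm)
    have hwc : w = c := by simpa [hwa, hwb] using hN w huw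
    obtain ⟨g, hgM, hg⟩ := exists_mem_of_triangle hst hcubic hM hua hub hab
    have hgtri : tri g := by
      rcases hg with hg | hg | hg
      · exact htri hg hub hab
      · exact htri hg hua hab.symm
      · exact htri hg hua.symm hub.symm
    have hug : u ∉ g.1 := fun h => hnu ((hm u g).mp ⟨hgM, h⟩ ▸ hgtri)
    have hvg : v ∉ g.1 := fun h => hnv ((hm v g).mp ⟨hgM, h⟩ ▸ hgtri)
    have hgab : g.1 = s(a, b) := by
      rcases hg with hg | hg | hg
      · exact absurd (by simp [hg]) hug
      · exact absurd (by simp [hg]) hug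
      · exact hg
    rcases hN v huv with rfl | rfl | rfl
    · exact hvg (by simp [hgab])
    · exact hvg (by simp [hgab])
    · exact hnM ⟨m u, hmu.1, by rw [hw, hwc]⟩

end CubicFlow

/-- For every claw-free bridgeless cubic graph `G` and every edge `e` of `G`, there is a
perfect matching `M` of `G` containing `e` such that there exists a non-conflicting
nowhere-zero `Z2 × Z2` flow with respect to `M`. -/
theorem stmt_8 {V : Type} [Fintype V] [DecidableEq V] (G : SimpleGraph V)
    (hclaw : ClawFree G) (hbl : G.Bridgeless) (hcubic : G.IsRegularOfDegree 3)
    (e : Sym2 V) (he : e ∈ G.edgeSet) :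
    ∃ M : G.Subgraph, M.IsPerfectMatching ∧ e ∈ M.edgeSet ∧
      ∃ θ : V → K4, IsNZFlowWrt G M θ ∧ NonConflicting G M θ := by
  exact CubicFlow.exists_nonConflicting G hclaw hbl hcubic e he
end

section
/- Every claw-free bridgeless cubic graph admits a normal 6-edge-coloring, i.e. a proper edge-coloring with at most 6 colors in which every edge is poor or rich. -/
open scoped Classical

/-- The edges of `N` with exactly one end in `X`, where the ends of `e` are `s e` and `t e`. -/
noncomputable def cut {I E : Type} (s t : E → I) (N : Finset E) (X : Set I) : Finset E :=
  N.filter (fun e => ¬ (s e ∈ X ↔ t e ∈ X))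

section Cuts

variable {I E : Type} {s t : E → I} {N : Finset E}

lemma mem_cut {X : Set I} {e : E} : e ∈ cut s t N X ↔ e ∈ N ∧ ¬ (s e ∈ X ↔ t e ∈ X) := by
  simp [cut]

lemma cut_compl (X : Set I) : cut s t N Xᶜ = cut s t N X := by
  ext e
  simp only [mem_cut, Set.mem_compl_iff]
  tauto

lemma cut_comp_preimage {J : Type} (p : I → J) (X : Set J) :
    cut (p ∘ s) (p ∘ t) N X = cut s t N (p ⁻¹' X) := rfl

lemma card_cut_add_card_cut (X Y : Set I) :
    (cut s t N X).card + (cut s t N Y).card = (cut s t N (X ∩ Y)).card +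
      (cut s t N (X ∪ Y)).card + 2 * (N.filter (fun e => (s e ∈ X \ Y ∧ t e ∈ Y \ X) ∨
        (t e ∈ X \ Y ∧ s e ∈ Y \ X))).card := by
  simp only [cut, Finset.card_filter, Finset.mul_sum, ← Finset.sum_add_distrib]
  refine Finset.sum_congr rfl fun e _ => ?_
  by_cases h1 : s e ∈ X <;> by_cases h2 : t e ∈ X <;> by_cases h3 : s e ∈ Y <;>
    by_cases h4 : t e ∈ Y <;> simp [h1, h2, h3, h4]

lemma cast_card_cut (X : Set I) : ((cut s t N X).card : ZMod 2) =
    ∑ e ∈ N, ((if s e ∈ X then 1 else 0) + (if t e ∈ X then 1 else 0)) := by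
  rw [cut, Finset.card_filter, Nat.cast_sum]
  refine Finset.sum_congr rfl fun e _ => ?_
  by_cases h1 : s e ∈ X <;> by_cases h2 : t e ∈ X <;> simp [h1, h2]
  decide

lemma cast_card_cut_inter_add_diff (X Y : Set I) :
    ((cut s t N (X ∩ Y)).card : ZMod 2) + (cut s t N (X \ Y)).card = (cut s t N X).card := by
  simp only [cast_card_cut, ← Finset.sum_add_distrib]
  refine Finset.sum_congr rfl fun e _ => ?_
  by_cases h1 : s e ∈ X <;> by_cases h2 : t e ∈ X <;> by_cases h3 : s e ∈ Y <;>
    by_cases h4 : t e ∈ Y <;> simp [h1, h2, h3, h4]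

lemma odd_card_cut_iff [Fintype I] (hdeg : ∀ i, Odd (cut s t N {i}).card) (X : Set I) :
    Odd (cut s t N X).card ↔ Odd X.ncard := by
  rw [← ZMod.natCast_eq_one_iff_odd, ← ZMod.natCast_eq_one_iff_odd]
  suffices h : ((cut s t N X).card : ZMod 2) = X.ncard by rw [h]
  have h1 : ∀ i, ((cut s t N {i}).card : ZMod 2) = 1 :=
    fun i => ZMod.natCast_eq_one_iff_odd.2 (hdeg i)
  have h2 : (X.ncard : ZMod 2) = ∑ i ∈ X.toFinset, ((cut s t N {i}).card : ZMod 2) := by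
    simp [h1, Set.ncard_eq_toFinset_card']
  rw [h2]
  simp only [cast_card_cut]
  rw [Finset.sum_comm]
  refine Finset.sum_congr rfl fun e _ => ?_
  simp [Finset.sum_add_distrib, Finset.sum_ite_eq]

end Cuts

section PerfectMatching

variable {I E : Type} [Fintype E] {s t : E → I}

lemma three_mul_card_parts_le {C : Type} (h3 : ∀ i, (cut s t Finset.univ {i}).card = 3)
    (p : I → Option C) (O : Finset C)
    (hO : ∀ c ∈ O, 3 ≤ (cut s t Finset.univ {i | p i = some c}).card) (D : Finset E)
    (hD : ∀ e ∉ D, p (s e) = none ∨ p (t e) = none ∨ p (s e) = p (t e)) (u : Finset I)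
    (hu : ∀ i, p i = none → i ∈ u) :
    3 * O.card ≤ 2 * D.card + 3 * u.card := by
  have key : ∀ e : E, (O.filter (fun c => ¬ (p (s e) = some c ↔ p (t e) = some c))).card ≤
      2 * (if e ∈ D then 1 else 0) +
        (u.filter (fun i => ¬ (s e ∈ ({i} : Set I) ↔ t e ∈ ({i} : Set I)))).card := by
    intro e
    by_cases he : e ∈ D
    · have : O.filter (fun c => ¬ (p (s e) = some c ↔ p (t e) = some c)) ⊆
          (p (s e)).toFinset ∪ (p (t e)).toFinset := by
        intro c
        simp only [Finset.mem_filter, Finset.mem_union, Option.mem_toFinset, Option.mem_def]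
        tauto
      have h1 := (Finset.card_le_card this).trans (Finset.card_union_le _ _)
      have h2 : ∀ o : Option C, o.toFinset.card ≤ 1 := by rintro (_ | c) <;> simp
      have h4 := h2 (p (s e))
      have h5 := h2 (p (t e))
      simp only [he, if_true]
      lia
    · by_cases heq : p (s e) = p (t e)
      · simp [heq]
      · have hone : ∀ a b : I, p a = none → p a ≠ p b →
            1 ≤ (u.filter (fun i => ¬ (a ∈ ({i} : Set I) ↔ b ∈ ({i} : Set I)))).card := by
          intro a b ha hab
          refine Finset.card_pos.2 ⟨a, ?_⟩
          simp only [Finset.mem_filter, Set.mem_singleton_iff]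
          refine ⟨hu a ha, ?_⟩
          rintro h
          exact hab (by rw [h.1 trivial])
        have hle : ∀ o : Option C, (O.filter (fun c => ¬ (none = some c ↔ o = some c))).card ≤
            1 := by
          intro o
          refine Finset.card_le_one.2 fun a ha b hb => ?_
          simp only [Finset.mem_filter, reduceCtorEq, false_iff, not_not] at ha hb
          exact Option.some_injective _ (ha.2.symm.trans hb.2)
        rcases hD e he with h | h | h
        · have h1 := hone _ _ h heq
          have h2 := hle (p (t e))
          rw [h]
          lia
        · have h1 := hone _ _ h (Ne.symm heq)
          have h2 := hle (p (s e))
          simp only [h, iff_comm (a := s e ∈ _), iff_comm (a := p (s e) = _)]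
          lia
        · exact absurd h heq
  have h1 : 3 * O.card ≤ ∑ c ∈ O, (cut s t Finset.univ {i | p i = some c}).card := by
    rw [mul_comm, ← smul_eq_mul]
    exact Finset.card_nsmul_le_sum _ _ _ hO
  have h2 : ∑ i ∈ u, (cut s t Finset.univ {i}).card = 3 * u.card := by
    simp [h3, mul_comm]
  have h4 := Finset.sum_le_sum fun e (_ : e ∈ (Finset.univ : Finset E)) => key e
  simp only [Finset.sum_add_distrib, ← Finset.mul_sum, Finset.card_filter] at h4
  rw [Finset.sum_comm, Finset.sum_comm (t := u)] at h4
  simp only [cut, Finset.card_filter, Set.mem_ofPred_eq] at h1 h2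
  have h5 : 3 * O.card ≤ 2 * (∑ e, if e ∈ D then 1 else 0) + 3 * u.card := by
    refine h1.trans ?_
    rw [← h2]
    convert h4
  simpa using h5

/-- In a bridgeless cubic multigraph every edge lies in a perfect matching. -/
lemma exists_perfect_matching_of_mem [Fintype I] (h3 : ∀ i, (cut s t Finset.univ {i}).card = 3)
    (h1 : ∀ X, (cut s t Finset.univ X).card ≠ 1) (e₀ : E) (he₀ : s e₀ ≠ t e₀) :
    ∃ N : Finset E, e₀ ∈ N ∧ ∀ i, (cut s t N {i}).card = 1 := by
  set D := (cut s t Finset.univ {s e₀}).erase e₀ with hDdef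
  have he₀' : e₀ ∈ cut s t Finset.univ {s e₀} := by simp [mem_cut, Ne.symm he₀]
  have hD2 : D.card = 2 := by rw [hDdef, Finset.card_erase_of_mem he₀', h3]
  have hodd : ∀ i, Odd (cut s t Finset.univ {i}).card := fun i => by rw [h3]; decide
  have hI : ¬ Odd (Fintype.card I) := by
    have := odd_card_cut_iff hodd Set.univ
    simp only [Set.ncard_univ, Nat.card_eq_fintype_card] at this
    rw [← this]
    simp [cut]
  let Γ : SimpleGraph I := SimpleGraph.fromRel fun i j => ∃ e ∉ D, s e = i ∧ t e = j
  have hΓ : ∀ i j, Γ.Adj i j → ∃ e ∉ D, s(s e, t e) = s(i, j) := by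
    intro i j h
    rcases (SimpleGraph.fromRel_adj _ _ _).1 h with ⟨_, ⟨e, he, rfl, rfl⟩ | ⟨e, he, rfl, rfl⟩⟩
    · exact ⟨e, he, rfl⟩
    · exact ⟨e, he, Sym2.eq_swap⟩
  obtain ⟨M, hM⟩ : ∃ M : Γ.Subgraph, M.IsPerfectMatching := by
    rw [SimpleGraph.tutte]
    intro u hviol
    rw [SimpleGraph.IsTutteViolator] at hviol
    set H := ((⊤ : Γ.Subgraph).deleteVerts u) with hH
    have hverts : ∀ i, i ∈ H.verts ↔ i ∉ u := by simp [hH]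
    have hparity := SimpleGraph.odd_ncard_oddComponents (G := H.coe)
    let p : I → Option H.coe.ConnectedComponent := fun i =>
      if h : i ∈ H.verts then some (H.coe.connectedComponentMk ⟨i, h⟩) else none
    have hp : ∀ c, {i | p i = some c} = Subtype.val '' c.supp := by
      intro c
      ext i
      by_cases h : i ∈ H.verts <;> simp [p, h]
    have := three_mul_card_parts_le h3 p H.coe.oddComponents.toFinset (fun c hc => by
        have hc' : Odd (cut s t Finset.univ {i | p i = some c}).card := by
          rw [odd_card_cut_iff hodd, hp, Set.ncard_image_of_injective _ Subtype.val_injective]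
          simpa using hc
        have := h1 {i | p i = some c}
        obtain ⟨k, hk⟩ := hc'
        lia) D (fun e he => by
          by_cases hs : s e ∈ H.verts
          · by_cases ht : t e ∈ H.verts
            · refine Or.inr (Or.inr ?_)
              simp only [p, hs, ht, dif_pos, Option.some_inj]
              by_cases hst : s e = t e
              · simp [hst]
              refine SimpleGraph.ConnectedComponent.eq.2 (SimpleGraph.Adj.reachable ?_)
              change H.Adj (s e) (t e)
              rw [hH, SimpleGraph.Subgraph.deleteVerts_adj]
              refine ⟨trivial, (hverts _).1 hs, trivial, (hverts _).1 ht, ?_⟩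
              have hadj : Γ.Adj (s e) (t e) :=
                (SimpleGraph.fromRel_adj _ _ _).2 ⟨hst, Or.inl ⟨e, he, rfl, rfl⟩⟩
              exact hadj
            · exact Or.inr (Or.inl (dif_neg ht))
          · exact Or.inl (dif_neg hs)) u.toFinset (fun i hi => by
            by_contra h
            have : i ∈ H.verts := (hverts i).2 (by simpa using h)
            simp [p, this] at hi)
    have hcard : Nat.card H.verts + u.ncard = Fintype.card I := by
      have : H.verts = uᶜ := Set.ext hverts
      rw [this, Nat.card_coe_set_eq, add_comm, Set.ncard_add_ncard_compl, Nat.card_eq_fintype_card]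
    rw [hD2, ← Set.ncard_eq_toFinset_card', ← Set.ncard_eq_toFinset_card'] at this
    rw [Nat.odd_iff, Nat.odd_iff] at hparity
    rw [Nat.odd_iff] at hI
    lia
  have hsub : ∀ q : M.edgeSet, ∃ e ∉ D, s(s e, t e) = q.1 := by
    rintro ⟨q, hq⟩
    induction q using Sym2.ind with
    | _ i j => exact hΓ i j (M.adj_sub hq)
  choose r hrD hr using hsub
  have hN : ∀ i, (cut s t (Finset.univ.image r) {i}).card = 1 := by
    intro i
    obtain ⟨j, hj, hj'⟩ := SimpleGraph.Subgraph.isPerfectMatching_iff.1 hM i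
    rw [Finset.card_eq_one]
    refine ⟨r ⟨s(i, j), hj⟩, ?_⟩
    have hij : i ≠ j := M.adj_sub hj |>.ne
    ext e
    simp only [mem_cut, Finset.mem_image, Finset.mem_univ, true_and, Set.mem_singleton_iff,
      Finset.mem_singleton]
    constructor
    · rintro ⟨⟨⟨q, hq⟩, rfl⟩, h⟩
      refine congrArg r (Subtype.ext ?_)
      have hq' := hr ⟨q, hq⟩
      simp only at hq'
      have hiq : i ∈ q := by
        rw [← hq', Sym2.mem_iff]
        tauto
      obtain ⟨k, rfl⟩ := Sym2.mem_iff_exists.1 hiq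
      exact congrArg (fun x => s(i, x)) (hj' k hq)
    · rintro rfl
      refine ⟨⟨_, rfl⟩, ?_⟩
      have := hr ⟨s(i, j), hj⟩
      simp only [Sym2.eq_iff] at this
      rcases this with ⟨h, h'⟩ | ⟨h, h'⟩ <;> simp [h, h', hij.symm]
  refine ⟨_, ?_, hN⟩
  obtain ⟨e, he⟩ := Finset.card_eq_one.1 (hN (s e₀))
  have he1 : e ∈ cut s t (Finset.univ.image r) {s e₀} := by simp [he]
  rw [mem_cut] at he1
  obtain ⟨q, -, rfl⟩ := Finset.mem_image.1 he1.1
  have := hrD q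
  simp only [hDdef, Finset.mem_erase, mem_cut, Finset.mem_univ, true_and] at this
  have h := he1.2
  have : r q = e₀ := by tauto
  exact this ▸ he1.1

end PerfectMatching

section ThreeCuts

variable {E : Type} [Fintype E]

lemma card_cut_eq_one_of_uncrossing {I : Type} {s t : E → I} {N : Finset E}
    (h1 : ∀ X, (cut s t Finset.univ X).card ≠ 1) {X : Set I}
    (hX : (cut s t Finset.univ X).card = 3)
    (hsup : ∀ Y, X ⊆ Y → (cut s t Finset.univ Y).card = 3 → (cut s t N Y).card = 1)
    (hsub : ∀ Y, Y ⊆ X → (cut s t Finset.univ Y).card = 3 → (cut s t N Y).card = 1)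
    (Y : Set I) (hY : (cut s t Finset.univ Y).card = 3) : (cut s t N Y).card = 1 := by
  wlog hodd : Odd (cut s t Finset.univ (X ∩ Y)).card generalizing Y with H
  · rw [← cut_compl]
    refine H Yᶜ (by rwa [cut_compl]) ?_
    have h := cast_card_cut_inter_add_diff (s := s) (t := t) (N := Finset.univ) X Y
    rw [← Nat.cast_add, hX, ZMod.natCast_eq_natCast_iff'] at h
    rw [Nat.odd_iff] at hodd ⊢
    rw [← Set.sdiff_eq]
    lia
  have h := card_cut_add_card_cut (s := s) (t := t) (N := Finset.univ) X Y
  have hpar : Odd (cut s t Finset.univ (X ∪ Y)).card := by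
    rw [Nat.odd_iff] at hodd ⊢
    lia
  have hi := h1 (X ∩ Y)
  have hu := h1 (X ∪ Y)
  rw [Nat.odd_iff] at hodd hpar
  have hi3 : (cut s t Finset.univ (X ∩ Y)).card = 3 := by lia
  have hu3 : (cut s t Finset.univ (X ∪ Y)).card = 3 := by lia
  have hcross : (Finset.univ.filter (fun e => (s e ∈ X \ Y ∧ t e ∈ Y \ X) ∨
      (t e ∈ X \ Y ∧ s e ∈ Y \ X))).card = 0 := by lia
  have hcrossN : (N.filter (fun e => (s e ∈ X \ Y ∧ t e ∈ Y \ X) ∨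
      (t e ∈ X \ Y ∧ s e ∈ Y \ X))).card = 0 :=
    Nat.le_zero.1 (hcross ▸ Finset.card_le_card (Finset.filter_subset_filter _ N.subset_univ))
  have hN := card_cut_add_card_cut (s := s) (t := t) (N := N) X Y
  rw [hcrossN, hsub _ Set.inter_subset_left hi3, hsup _ Set.subset_union_left hu3,
    hsup X subset_rfl hX] at hN
  lia

/-- A bridgeless cubic multigraph has, for each edge, a perfect matching which contains that edge
and meets every 3-edge-cut exactly once. -/
theorem exists_matching_meeting_three_cuts {I : Type} [Fintype I] {s t : E → I}
    (h3 : ∀ i, (cut s t Finset.univ {i}).card = 3)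
    (h1 : ∀ X, (cut s t Finset.univ X).card ≠ 1) (e₀ : E) (he₀ : s e₀ ≠ t e₀) :
    ∃ N : Finset E, e₀ ∈ N ∧ ∀ X, (cut s t Finset.univ X).card = 3 → (cut s t N X).card = 1 := by
  induction hn : Fintype.card I using Nat.strong_induction_on generalizing I e₀ with
  | _ n ih =>
  have hcontract : ∀ (Z : Set I), 2 ≤ Z.ncard → (cut s t Finset.univ Z).card = 3 →
      ∀ e, s e ≠ t e → ¬ (s e ∈ Z ∧ t e ∈ Z) →
      ∃ N : Finset E, e ∈ N ∧ ∀ Y, Z ⊆ Y → (cut s t Finset.univ Y).card = 3 →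
        (cut s t N Y).card = 1 := by
    intro Z hZ2 hZ3 e hne he
    let p : I → Option ↥Zᶜ := fun i => if h : i ∈ Z then none else some ⟨i, h⟩
    have hpnone : ∀ i, p i = none ↔ i ∈ Z := by
      intro i
      by_cases h : i ∈ Z <;> simp [p, h]
    have hpsome : ∀ i j, p i = some j ↔ i = j := by
      rintro i ⟨j, hj⟩
      by_cases h : i ∈ Z
      · have : i ≠ j := fun hij => hj (hij ▸ h)
        simp [p, h, this]
      · simp [p, h]
    have hinj : ∀ i j, p i = p j → i = j ∨ (i ∈ Z ∧ j ∈ Z) := by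
      intro i j hij
      rcases hj : p j with _ | k
      · rw [hj] at hij
        exact Or.inr ⟨(hpnone i).1 hij, (hpnone j).1 hj⟩
      · rw [hj] at hij
        exact Or.inl (((hpsome _ _).1 hij).trans ((hpsome _ _).1 hj).symm)
    have hcard : Fintype.card (Option ↥Zᶜ) < n := by
      rw [Fintype.card_option, ← Nat.card_eq_fintype_card (α := ↥Zᶜ), Nat.card_coe_set_eq, ← hn]
      have := Set.ncard_add_ncard_compl Z
      rw [Nat.card_eq_fintype_card] at this
      lia
    obtain ⟨N, heN, hN⟩ := ih _ hcard (s := p ∘ s) (t := p ∘ t) (by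
        rintro (_ | j)
        · rw [cut_comp_preimage]
          convert hZ3 using 3
          ext i
          simp [hpnone]
        · rw [cut_comp_preimage]
          convert h3 j using 3
          ext i
          simp [hpsome]) (fun X => by rw [cut_comp_preimage]; exact h1 _) e (fun h => (hinj _ _ h).elim hne he) rfl
    refine ⟨N, heN, fun Y hY hY3 => ?_⟩
    have hpre : p ⁻¹' (p '' Y) = Y := by
      refine Set.Subset.antisymm ?_ (Set.subset_preimage_image _ _)
      rintro i ⟨j, hj, hji⟩
      rcases hinj _ _ hji with rfl | h
      · exact hj
      · exact hY h.2
    have := hN (p '' Y)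
    rw [cut_comp_preimage, cut_comp_preimage, hpre] at this
    exact this hY3
  by_cases hcut : ∃ X : Set I, (cut s t Finset.univ X).card = 3 ∧ 2 ≤ X.ncard ∧ 2 ≤ Xᶜ.ncard
  · obtain ⟨X, hX3, hX, hXc, he₀X⟩ : ∃ X : Set I, (cut s t Finset.univ X).card = 3 ∧
        2 ≤ X.ncard ∧ 2 ≤ Xᶜ.ncard ∧ ¬ (s e₀ ∈ X ∧ t e₀ ∈ X) := by
      obtain ⟨X, hX3, hX, hXc⟩ := hcut
      by_cases he : s e₀ ∈ X ∧ t e₀ ∈ X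
      · refine ⟨Xᶜ, by rwa [cut_compl], hXc, by rwa [compl_compl], fun h => h.1 he.1⟩
      · exact ⟨X, hX3, hX, hXc, he⟩
    obtain ⟨N₁, he₀N, hN₁⟩ := hcontract X hX hX3 e₀ he₀ he₀X
    obtain ⟨f, hf⟩ := Finset.card_eq_one.1 (hN₁ X subset_rfl hX3)
    have hf' : f ∈ cut s t N₁ X := by simp [hf]
    rw [mem_cut] at hf'
    obtain ⟨N₂, hfN, hN₂⟩ := hcontract Xᶜ hXc (by rwa [cut_compl]) f
      (fun h => hf'.2 (by rw [h])) (by simp only [Set.mem_compl_iff]; tauto)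
    have hfX : ∀ e ∈ N₂, ¬ (s e ∈ X ↔ t e ∈ X) → e = f := by
      intro e he heX
      have h2 := hN₂ Xᶜ subset_rfl (by rwa [cut_compl])
      rw [cut_compl] at h2
      exact Finset.card_le_one.1 h2.le e (mem_cut.2 ⟨he, heX⟩) f (mem_cut.2 ⟨hfN, hf'.2⟩)
    have hfX' : ∀ e ∈ N₁, ¬ (s e ∈ X ↔ t e ∈ X) → e = f := by
      intro e he heX
      have : e ∈ cut s t N₁ X := mem_cut.2 ⟨he, heX⟩
      simpa [hf] using this
    refine ⟨N₁.filter (fun e => ¬ (s e ∈ X ∧ t e ∈ X)) ∪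
      N₂.filter (fun e => ¬ (s e ∉ X ∧ t e ∉ X)), ?_, ?_⟩
    · simp only [Finset.mem_union, Finset.mem_filter]
      exact Or.inl ⟨he₀N, he₀X⟩
    refine card_cut_eq_one_of_uncrossing h1 hX3 (fun Y hY hY3 => ?_) (fun Y hY hY3 => ?_)
    · rw [← hN₁ Y hY hY3]
      congr 1
      ext e
      simp only [mem_cut, Finset.mem_union, Finset.mem_filter]
      have hs := @hY (s e)
      have ht := @hY (t e)
      have h := hfX e
      have h' : e = f → e ∈ N₁ := fun h => h ▸ hf'.1
      grind only
    · have hYc : Xᶜ ⊆ Yᶜ := Set.compl_subset_compl.2 hY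
      rw [← hN₂ Yᶜ hYc (by rwa [cut_compl]), cut_compl]
      congr 1
      ext e
      simp only [mem_cut, Finset.mem_union, Finset.mem_filter]
      have hs := @hY (s e)
      have ht := @hY (t e)
      have h := hfX' e
      have h' : e = f → e ∈ N₂ := fun h => h ▸ hfN
      grind only
  · obtain ⟨N, he₀N, hN⟩ := exists_perfect_matching_of_mem h3 h1 e₀ he₀
    refine ⟨N, he₀N, fun X hX => ?_⟩
    push Not at hcut
    have hodd : ∀ i, Odd (cut s t Finset.univ {i}).card := fun i => by rw [h3]; decide
    have hX0 : Odd X.ncard := by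
      rw [← odd_card_cut_iff hodd, hX]
      decide
    have hXc0 : Odd Xᶜ.ncard := by
      rw [← odd_card_cut_iff hodd, cut_compl, hX]
      decide
    have := hcut X hX
    rw [Nat.odd_iff] at hX0 hXc0
    rcases (by lia : X.ncard = 1 ∨ Xᶜ.ncard = 1) with h | h
    · obtain ⟨i, rfl⟩ := Set.ncard_eq_one.1 h
      exact hN i
    · obtain ⟨i, hi⟩ := Set.ncard_eq_one.1 h
      rw [← cut_compl, hi]
      exact hN i

end ThreeCuts

section DisjointSpanning

/-- Rado's theorem for monotone submodular functions. -/
lemma exists_transversal_of_submodular {ι α : Type} [Fintype ι]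
    [DecidableEq ι] [DecidableEq α] (f : Finset α → ℤ)
    (h0 : f ∅ = 0) (hmono : Monotone f)
    (hsub : ∀ A B, f (A ∪ B) + f (A ∩ B) ≤ f A + f B) (L : ι → Finset α)
    (hL : ∀ J : Finset ι, (J.card : ℤ) ≤ f (J.biUnion L)) :
    ∃ x : ι → α, (∀ i, x i ∈ L i) ∧ ∀ J : Finset ι, (J.card : ℤ) ≤ f (J.image x) := by
  induction hn : ∑ i, (L i).card using Nat.strong_induction_on generalizing L with
  | _ n ih =>
  by_cases hall : ∀ i, (L i).card ≤ 1
  · have hne : ∀ i, ∃ a, L i = {a} := by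
      intro i
      rw [← Finset.card_eq_one]
      refine le_antisymm (hall i) (Finset.card_pos.2 ?_)
      rw [Finset.nonempty_iff_ne_empty]
      intro h
      have := hL {i}
      simp [h, h0] at this
    choose x hx using hne
    refine ⟨x, fun i => by simp [hx], fun J => ?_⟩
    convert hL J
    ext a
    simp [hx, eq_comm]
  push Not at hall
  obtain ⟨i, hi⟩ := hall
  obtain ⟨a, ha, b, hb, hab⟩ := Finset.one_lt_card.1 hi
  have hstep : ∀ c ∈ L i, (∀ J : Finset ι, (J.card : ℤ) ≤
      f (J.biUnion (Function.update L i ((L i).erase c)))) →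
      ∃ x : ι → α, (∀ i, x i ∈ L i) ∧ ∀ J : Finset ι, (J.card : ℤ) ≤ f (J.image x) := by
    intro c hc h
    have hle : ∀ j, Function.update L i ((L i).erase c) j ⊆ L j := by
      intro j
      by_cases hj : j = i
      · subst hj
        simp [Finset.erase_subset]
      · simp [hj]
    obtain ⟨x, hx, hx'⟩ := ih _ (by
      rw [← hn]
      refine Finset.sum_lt_sum (fun j _ => Finset.card_le_card (hle j)) ⟨i, Finset.mem_univ _, ?_⟩
      simp only [Function.update_self]
      exact Finset.card_erase_lt_of_mem hc) _ h rfl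
    exact ⟨x, fun j => hle j (hx j), hx'⟩
  by_cases hA : ∀ J : Finset ι, (J.card : ℤ) ≤
      f (J.biUnion (Function.update L i ((L i).erase a)))
  · exact hstep a ha hA
  by_cases hB : ∀ J : Finset ι, (J.card : ℤ) ≤
      f (J.biUnion (Function.update L i ((L i).erase b)))
  · exact hstep b hb hB
  exfalso
  have hviol : ∀ c, (¬ ∀ J : Finset ι, (J.card : ℤ) ≤
      f (J.biUnion (Function.update L i ((L i).erase c)))) →
      ∃ J : Finset ι, i ∉ J ∧ f (J.biUnion L ∪ (L i).erase c) ≤ J.card := by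
    intro c h
    push Not at h
    obtain ⟨J, hJ⟩ := h
    have hcongr : (J.erase i).biUnion (Function.update L i ((L i).erase c)) =
        (J.erase i).biUnion L :=
      Finset.biUnion_congr rfl fun j hj => by simp [Finset.ne_of_mem_erase hj]
    by_cases hiJ : i ∈ J
    · refine ⟨J.erase i, by simp, ?_⟩
      rw [← Finset.insert_erase hiJ, Finset.biUnion_insert, Finset.card_insert_of_notMem (by simp),
        Function.update_self, hcongr, Finset.union_comm] at hJ
      push_cast at hJ
      lia
    · rw [← Finset.erase_eq_of_notMem hiJ, hcongr, Finset.erase_eq_of_notMem hiJ] at hJ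
      exact absurd (hL J) (not_le.2 hJ)
  obtain ⟨J, hiJ, hJ⟩ := hviol a hA
  obtain ⟨K, hiK, hK⟩ := hviol b hB
  have h1 := hsub (J.biUnion L ∪ (L i).erase a) (K.biUnion L ∪ (L i).erase b)
  have h2 : ((insert i (J ∪ K)).card : ℤ) ≤
      f ((J.biUnion L ∪ (L i).erase a) ∪ (K.biUnion L ∪ (L i).erase b)) := by
    refine (hL _).trans (hmono ?_)
    intro c
    simp only [Finset.mem_biUnion, Finset.mem_insert, Finset.mem_union, Finset.mem_erase]
    rintro ⟨j, rfl | hj | hj, hc⟩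
    · by_cases hca : c = a
      · subst hca
        tauto
      · tauto
    · exact Or.inl (Or.inl ⟨j, hj, hc⟩)
    · exact Or.inr (Or.inl ⟨j, hj, hc⟩)
  have h3 : ((J ∩ K).card : ℤ) ≤
      f ((J.biUnion L ∪ (L i).erase a) ∩ (K.biUnion L ∪ (L i).erase b)) := by
    refine (hL _).trans (hmono ?_)
    intro c
    simp only [Finset.mem_biUnion, Finset.mem_inter, Finset.mem_union]
    rintro ⟨j, ⟨hj, hj'⟩, hc⟩
    exact ⟨Or.inl ⟨j, hj, hc⟩, Or.inl ⟨j, hj', hc⟩⟩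
  rw [Finset.card_insert_of_notMem (by simp [hiJ, hiK])] at h2
  have h4 := Finset.card_union_add_card_inter J K
  push_cast at h2
  lia

/-- A matroid-like rank function admits two disjoint sets of full rank as soon as the obvious
counting condition holds. -/
lemma exists_disjoint_full_rank {E : Type} [Fintype E] (r : Finset E → ℤ) (hr : Monotone r)
    (hrsub : ∀ A B, r (A ∪ B) + r (A ∩ B) ≤ r A + r B)
    (hrcard : ∀ A B, r (A ∪ B) ≤ r A + B.card)
    (h : ∀ A : Finset E, 2 * r Finset.univ ≤ 2 * r A + (Aᶜ).card) :
    ∃ B : Finset E, r B = r Finset.univ ∧ r Bᶜ = r Finset.univ := by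
  obtain ⟨g, hgdef⟩ : ∃ g : Finset E → ℤ, ∀ X, g X = X.card + r Xᶜ - r Finset.univ :=
    ⟨_, fun _ => rfl⟩
  have hg : Monotone g := by
    intro X Y hXY
    have h1 := hrcard Yᶜ (Y \ X)
    have h2 : Yᶜ ∪ (Y \ X) = Xᶜ := by
      ext e
      have := @hXY e
      simp only [Finset.mem_union, Finset.mem_compl, Finset.mem_sdiff]
      tauto
    have h3 := Finset.card_sdiff_add_card_eq_card hXY
    rw [h2] at h1
    rw [hgdef, hgdef]
    lia
  have hgsub : ∀ A B, g (A ∪ B) + g (A ∩ B) ≤ g A + g B := by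
    intro A B
    have h1 := hrsub Aᶜ Bᶜ
    rw [← Finset.compl_inter, ← Finset.compl_union] at h1
    have h2 := Finset.card_union_add_card_inter A B
    rw [hgdef, hgdef, hgdef, hgdef]
    lia
  obtain ⟨sl, hsl⟩ : ∃ sl : Finset (E × Bool) → Bool → Finset E,
      ∀ X b e, e ∈ sl X b ↔ (e, b) ∈ X :=
    ⟨fun X b => Finset.univ.filter (fun e => (e, b) ∈ X), by simp⟩
  have hslmono : ∀ X Y, X ⊆ Y → ∀ b, sl X b ⊆ sl Y b := by
    intro X Y hXY b e
    rw [hsl, hsl]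
    exact fun h => hXY h
  have hslunion : ∀ X Y b, sl (X ∪ Y) b = sl X b ∪ sl Y b := by
    intro X Y b
    ext e
    simp [hsl]
  have hslinter : ∀ X Y b, sl (X ∩ Y) b = sl X b ∩ sl Y b := by
    intro X Y b
    ext e
    simp [hsl]
  have hslempty : ∀ b, sl ∅ b = ∅ := by
    intro b
    ext e
    simp [hsl]
  obtain ⟨y, hy, hy'⟩ := exists_transversal_of_submodular
    (fun X => g (sl X true) + g (sl X false)) (by simp [hslempty, hgdef])
    (fun X Y hXY => add_le_add (hg (hslmono X Y hXY _)) (hg (hslmono X Y hXY _)))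
    (fun X Y => by
      have h1 := hgsub (sl X true) (sl Y true)
      have h2 := hgsub (sl X false) (sl Y false)
      simp only [hslunion, hslinter]
      lia)
    (fun e : E => {(e, true), (e, false)}) (fun J => by
      have h1 : ∀ b, sl (J.biUnion fun e : E => {(e, true), (e, false)}) b = J := by
        intro b
        ext e
        cases b <;> simp [hsl]
      have h2 := h Jᶜ
      rw [compl_compl] at h2
      simp only [h1, hgdef]
      lia)
  have hfst : ∀ e, (y e).1 = e := by
    intro e
    have := hy e
    simp only [Finset.mem_insert, Finset.mem_singleton] at this
    rcases this with h | h <;> simp [h]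
  have hslice : ∀ b, sl (Finset.univ.image y) b = Finset.univ.filter (fun e => (y e).2 = b) := by
    intro b
    ext e
    simp only [hsl, Finset.mem_filter, Finset.mem_univ, true_and, Finset.mem_image]
    constructor
    · rintro ⟨a, ha⟩
      have := hfst a
      rw [ha] at this
      simp only at this
      rw [this, ha]
    · intro h
      exact ⟨e, Prod.ext (hfst e) h⟩
  obtain ⟨B, hB⟩ : ∃ B : Finset E, B = Finset.univ.filter (fun e => (y e).2 = true) := ⟨_, rfl⟩
  have hBc : Finset.univ.filter (fun e => (y e).2 = false) = Bᶜ := by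
    ext e
    simp [hB]
  have hfin := hy' Finset.univ
  rw [hslice, hslice, hBc, ← hB, hgdef, hgdef, compl_compl, Finset.card_univ] at hfin
  have hBu := hr (Finset.subset_univ B)
  have hBcu := hr (Finset.subset_univ Bᶜ)
  have hBcard := Finset.card_add_card_compl B
  exact ⟨B, by lia, by lia⟩

open Module in
/-- A family of vectors has two disjoint subfamilies which span the same space modulo `U` as
soon as the obvious rank condition holds. -/
lemma exists_disjoint_spanning {K M E : Type} [Fintype E] [Field K] [AddCommGroup M] [Module K M]
    [FiniteDimensional K M] (x : E → M) (U : Submodule K M)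
    (h : ∀ A : Finset E, 2 * finrank K ↥(U ⊔ Submodule.span K (Set.range x)) ≤
      2 * finrank K ↥(U ⊔ Submodule.span K (x '' A)) + (Aᶜ).card) :
    ∃ B : Finset E, U ⊔ Submodule.span K (x '' B) = U ⊔ Submodule.span K (Set.range x) ∧
      U ⊔ Submodule.span K (x '' ↑(Bᶜ)) = U ⊔ Submodule.span K (Set.range x) := by
  obtain ⟨S, hSdef⟩ : ∃ S : Finset E → Submodule K M,
      ∀ A, S A = U ⊔ Submodule.span K (x '' A) := ⟨_, fun _ => rfl⟩
  have hS : Monotone S := fun A B hAB => by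
    rw [hSdef, hSdef]
    exact sup_le_sup_left (Submodule.span_mono (Set.image_mono (by exact_mod_cast hAB))) _
  have hSunion : ∀ A B, S (A ∪ B) = S A ⊔ Submodule.span K (x '' B) := by
    intro A B
    rw [hSdef, hSdef, Finset.coe_union, Set.image_union, Submodule.span_union, sup_assoc]
  have hSunion' : ∀ A B, S (A ∪ B) = S A ⊔ S B := by
    intro A B
    rw [hSunion, hSdef A, hSdef B, ← sup_assoc, sup_right_comm U _ U, sup_idem]
  have hSuniv : S Finset.univ = U ⊔ Submodule.span K (Set.range x) := by
    simp [hSdef]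
  obtain ⟨B, hB, hB'⟩ := exists_disjoint_full_rank (fun A => (finrank K (S A) : ℤ))
    (fun A B hAB => by
      exact Int.ofNat_le.2 (Submodule.finrank_mono (hS hAB)))
    (fun A B => by
      have h1 := Submodule.finrank_sup_add_finrank_inf_eq (S A) (S B)
      have h2 : finrank K (S (A ∩ B)) ≤ finrank K ↥(S A ⊓ S B) :=
        Submodule.finrank_mono
          (le_inf (hS Finset.inter_subset_left) (hS Finset.inter_subset_right))
      rw [hSunion']
      norm_cast
      lia)
    (fun A B => by
      have h2 := Submodule.finrank_add_le_finrank_add_finrank (S A) (Submodule.span K (x '' B))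
      have h3 : finrank K (Submodule.span K (x '' (B : Set E))) ≤ B.card := by
        rw [← Finset.coe_image]
        exact (finrank_span_finset_le_card _).trans Finset.card_image_le
      rw [hSunion]
      norm_cast
      lia)
    (fun A => by
      have h2 := h A
      rw [← hSuniv, ← hSdef] at h2
      exact_mod_cast h2)
  refine ⟨B, ?_⟩
  rw [← hSdef, ← hSdef, ← hSuniv]
  exact ⟨Submodule.eq_of_le_of_finrank_eq (hS (Finset.subset_univ B)) (by exact_mod_cast hB),
    Submodule.eq_of_le_of_finrank_eq (hS (Finset.subset_univ Bᶜ)) (by exact_mod_cast hB')⟩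

end DisjointSpanning

section CutSpace

/-- The column of the incidence matrix modulo two of the edge `e`. -/
noncomputable def edgeVec {I E : Type} (s t : E → I) (e : E) : I → ZMod 2 :=
  Pi.single (s e) 1 - Pi.single (t e) 1

/-- The sum of the coordinates in `X`. -/
noncomputable def coordSum {I : Type} [Fintype I] (X : Set I) : (I → ZMod 2) →ₗ[ZMod 2] ZMod 2 :=
  ∑ i ∈ Finset.univ.filter (· ∈ X), LinearMap.proj i

variable {I E : Type} {s t : E → I} [Fintype I]

lemma coordSum_single (X : Set I) (i : I) :
    coordSum X (Pi.single i 1) = if i ∈ X then 1 else 0 := by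
  simp [coordSum, Pi.single_apply]

lemma coordSum_edgeVec [Fintype E] (X : Set I) (e : E) :
    coordSum X (edgeVec s t e) = if e ∈ cut s t Finset.univ X then 1 else 0 := by
  rw [edgeVec, map_sub, coordSum_single, coordSum_single]
  by_cases h1 : s e ∈ X <;> by_cases h2 : t e ∈ X <;> simp [h1, h2, mem_cut]

open Module in
lemma two_mul_finrank_sup_span_le [Fintype E] (S : Submodule (ZMod 2) (I → ZMod 2)) (D : Finset E)
    (hD : ∀ e, edgeVec s t e ∉ S → e ∈ D)
    (h : ∀ X, (∀ e ∈ cut s t Finset.univ X, edgeVec s t e ∉ S) →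
      cut s t Finset.univ X = ∅ ∨ 4 ≤ (cut s t Finset.univ X).card) :
    2 * finrank (ZMod 2) ↥(S ⊔ Submodule.span (ZMod 2) (Set.range (edgeVec s t))) ≤
      2 * finrank (ZMod 2) S + D.card := by
  obtain ⟨p, hp⟩ : ∃ p : I → (I → ZMod 2) ⧸ S, ∀ u, p u = S.mkQ (Pi.single u 1) :=
    ⟨_, fun _ => rfl⟩
  have hpS : ∀ u v, p u = p v ↔ Pi.single u 1 - Pi.single v 1 ∈ S := by
    intro u v
    rw [hp, hp, Submodule.mkQ_apply, Submodule.mkQ_apply, Submodule.Quotient.eq]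
  obtain ⟨Bad, hBad⟩ : ∃ B : Finset ((I → ZMod 2) ⧸ S), ∀ q, q ∈ B ↔
      (cut s t Finset.univ (p ⁻¹' {q})).Nonempty := by
    refine ⟨(Finset.univ.image p).filter
      (fun q => (cut s t Finset.univ (p ⁻¹' {q})).Nonempty), fun q => ?_⟩
    simp only [Finset.mem_filter, Finset.mem_image, Finset.mem_univ, true_and,
      and_iff_right_iff_imp]
    rintro ⟨e, he⟩
    simp only [mem_cut, Finset.mem_univ, true_and, Set.mem_preimage, Set.mem_singleton_iff] at he
    by_cases h1 : p (s e) = q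
    · exact ⟨_, h1⟩
    · exact ⟨t e, by tauto⟩
  have hcutS : ∀ q, ∀ e ∈ cut s t Finset.univ (p ⁻¹' {q}), edgeVec s t e ∉ S := by
    intro q e he hS
    rw [edgeVec, ← hpS] at hS
    simp [mem_cut, hS] at he
  have hcount : Bad.card * 4 ≤ D.card * 2 := by
    refine Finset.card_mul_le_card_mul
      (fun q e => e ∈ cut s t Finset.univ (p ⁻¹' {q})) (fun q hq => ?_) (fun e _ => ?_)
    · have h1 := (h _ (hcutS q)).resolve_left ((hBad q).1 hq).ne_empty
      refine h1.trans (Finset.card_le_card fun e he => ?_)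
      rw [Finset.mem_bipartiteAbove]
      exact ⟨hD e (hcutS q e he), he⟩
    · refine (Finset.card_le_card (t := {p (s e), p (t e)}) fun q hq => ?_).trans
        Finset.card_le_two
      simp only [Finset.mem_bipartiteBelow, mem_cut, Finset.mem_univ, true_and, Set.mem_preimage,
        Set.mem_singleton_iff] at hq
      rw [Finset.mem_insert, Finset.mem_singleton]
      grind only
  have hrep : ∀ q, ∃ v : I → ZMod 2, ∀ u, p u = q → Pi.single u 1 - v ∈ S := by
    intro q
    by_cases hq : ∃ u, p u = q
    · obtain ⟨w, hw⟩ := hq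
      exact ⟨Pi.single w 1, fun u hu => (hpS u w).1 (hu.trans hw.symm)⟩
    · exact ⟨0, fun u hu => absurd ⟨u, hu⟩ hq⟩
  choose v hv using hrep
  have hle : S ⊔ Submodule.span (ZMod 2) (Set.range (edgeVec s t)) ≤
      S ⊔ Submodule.span (ZMod 2) ((Bad.image v : Finset (I → ZMod 2)) : Set (I → ZMod 2)) := by
    refine sup_le le_sup_left (Submodule.span_le.2 ?_)
    rintro _ ⟨e, rfl⟩
    by_cases he : edgeVec s t e ∈ S
    · exact Submodule.mem_sup_left he
    have hne : p (s e) ≠ p (t e) := fun h => he ((hpS _ _).1 h)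
    have hmem : ∀ u, p u ∈ Bad → Pi.single u 1 ∈ S ⊔
        Submodule.span (ZMod 2) ((Bad.image v : Finset (I → ZMod 2)) : Set (I → ZMod 2)) := by
      intro u hu
      rw [← sub_add_cancel (Pi.single u 1) (v (p u))]
      exact add_mem (Submodule.mem_sup_left (hv _ u rfl)) (Submodule.mem_sup_right
        (Submodule.subset_span (Finset.mem_coe.2 (Finset.mem_image_of_mem v hu))))
    refine sub_mem (hmem _ ((hBad _).2 ⟨e, ?_⟩)) (hmem _ ((hBad _).2 ⟨e, ?_⟩))
    · simp [mem_cut, hne.symm]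
    · simp [mem_cut, hne]
  have h1 := Submodule.finrank_mono hle
  have h2 := Submodule.finrank_add_le_finrank_add_finrank S
    (Submodule.span (ZMod 2) ((Bad.image v : Finset (I → ZMod 2)) : Set (I → ZMod 2)))
  have h3 := (finrank_span_finset_le_card (R := ZMod 2) (Bad.image v)).trans
    Finset.card_image_le
  have h4 : (Set.finrank (ZMod 2) ((Bad.image v : Finset (I → ZMod 2)) : Set (I → ZMod 2))) =
    finrank (ZMod 2) (Submodule.span (ZMod 2)
      ((Bad.image v : Finset (I → ZMod 2)) : Set (I → ZMod 2))) := rfl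
  lia

end CutSpace

section Flow

variable {I E : Type} {s t : E → I} [Fintype E]

lemma sum_cut_eq_zero [Fintype I] {g : E → ZMod 2} (hg : ∑ e, g e • edgeVec s t e = 0) (X : Set I) :
    ∑ e ∈ cut s t Finset.univ X, g e = 0 := by
  have h := congrArg (coordSum X) hg
  rw [map_sum, map_zero] at h
  simp only [map_smul, coordSum_edgeVec, smul_eq_mul, mul_ite, mul_one, mul_zero] at h
  rw [← h, ← Finset.sum_filter]
  congr 1
  ext e
  simp

lemma exists_dependence_eq_one (F B : Finset E)
    (h : Submodule.span (ZMod 2) (edgeVec s t '' F) ⊔ Submodule.span (ZMod 2) (edgeVec s t '' B) =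
      Submodule.span (ZMod 2) (edgeVec s t '' F) ⊔
        Submodule.span (ZMod 2) (Set.range (edgeVec s t))) :
    ∃ g : E → ZMod 2, (∑ e, g e • edgeVec s t e = 0) ∧ ∀ e, e ∉ F →
      (e ∈ B → edgeVec s t e ∈ Submodule.span (ZMod 2) (edgeVec s t '' F)) → g e = 1 := by
  obtain ⟨T, hT⟩ : ∃ T : Finset E, ∀ e, e ∈ T ↔ e ∈ F ∨ (e ∈ B ∧
      edgeVec s t e ∉ Submodule.span (ZMod 2) (edgeVec s t '' F)) :=
    ⟨Finset.univ.filter (fun e => e ∈ F ∨ (e ∈ B ∧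
      edgeVec s t e ∉ Submodule.span (ZMod 2) (edgeVec s t '' F))), by simp⟩
  have hFT : Submodule.span (ZMod 2) (edgeVec s t '' F) ≤
      Submodule.span (ZMod 2) (edgeVec s t '' T) :=
    Submodule.span_mono (Set.image_mono fun e he => Finset.mem_coe.2 ((hT e).2 (Or.inl he)))
  have hBT : Submodule.span (ZMod 2) (edgeVec s t '' B) ≤
      Submodule.span (ZMod 2) (edgeVec s t '' T) := by
    refine Submodule.span_le.2 ?_
    rintro _ ⟨e, he, rfl⟩
    by_cases heF : edgeVec s t e ∈ Submodule.span (ZMod 2) (edgeVec s t '' F)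
    · exact hFT heF
    · exact Submodule.subset_span ⟨e, Finset.mem_coe.2 ((hT e).2 (Or.inr ⟨he, heF⟩)), rfl⟩
  have hall : ∀ e, edgeVec s t e ∈ Submodule.span (ZMod 2) (edgeVec s t '' T) := by
    intro e
    refine (h ▸ sup_le hFT hBT) (Submodule.mem_sup_right ?_)
    exact Submodule.subset_span ⟨e, rfl⟩
  obtain ⟨c, hc⟩ := (Submodule.mem_span_image_finset_iff_exists_fun' (ZMod 2)).1
    (sum_mem (t := Tᶜ) fun e _ => hall e)
  refine ⟨fun e => if e ∈ T then -c e else 1, ?_, fun e heF heB => ?_⟩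
  · rw [← Finset.sum_add_sum_compl T]
    have h1 : ∑ e ∈ T, (if e ∈ T then -c e else 1) • edgeVec s t e =
        -∑ e ∈ T, c e • edgeVec s t e := by
      rw [← Finset.sum_neg_distrib]
      refine Finset.sum_congr rfl fun e he => ?_
      rw [if_pos he, neg_smul]
    have h2 : ∑ e ∈ Tᶜ, (if e ∈ T then -c e else 1) • edgeVec s t e =
        ∑ e ∈ Tᶜ, edgeVec s t e := by
      refine Finset.sum_congr rfl fun e he => ?_
      rw [if_neg (Finset.mem_compl.1 he), one_smul]
    rw [h1, h2, hc, neg_add_cancel]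
  · refine if_neg fun he => ?_
    have := (hT e).1 he
    tauto

/-- If no edge cut avoiding `F` has one or three edges, there is a `Z2 × Z2` flow which vanishes
nowhere outside `F` and equals `(1, 1)` on the edges outside `F` spanned by `F`. -/
theorem exists_flow [Fintype I] (F : Finset E)
    (hF : ∀ X, Disjoint (cut s t Finset.univ X) F →
      (cut s t Finset.univ X).card ≠ 1 ∧ (cut s t Finset.univ X).card ≠ 3) :
    ∃ f : E → K4, (∀ X, ∑ e ∈ cut s t Finset.univ X, f e = 0) ∧ (∀ e, e ∉ F → f e ≠ 0) ∧
      ∀ e, e ∉ F → edgeVec s t e ∈ Submodule.span (ZMod 2) (edgeVec s t '' F) →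
        f e = (1, 1) := by
  induction hn : Fᶜ.card using Nat.strong_induction_on generalizing F with
  | _ n ih =>
  by_cases h2 : ∃ X, Disjoint (cut s t Finset.univ X) F ∧ (cut s t Finset.univ X).card = 2
  · obtain ⟨X, hX, hX2⟩ := h2
    obtain ⟨e, e', hee, hXe⟩ := Finset.card_eq_two.1 hX2
    have heX : e ∈ cut s t Finset.univ X := by simp [hXe]
    have heX' : e' ∈ cut s t Finset.univ X := by simp [hXe]
    have heF := Finset.disjoint_left.1 hX heX
    have heF' := Finset.disjoint_left.1 hX heX'
    obtain ⟨f, hf1, hf2, hf3⟩ := ih (insert e F)ᶜ.card (by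
      rw [← hn]
      refine Finset.card_lt_card ?_
      rw [Finset.compl_ssubset_compl]
      exact Finset.ssubset_insert heF) (insert e F)
      (fun Y hY => hF Y (hY.mono_right (Finset.subset_insert _ _))) rfl
    refine ⟨f, hf1, fun a ha => ?_, fun a ha hspan => ?_⟩
    · by_cases hae : a = e
      · subst hae
        have h3 := hf1 X
        rw [hXe, Finset.sum_pair hee] at h3
        intro h4
        rw [h4, zero_add] at h3
        exact hf2 e' (by simp [hee.symm, heF']) h3
      · exact hf2 a (by simp [hae, ha])
    · by_cases hae : a = e
      · subst hae
        have h3 : Submodule.span (ZMod 2) (edgeVec s t '' F) ≤ LinearMap.ker (coordSum X) := by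
          refine Submodule.span_le.2 ?_
          rintro _ ⟨b, hb, rfl⟩
          have hbX : b ∉ cut s t Finset.univ X := fun h => Finset.disjoint_left.1 hX h hb
          rw [SetLike.mem_coe, LinearMap.mem_ker, coordSum_edgeVec, if_neg hbX]
        have h4 := h3 hspan
        rw [LinearMap.mem_ker, coordSum_edgeVec, if_pos heX] at h4
        exact absurd h4 one_ne_zero
      · refine hf3 a (by simp [hae, ha]) (Submodule.span_mono (Set.image_mono ?_) hspan)
        exact_mod_cast Finset.subset_insert e F
  · push Not at h2
    obtain ⟨B, hB, hB'⟩ := exists_disjoint_spanning (edgeVec s t)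
      (Submodule.span (ZMod 2) (edgeVec s t '' F)) (fun A => by
        have h3 := two_mul_finrank_sup_span_le (s := s) (t := t)
          (Submodule.span (ZMod 2) (edgeVec s t '' F) ⊔
            Submodule.span (ZMod 2) (edgeVec s t '' A)) Aᶜ
          (fun e he => Finset.mem_compl.2 fun heA => he (Submodule.mem_sup_right
            (Submodule.subset_span ⟨e, heA, rfl⟩)))
          (fun X hX => by
            have h4 : Disjoint (cut s t Finset.univ X) F := Finset.disjoint_left.2
              fun e he heF => hX e he (Submodule.mem_sup_left
                (Submodule.subset_span ⟨e, heF, rfl⟩))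
            have h5 := hF X h4
            have h6 := h2 X h4
            rw [← Finset.card_eq_zero]
            lia)
        refine le_trans ?_ h3
        gcongr 2 * ?_
        exact Submodule.finrank_mono (sup_le_sup_right le_sup_left _))
    obtain ⟨g, hg, hg1⟩ := exists_dependence_eq_one F B hB
    obtain ⟨g', hg', hg1'⟩ := exists_dependence_eq_one F Bᶜ hB'
    refine ⟨fun e => (g e, g' e), fun X => ?_, fun e he h0 => ?_, fun e he hspan => ?_⟩
    · rw [Prod.ext_iff, Prod.fst_sum, Prod.snd_sum]
      exact ⟨sum_cut_eq_zero hg X, sum_cut_eq_zero hg' X⟩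
    · rw [Prod.ext_iff] at h0
      by_cases heB : e ∈ B
      · exact absurd ((hg1' e he fun h => absurd heB (Finset.mem_compl.1 h)).symm.trans h0.2)
          one_ne_zero
      · exact absurd ((hg1 e he fun h => absurd h heB).symm.trans h0.1) one_ne_zero
    · exact Prod.ext (hg1 e he fun _ => hspan) (hg1' e he fun _ => hspan)

end Flow

section Coloring

/-- The color of a matching edge with flow value `a`. -/
def matchingColor (a : K4) : Fin 6 := if a = (1, 1) then 4 else 5

/-- The color of an edge of the complementary 2-factor with flow value `a`. -/
def factorColor (a : K4) : Fin 6 :=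
  if a = (0, 0) then 0 else if a = (1, 0) then 1 else if a = (0, 1) then 2 else 3

/-- The colors at a vertex whose matching edge has flow value `a` and which has an edge of the
complementary 2-factor with flow value `b`. -/
def colorTriple (a b : K4) : Finset (Fin 6) :=
  {matchingColor a, factorColor b, factorColor (a + b)}

lemma matchingColor_ne_factorColor (a b : K4) : matchingColor a ≠ factorColor b := by
  revert a b
  decide

lemma factorColor_injective : Function.Injective factorColor := by
  intro a b
  revert a b
  decide

lemma card_colorTriple_union_self (a b c : K4) (ha : a ≠ 0) :
    (colorTriple a b ∪ colorTriple a c).card = 3 ∨ (colorTriple a b ∪ colorTriple a c).card = 5 := by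
  revert a b c
  decide

lemma card_colorTriple_union (a b c : K4) (ha : a ≠ 0) (hb : b ≠ 0)
    (hab : a = (1, 1) ∨ b = (1, 1)) :
    (colorTriple a c ∪ colorTriple b c).card = 3 ∨ (colorTriple a c ∪ colorTriple b c).card = 5 := by
  revert a b c
  decide

lemma eq_add_of_add_add_eq_zero {a b c : K4} (h : a + b + c = 0) : c = a + b := by
  revert a b c
  decide

lemma hasNormalColoring_of_flow {V : Type} [Fintype V] (G : SimpleGraph V) (hclaw : ClawFree G)
    (M : Set (Sym2 V)) (f : Sym2 V → K4)
    (hdeg : ∀ v, ∃ a b c, a ≠ b ∧ a ≠ c ∧ b ≠ c ∧ (∀ w, G.Adj v w ↔ w = a ∨ w = b ∨ w = c) ∧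
      s(v, a) ∈ M ∧ s(v, b) ∉ M ∧ s(v, c) ∉ M ∧ f s(v, a) + f s(v, b) + f s(v, c) = 0)
    (hne : ∀ u v, G.Adj u v → s(u, v) ∈ M → f s(u, v) ≠ 0)
    (htri : ∀ u v w, G.Adj u v → G.Adj v w → G.Adj u w → s(u, v) ∈ M → f s(u, v) = (1, 1))
    (htri' : ∀ u v w, G.Adj u v → G.Adj v w → G.Adj u w →
      s(u, v) ∈ M ∨ s(v, w) ∈ M ∨ s(u, w) ∈ M) :
    HasNormalColoring G 6 := by
  obtain ⟨col, hcol⟩ : ∃ col : Sym2 V → Fin 6, ∀ e,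
      col e = if e ∈ M then matchingColor (f e) else factorColor (f e) := ⟨_, fun _ => rfl⟩
  have hcolM : ∀ e ∈ M, col e = matchingColor (f e) := fun e he => by rw [hcol, if_pos he]
  have hcolF : ∀ e ∉ M, col e = factorColor (f e) := fun e he => by rw [hcol, if_neg he]
  have hat : ∀ v a b c, (∀ w, G.Adj v w ↔ w = a ∨ w = b ∨ w = c) →
      s(v, a) ∈ M → s(v, b) ∉ M → s(v, c) ∉ M → f s(v, a) + f s(v, b) + f s(v, c) = 0 →
      colorsAt G col v = colorTriple (f s(v, a)) (f s(v, b)) := by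
    intro v a b c hnb ha hb hc hsum
    have h1 : Finset.univ.filter (fun w => G.Adj v w) = {a, b, c} := by
      ext w
      simp [hnb]
    rw [colorsAt, h1, colorTriple, Finset.image_insert, Finset.image_insert,
      Finset.image_singleton, hcolM _ ha, hcolF _ hb, hcolF _ hc, eq_add_of_add_add_eq_zero hsum]
  have hmatch : ∀ v w, G.Adj v w → s(v, w) ∈ M →
      ∃ x, colorsAt G col v = colorTriple (f s(v, w)) x := by
    intro v w hvw hM
    obtain ⟨a, b, c, hab, hac, hbc, hnb, ha, hb, hc, hsum⟩ := hdeg v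
    have hwa : w = a := by
      rcases (hnb w).1 hvw with rfl | rfl | rfl
      · rfl
      · exact absurd hM hb
      · exact absurd hM hc
    subst hwa
    exact ⟨_, hat v w b c hnb ha hb hc hsum⟩
  have hfactor : ∀ v w, G.Adj v w → s(v, w) ∉ M → ∃ a, f s(v, a) ≠ 0 ∧
      (∀ d, G.Adj v d → s(v, d) ∈ M → d = a) ∧
      colorsAt G col v = colorTriple (f s(v, a)) (f s(v, w)) ∧
      (f s(v, a) = (1, 1) ∨ ∃ d, G.Adj v d ∧ G.Adj w d ∧ s(v, d) ∉ M) := by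
    intro v w hvw hM
    obtain ⟨a, b, c, hab, hac, hbc, hnb, ha, hb, hc, hsum⟩ := hdeg v
    obtain ⟨d, hbd, hd, hnb', hsum', hwd⟩ : ∃ d, a ≠ d ∧ s(v, d) ∉ M ∧
        (∀ x, G.Adj v x ↔ x = a ∨ x = w ∨ x = d) ∧ f s(v, a) + f s(v, w) + f s(v, d) = 0 ∧
        w ≠ d := by
      rcases (hnb w).1 hvw with rfl | rfl | rfl
      · exact absurd ha hM
      · exact ⟨c, hac, hc, hnb, hsum, hbc⟩
      · refine ⟨b, hab, hb, fun x => ?_, by rw [← hsum]; abel, hbc.symm⟩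
        rw [hnb]
        tauto
    have hva : G.Adj v a := (hnb' a).2 (Or.inl rfl)
    have hvd : G.Adj v d := (hnb' d).2 (Or.inr (Or.inr rfl))
    refine ⟨a, hne v a hva ha, fun x hx hxM => ?_, hat v a w d hnb' ha hM hd hsum', ?_⟩
    · rcases (hnb' x).1 hx with rfl | rfl | rfl
      · rfl
      · exact absurd hxM hM
      · exact absurd hxM hd
    · by_cases haw : G.Adj a w
      · exact Or.inl (htri v a w hva haw hvw ha)
      by_cases had : G.Adj a d
      · exact Or.inl (htri v a d hva had hvd ha)
      by_cases hwd' : G.Adj w d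
      · exact Or.inr ⟨d, hvd, hwd', hd⟩
      have haw' : a ≠ w := by
        rintro rfl
        exact hM ha
      exact absurd ⟨v, a, w, d, haw', hbd, hwd, hva, hvw, hvd, haw, had, hwd'⟩ hclaw
  refine ⟨col, ?_, ?_⟩
  · intro u v w huv huw hvw
    obtain ⟨a, b, c, hab, hac, hbc, hnb, ha, hb, hc, hsum⟩ := hdeg u
    have hfac : f s(u, b) ≠ f s(u, c) := by
      intro h
      rw [h, add_assoc, CharTwo.add_self_eq_zero, add_zero] at hsum
      exact hne u a ((hnb a).2 (Or.inl rfl)) ha hsum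
    have h1 : col s(u, a) ≠ col s(u, b) := by
      rw [hcolM _ ha, hcolF _ hb]
      exact matchingColor_ne_factorColor _ _
    have h2 : col s(u, a) ≠ col s(u, c) := by
      rw [hcolM _ ha, hcolF _ hc]
      exact matchingColor_ne_factorColor _ _
    have h3 : col s(u, b) ≠ col s(u, c) := by
      rw [hcolF _ hb, hcolF _ hc]
      exact fun h => hfac (factorColor_injective h)
    rcases (hnb v).1 huv with rfl | rfl | rfl <;> rcases (hnb w).1 huw with rfl | rfl | rfl
    all_goals first
      | exact absurd rfl hvw
      | assumption
      | (apply Ne.symm; assumption)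
  · intro u v huv
    by_cases hM : s(u, v) ∈ M
    · obtain ⟨x, hx⟩ := hmatch u v huv hM
      obtain ⟨y, hy⟩ := hmatch v u huv.symm (Sym2.eq_swap ▸ hM)
      rw [Sym2.eq_swap] at hy
      rw [hx, hy]
      exact card_colorTriple_union_self _ _ _ (hne u v huv hM)
    · have hM' : s(v, u) ∉ M := Sym2.eq_swap ▸ hM
      obtain ⟨a, ha, -, hau, ha'⟩ := hfactor u v huv hM
      obtain ⟨b, hb, hbuniq, hbv, -⟩ := hfactor v u huv.symm hM'
      rw [Sym2.eq_swap (a := v) (b := u)] at hbv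
      rw [hau, hbv]
      refine card_colorTriple_union _ _ _ ha hb (ha'.imp_right ?_)
      rintro ⟨d, hud, hvd, hd⟩
      rcases htri' u v d huv hvd hud with h | h | h
      · exact absurd h hM
      · rw [← hbuniq d hvd h]
        exact htri v d u hvd hud.symm huv.symm h
      · exact absurd h hd

end Coloring

section Assembly

variable {V : Type} {G : SimpleGraph V} {s t : G.edgeSet → V}

/-- The edge joining two adjacent vertices. -/
def edgeOfAdj {u v : V} (h : G.Adj u v) : G.edgeSet := ⟨s(u, v), h⟩

lemma edgeOfAdj_eq_iff {u v x y : V} {h : G.Adj u v} {h' : G.Adj x y} :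
    edgeOfAdj h = edgeOfAdj h' ↔ u = x ∧ v = y ∨ u = y ∧ v = x := by
  rw [← Sym2.eq_iff]
  exact Subtype.mk_eq_mk

lemma exists_eq_edgeOfAdj (e : G.edgeSet) : ∃ u v, ∃ h : G.Adj u v, e = edgeOfAdj h := by
  obtain ⟨e, he⟩ := e
  induction e with
  | h u v => exact ⟨u, v, he, rfl⟩

lemma edgeOfAdj_mem_cut_iff (hst : ∀ e, s(s e, t e) = e.1) {N : Finset G.edgeSet} {X : Set V} {u v : V}
    (h : G.Adj u v) : edgeOfAdj h ∈ cut s t N X ↔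
      edgeOfAdj h ∈ N ∧ ¬ (u ∈ X ↔ v ∈ X) := by
  rw [mem_cut]
  have h1 := Sym2.eq_iff.1 (hst (edgeOfAdj h))
  rcases h1 with ⟨h1, h2⟩ | ⟨h1, h2⟩
  · rw [h1, h2]
  · rw [h1, h2, iff_comm (a := u ∈ X)]

lemma edgeVec_edgeOfAdj (hst : ∀ e, s(s e, t e) = e.1) {u v : V} (h : G.Adj u v) :
    edgeVec s t (edgeOfAdj h) = Pi.single u 1 + Pi.single v 1 := by
  have h1 := Sym2.eq_iff.1 (hst (edgeOfAdj h))
  rcases h1 with ⟨h1, h2⟩ | ⟨h1, h2⟩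
  · rw [edgeVec, h1, h2]
    ext i
    exact CharTwo.sub_eq_add _ _
  · rw [edgeVec, h1, h2, add_comm]
    ext i
    exact CharTwo.sub_eq_add _ _

lemma card_cut_ne_one_of_bridgeless [Fintype V] (hbl : G.Bridgeless)
    (hst : ∀ e, s(s e, t e) = e.1) (X : Set V) : (cut s t Finset.univ X).card ≠ 1 := by
  intro hX
  obtain ⟨e, hXe⟩ := Finset.card_eq_one.1 hX
  obtain ⟨u, v, he, rfl⟩ := exists_eq_edgeOfAdj e
  have hwalk : ∀ a b, (G.deleteEdges {s(u, v)}).Walk a b → (a ∈ X ↔ b ∈ X) := by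
    intro a b p
    induction p with
    | nil => rfl
    | @cons a c b hac p ih =>
      rw [← ih]
      rw [SimpleGraph.deleteEdges_adj] at hac
      by_contra h
      have h1 := (edgeOfAdj_mem_cut_iff hst hac.1).2 ⟨Finset.mem_univ _, h⟩
      rw [hXe, Finset.mem_singleton, edgeOfAdj_eq_iff, ← Sym2.eq_iff] at h1
      exact hac.2 h1
  have h1 := hbl s(u, v)
  rw [SimpleGraph.isBridge_iff, not_not] at h1
  obtain ⟨p⟩ := h1
  have h2 : edgeOfAdj he ∈ cut s t Finset.univ X := by simp [hXe]
  exact ((edgeOfAdj_mem_cut_iff hst he).1 h2).2 (hwalk u v p)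

lemma cut_singleton_eq [Fintype V] (hst : ∀ e, s(s e, t e) = e.1) {v a b c : V}
    (hnb : ∀ w, G.Adj v w ↔ w = a ∨ w = b ∨ w = c) :
    cut s t Finset.univ {v} = {edgeOfAdj ((hnb a).2 (Or.inl rfl)),
      edgeOfAdj ((hnb b).2 (Or.inr (Or.inl rfl))), edgeOfAdj ((hnb c).2 (Or.inr (Or.inr rfl)))} := by
  ext e
  obtain ⟨x, y, hxy, rfl⟩ := exists_eq_edgeOfAdj e
  rw [edgeOfAdj_mem_cut_iff hst hxy]
  simp only [Finset.mem_univ, true_and, Set.mem_singleton_iff, Finset.mem_insert,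
    Finset.mem_singleton, edgeOfAdj_eq_iff]
  constructor
  · intro h
    by_cases hx : x = v
    · subst hx
      have := (hnb y).1 hxy
      tauto
    · have hy : y = v := by tauto
      subst hy
      have := (hnb x).1 hxy.symm
      tauto
  · have hne := hxy.ne
    have ha := ((hnb a).2 (Or.inl rfl)).ne
    have hb := ((hnb b).2 (Or.inr (Or.inl rfl))).ne
    have hc := ((hnb c).2 (Or.inr (Or.inr rfl))).ne
    grind only

lemma card_cut_singleton [Fintype V] (hst : ∀ e, s(s e, t e) = e.1) {v a b c : V}
    (hab : a ≠ b) (hac : a ≠ c) (hbc : b ≠ c) (hnb : ∀ w, G.Adj v w ↔ w = a ∨ w = b ∨ w = c) :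
    (cut s t Finset.univ {v}).card = 3 := by
  rw [cut_singleton_eq hst hnb]
  exact Finset.card_eq_three.2 ⟨_, _, _, by simp [edgeOfAdj_eq_iff]; grind only,
    by simp [edgeOfAdj_eq_iff]; grind only, by simp [edgeOfAdj_eq_iff]; grind only, rfl⟩

lemma sum_cut_singleton [Fintype V] {A : Type} [AddCommMonoid A] {f : G.edgeSet → A}
    (hst : ∀ e, s(s e, t e) = e.1) {v a b c : V}
    (hab : a ≠ b) (hac : a ≠ c) (hbc : b ≠ c) (hnb : ∀ w, G.Adj v w ↔ w = a ∨ w = b ∨ w = c) :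
    ∑ e ∈ cut s t Finset.univ {v}, f e = f (edgeOfAdj ((hnb a).2 (Or.inl rfl))) +
      f (edgeOfAdj ((hnb b).2 (Or.inr (Or.inl rfl)))) +
      f (edgeOfAdj ((hnb c).2 (Or.inr (Or.inr rfl)))) := by
  rw [cut_singleton_eq hst hnb, Finset.sum_insert, Finset.sum_pair, add_assoc]
  · rw [Ne, edgeOfAdj_eq_iff]
    grind only
  · simp only [Finset.mem_insert, Finset.mem_singleton, edgeOfAdj_eq_iff]
    grind only

lemma card_cut_triangle [Fintype V] (hst : ∀ e, s(s e, t e) = e.1) {u v w u' v' w' : V}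
    (huv : G.Adj u v) (hvw : G.Adj v w) (huw : G.Adj u w) (hu' : u' ≠ v ∧ u' ≠ w)
    (hv' : v' ≠ u ∧ v' ≠ w) (hw' : w' ≠ u ∧ w' ≠ v)
    (hu : ∀ x, G.Adj u x ↔ x = u' ∨ x = v ∨ x = w)
    (hv : ∀ x, G.Adj v x ↔ x = v' ∨ x = u ∨ x = w)
    (hw : ∀ x, G.Adj w x ↔ x = w' ∨ x = u ∨ x = v) :
    (cut s t Finset.univ {u, v, w}).card = 3 ∧
      ∀ e ∈ cut s t Finset.univ {u, v, w}, e.1 = s(u, u') ∨ e.1 = s(v, v') ∨ e.1 = s(w, w') := by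
  have huu' : G.Adj u u' := (hu u').2 (Or.inl rfl)
  have hvv' : G.Adj v v' := (hv v').2 (Or.inl rfl)
  have hww' : G.Adj w w' := (hw w').2 (Or.inl rfl)
  have hcut : cut s t Finset.univ {u, v, w} =
      {edgeOfAdj huu', edgeOfAdj hvv', edgeOfAdj hww'} := by
    ext e
    obtain ⟨x, y, hxy, rfl⟩ := exists_eq_edgeOfAdj e
    rw [edgeOfAdj_mem_cut_iff hst hxy]
    simp only [Finset.mem_univ, true_and, Set.mem_singleton_iff, Set.mem_insert_iff,
      Finset.mem_insert, Finset.mem_singleton, edgeOfAdj_eq_iff]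
    have h1 := huu'.ne
    have h2 := hvv'.ne
    have h3 := hww'.ne
    constructor
    · have key : ∀ x y, G.Adj x y → (x = u ∨ x = v ∨ x = w) → ¬ (y = u ∨ y = v ∨ y = w) →
          x = u ∧ y = u' ∨ x = v ∧ y = v' ∨ x = w ∧ y = w' := by
        rintro x y hxy (rfl | rfl | rfl) hy
        · rcases (hu y).1 hxy with h | h | h
          · exact Or.inl ⟨rfl, h⟩
          · exact absurd (Or.inr (Or.inl h)) hy
          · exact absurd (Or.inr (Or.inr h)) hy
        · rcases (hv y).1 hxy with h | h | h
          · exact Or.inr (Or.inl ⟨rfl, h⟩)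
          · exact absurd (Or.inl h) hy
          · exact absurd (Or.inr (Or.inr h)) hy
        · rcases (hw y).1 hxy with h | h | h
          · exact Or.inr (Or.inr ⟨rfl, h⟩)
          · exact absurd (Or.inl h) hy
          · exact absurd (Or.inr (Or.inl h)) hy
      intro h
      by_cases hx : x = u ∨ x = v ∨ x = w
      · rcases key x y hxy hx (fun hy => h (iff_of_true hx hy)) with h' | h' | h'
        · exact Or.inl (Or.inl h')
        · exact Or.inr (Or.inl (Or.inl h'))
        · exact Or.inr (Or.inr (Or.inl h'))
      · have hy : y = u ∨ y = v ∨ y = w := by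
          by_contra hy
          exact h (iff_of_false hx hy)
        rcases key y x hxy.symm hy hx with h' | h' | h'
        · exact Or.inl (Or.inr h'.symm)
        · exact Or.inr (Or.inl (Or.inr h'.symm))
        · exact Or.inr (Or.inr (Or.inr h'.symm))
    · clear hu hv hw hst
      grind only
  refine ⟨?_, ?_⟩
  · rw [hcut]
    refine Finset.card_eq_three.2 ⟨_, _, _, ?_, ?_, ?_, rfl⟩ <;>
    · rw [Ne, edgeOfAdj_eq_iff]
      have := huv.ne
      have := huw.ne
      have := hvw.ne
      grind only
  · intro e he
    rw [hcut] at he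
    simp only [Finset.mem_insert, Finset.mem_singleton] at he
    rcases he with rfl | rfl | rfl
    · exact Or.inl rfl
    · exact Or.inr (Or.inl rfl)
    · exact Or.inr (Or.inr rfl)

end Assembly

/-- Every claw-free bridgeless cubic graph admits a normal 6-edge-coloring. -/
theorem stmt_9 {V : Type} [Fintype V] [DecidableEq V] (G : SimpleGraph V)
    (hclaw : ClawFree G) (hbl : G.Bridgeless) (hcubic : G.IsRegularOfDegree 3) :
    HasNormalColoring G 6 := by
  have hnbr : ∀ v, ∃ a b c, a ≠ b ∧ a ≠ c ∧ b ≠ c ∧ ∀ w, G.Adj v w ↔ w = a ∨ w = b ∨ w = c := by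
    intro v
    obtain ⟨a, b, c, hab, hac, hbc, h⟩ := Finset.card_eq_three.1 (hcubic v)
    refine ⟨a, b, c, hab, hac, hbc, fun w => ?_⟩
    rw [← SimpleGraph.mem_neighborFinset, h]
    simp
  rcases isEmpty_or_nonempty V with hV | ⟨⟨v₀⟩⟩
  · exact ⟨fun _ => 0, fun u => isEmptyElim u, fun u => isEmptyElim u⟩
  have hends : ∀ e : G.edgeSet, ∃ p : V × V, s(p.1, p.2) = e.1 := by
    rintro ⟨e, he⟩
    induction e with
    | h x y => exact ⟨(x, y), rfl⟩
  choose p hp using hends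
  obtain ⟨s, t, hst⟩ : ∃ s t : G.edgeSet → V, ∀ e, s(s e, t e) = e.1 :=
    ⟨fun e => (p e).1, fun e => (p e).2, hp⟩
  have h3 : ∀ v, (cut s t Finset.univ {v}).card = 3 := by
    intro v
    obtain ⟨a, b, c, hab, hac, hbc, hnb⟩ := hnbr v
    exact card_cut_singleton hst hab hac hbc hnb
  have h1 := card_cut_ne_one_of_bridgeless hbl hst
  obtain ⟨e₀, -⟩ : (cut s t Finset.univ {v₀}).Nonempty := by
    rw [← Finset.card_pos, h3]
    norm_num
  have he₀ : s e₀ ≠ t e₀ := by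
    have h2 := e₀.2
    rw [← hst e₀, SimpleGraph.mem_edgeSet] at h2
    exact h2.ne
  obtain ⟨N, -, hN⟩ := exists_matching_meeting_three_cuts h3 h1 e₀ he₀
  obtain ⟨f, hf, hf0, hfspan⟩ := exists_flow (s := s) (t := t) Nᶜ (by
    intro X hX
    refine ⟨h1 X, fun hX3 => ?_⟩
    have h2 : cut s t N X = cut s t Finset.univ X := by
      ext e
      rw [mem_cut, mem_cut]
      refine ⟨fun h => ⟨Finset.mem_univ _, h.2⟩, fun h => ⟨?_, h.2⟩⟩
      by_contra heN
      exact Finset.disjoint_left.1 hX (mem_cut.2 h) (Finset.mem_compl.2 heN)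
    have h4 := hN X hX3
    rw [h2] at h4
    exact h1 X h4)
  obtain ⟨M, hM⟩ : ∃ M : Set (Sym2 V), ∀ (e : Sym2 V) (he : e ∈ G.edgeSet),
      e ∈ M ↔ (⟨e, he⟩ : G.edgeSet) ∈ N :=
    ⟨{e | ∃ he : e ∈ G.edgeSet, (⟨e, he⟩ : G.edgeSet) ∈ N}, fun e he => by simp [he]⟩
  obtain ⟨φ, hφ⟩ : ∃ φ : Sym2 V → K4, ∀ (e : Sym2 V) (he : e ∈ G.edgeSet), φ e = f ⟨e, he⟩ :=
    ⟨fun e => if he : e ∈ G.edgeSet then f ⟨e, he⟩ else 0, fun e he => by simp [he]⟩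
  have hdeg : ∀ v, ∃ a b c, a ≠ b ∧ a ≠ c ∧ b ≠ c ∧ (∀ w, G.Adj v w ↔ w = a ∨ w = b ∨ w = c) ∧
      s(v, a) ∈ M ∧ s(v, b) ∉ M ∧ s(v, c) ∉ M ∧ φ s(v, a) + φ s(v, b) + φ s(v, c) = 0 := by
    intro v
    have key : ∀ a b c, a ≠ b → a ≠ c → b ≠ c → (∀ w, G.Adj v w ↔ w = a ∨ w = b ∨ w = c) →
        s(v, a) ∈ M → s(v, b) ∉ M ∧ s(v, c) ∉ M ∧ φ s(v, a) + φ s(v, b) + φ s(v, c) = 0 := by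
      intro a b c hab hac hbc hnb haM
      have hva : G.Adj v a := (hnb a).2 (Or.inl rfl)
      have hvb : G.Adj v b := (hnb b).2 (Or.inr (Or.inl rfl))
      have hvc : G.Adj v c := (hnb c).2 (Or.inr (Or.inr rfl))
      have huniq : ∀ d, G.Adj v d → s(v, d) ∈ M → d = a := by
        intro d hvd hd
        have h4 := Finset.card_le_one.1 (hN {v} (h3 v)).le _
          ((edgeOfAdj_mem_cut_iff hst hvd).2 ⟨(hM _ _).1 hd, by simp [hvd.ne']⟩) _
          ((edgeOfAdj_mem_cut_iff hst hva).2 ⟨(hM _ _).1 haM, by simp [hva.ne']⟩)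
        rw [edgeOfAdj_eq_iff] at h4
        grind only
      refine ⟨fun h => hab (huniq b hvb h).symm, fun h => hac (huniq c hvc h).symm, ?_⟩
      have hsum := hf {v}
      rw [sum_cut_singleton hst hab hac hbc hnb] at hsum
      rw [hφ _ hva, hφ _ hvb, hφ _ hvc]
      exact hsum
    obtain ⟨a, b, c, hab, hac, hbc, hnb⟩ := hnbr v
    have hex : s(v, a) ∈ M ∨ s(v, b) ∈ M ∨ s(v, c) ∈ M := by
      obtain ⟨e, he⟩ := Finset.card_pos.1 ((hN {v} (h3 v)).symm ▸ Nat.one_pos)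
      have he2 : e ∈ cut s t Finset.univ {v} := mem_cut.2 ⟨Finset.mem_univ _, (mem_cut.1 he).2⟩
      have heM : e.1 ∈ M := (hM _ e.2).2 (mem_cut.1 he).1
      rw [cut_singleton_eq hst hnb] at he2
      simp only [Finset.mem_insert, Finset.mem_singleton] at he2
      rcases he2 with rfl | rfl | rfl
      · exact Or.inl heM
      · exact Or.inr (Or.inl heM)
      · exact Or.inr (Or.inr heM)
    rcases hex with h | h | h
    · exact ⟨a, b, c, hab, hac, hbc, hnb, h, key a b c hab hac hbc hnb h⟩
    · have hnb' : ∀ w, G.Adj v w ↔ w = b ∨ w = a ∨ w = c := fun w => by rw [hnb]; tauto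
      exact ⟨b, a, c, hab.symm, hbc, hac, hnb', h, key b a c hab.symm hbc hac hnb' h⟩
    · have hnb' : ∀ w, G.Adj v w ↔ w = c ∨ w = a ∨ w = b := fun w => by rw [hnb]; tauto
      exact ⟨c, a, b, hac.symm, hbc.symm, hab, hnb', h, key c a b hac.symm hbc.symm hab hnb' h⟩
  have hthird : ∀ u v w, G.Adj u v → G.Adj u w → v ≠ w → s(u, v) ∉ M → s(u, w) ∉ M →
      ∃ u', u' ≠ v ∧ u' ≠ w ∧ s(u, u') ∈ M ∧ ∀ x, G.Adj u x ↔ x = u' ∨ x = v ∨ x = w := by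
    intro u v w huv huw hvw hv hw
    obtain ⟨a, b, c, hab, hac, hbc, hnb, ha, hb, hc, -⟩ := hdeg u
    refine ⟨a, ?_, ?_, ha, fun x => ?_⟩
    · rintro rfl
      exact hv ha
    · rintro rfl
      exact hw ha
    rw [hnb]
    rcases (hnb v).1 huv with rfl | rfl | rfl <;> rcases (hnb w).1 huw with rfl | rfl | rfl <;>
      tauto
  have huniq : ∀ u v w, G.Adj u v → G.Adj u w → v ≠ w → s(u, v) ∈ M → s(u, w) ∉ M := by
    intro u v w huv huw hvw hv hw
    obtain ⟨a, b, c, hab, hac, hbc, hnb, ha, hb, hc, -⟩ := hdeg u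
    rcases (hnb v).1 huv with rfl | rfl | rfl <;> rcases (hnb w).1 huw with rfl | rfl | rfl <;>
      tauto
  refine hasNormalColoring_of_flow G hclaw M φ hdeg ?_ ?_ ?_
  · intro u v huv h
    rw [hφ _ huv]
    exact hf0 _ (fun hc => Finset.mem_compl.1 hc ((hM _ huv).1 h))
  · intro u v w huv hvw huw h
    have huwM := huniq u v w huv huw hvw.ne h
    have hvwM := huniq v u w huv.symm hvw huw.ne (Sym2.eq_swap ▸ h)
    rw [hφ _ huv]
    refine hfspan _ (fun hc => Finset.mem_compl.1 hc ((hM _ huv).1 h)) ?_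
    have h4 : edgeVec s t (edgeOfAdj huv) =
        edgeVec s t (edgeOfAdj huw) + edgeVec s t (edgeOfAdj hvw) := by
      rw [edgeVec_edgeOfAdj hst, edgeVec_edgeOfAdj hst, edgeVec_edgeOfAdj hst]
      ext i
      have h5 : ∀ x y z : ZMod 2, x + y = x + z + (y + z) := by decide
      exact h5 _ _ _
    change edgeVec s t (edgeOfAdj huv) ∈ _
    rw [h4]
    exact add_mem
      (Submodule.subset_span ⟨_, Finset.mem_coe.2 (Finset.mem_compl.2 fun h => huwM ((hM _ huw).2 h)), rfl⟩)
      (Submodule.subset_span ⟨_, Finset.mem_coe.2 (Finset.mem_compl.2 fun h => hvwM ((hM _ hvw).2 h)), rfl⟩)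
  · intro u v w huv hvw huw
    by_contra hcon
    push Not at hcon
    obtain ⟨huvM, hvwM, huwM⟩ := hcon
    have hvuM : s(v, u) ∉ M := Sym2.eq_swap ▸ huvM
    have hwvM : s(w, v) ∉ M := Sym2.eq_swap ▸ hvwM
    have hwuM : s(w, u) ∉ M := Sym2.eq_swap ▸ huwM
    obtain ⟨u', hu1, hu2, huM, hu⟩ := hthird u v w huv huw hvw.ne huvM huwM
    obtain ⟨v', hv1, hv2, hvM, hv⟩ := hthird v u w huv.symm hvw huw.ne hvuM hvwM
    obtain ⟨w', hw1, hw2, hwM, hw⟩ := hthird w u v huw.symm hvw.symm huv.ne hwuM hwvM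
    obtain ⟨hc3, hc⟩ := card_cut_triangle hst huv hvw huw ⟨hu1, hu2⟩ ⟨hv1, hv2⟩ ⟨hw1, hw2⟩ hu hv hw
    have h4 : cut s t N {u, v, w} = cut s t Finset.univ {u, v, w} := by
      ext e
      refine ⟨fun h => mem_cut.2 ⟨Finset.mem_univ _, (mem_cut.1 h).2⟩,
        fun h => mem_cut.2 ⟨(hM _ e.2).1 ?_, (mem_cut.1 h).2⟩⟩
      rcases hc e h with h | h | h <;> rw [h] <;> assumption
    have h5 := hN _ hc3
    rw [h4] at h5
    exact h1 _ h5
end
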